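/- Let M be a compact, embedded self-similar shrinker in ℝ³ of genus 0. Then M is a round sphere (namely the sphere of radius 2 centered at the origin). -/

import Mathlib

open scoped RealInnerProductSpace
open MeasureTheory
noncomputable section

abbrev E3 := EuclideanSpace ℝ (Fin 3)

/-- A smoothly embedded surface in `ℝ³`, given locally as the regular zero set of a
smooth defining function, together with the unit normal `ν` (the normalized gradient
of the local defining function, extended to a neighborhood). -/
structure Surface3 where
  carrier : Set E3
  ν : E3 → E3
  localDef : ∀ p ∈ carrier, ∃ U : Set E3, IsOpen U ∧ p ∈ U ∧ ∃ f : E3 → ℝ,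
    ContDiffOn ℝ (⊤ : ℕ∞) f U ∧ (∀ x ∈ U, (x ∈ carrier ↔ f x = 0)) ∧
    ∀ x ∈ U, gradient f x ≠ 0 ∧ ν x = ‖gradient f x‖⁻¹ • gradient f x

/-- The mean curvature of a surface, computed as the (ambient) divergence of the unit
normal extension; since `ν` has unit length near the surface this agrees with the
tangential divergence, i.e. the trace of the second fundamental form. -/
def meanCurv (S : Surface3) (p : E3) : ℝ :=
  ∑ i : Fin 3, ⟪fderiv ℝ S.ν p (EuclideanSpace.single i 1), EuclideanSpace.single i 1⟫

/-- The self-shrinker equation `H = ½⟨x, ν⟩`. -/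
def IsShrinker (S : Surface3) : Prop :=
  ∀ p ∈ S.carrier, meanCurv S p = (1/2) * ⟪p, S.ν p⟫

section Jets

open Filter Topology Set

variable {E : Type*} [NormedAddCommGroup E] [NormedSpace ℝ E]

/-- The curve `γ` is twice differentiable at `0`, with value `a`, velocity `v` and
acceleration `w` there. -/
def HasJet2 (γ : ℝ → E) (a v w : E) : Prop :=
  γ 0 = a ∧ ∃ γ' : ℝ → E, (∀ᶠ t in 𝓝 0, HasDerivAt γ (γ' t) t) ∧ γ' 0 = v ∧ HasDerivAt γ' w 0

namespace HasJet2

theorem hasDerivAt {γ : ℝ → E} {a v w : E} (h : HasJet2 γ a v w) : HasDerivAt γ v 0 := by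
  obtain ⟨-, γ', h1, rfl, -⟩ := h
  exact h1.self_of_nhds

theorem congr {γ δ : ℝ → E} {a v w : E} (h : HasJet2 γ a v w) (hd : δ =ᶠ[𝓝 0] γ) :
    HasJet2 δ a v w := by
  obtain ⟨h0, γ', h1, h2, h3⟩ := h
  refine ⟨hd.self_of_nhds.trans h0, γ', ?_, h2, h3⟩
  filter_upwards [h1, hd.eventually_nhds] with t ht ht'
  exact ht.congr_of_eventuallyEq ht'

theorem unique {γ : ℝ → E} {a v w a' v' w' : E} (h : HasJet2 γ a v w) (h' : HasJet2 γ a' v' w') :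
    a = a' ∧ v = v' ∧ w = w' := by
  have hv : v = v' := h.hasDerivAt.unique h'.hasDerivAt
  obtain ⟨h0, γ', h1, h2, h3⟩ := h
  obtain ⟨k0, δ', k1, k2, k3⟩ := h'
  refine ⟨h0.symm.trans k0, hv, h3.unique (k3.congr_of_eventuallyEq ?_)⟩
  filter_upwards [h1, k1] with t ht kt using ht.unique kt

theorem const (c : E) : HasJet2 (fun _ => c) c 0 0 :=
  ⟨rfl, fun _ => 0, .of_forall fun t => hasDerivAt_const t c, rfl, hasDerivAt_const 0 _⟩

theorem affine (c : ℝ) : HasJet2 (fun t : ℝ => c + t) c 1 0 :=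
  ⟨by simp, fun _ => 1, .of_forall fun t => (hasDerivAt_id t).const_add c, rfl,
    hasDerivAt_const 0 _⟩

theorem add {γ δ : ℝ → E} {a v w a' v' w' : E} (h : HasJet2 γ a v w) (h' : HasJet2 δ a' v' w') :
    HasJet2 (fun t => γ t + δ t) (a + a') (v + v') (w + w') := by
  obtain ⟨rfl, γ', h1, rfl, h3⟩ := h
  obtain ⟨rfl, δ', k1, rfl, k3⟩ := h'
  refine ⟨rfl, fun t => γ' t + δ' t, ?_, rfl, h3.add k3⟩
  filter_upwards [h1, k1] with t ht kt using ht.add kt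

theorem neg {γ : ℝ → E} {a v w : E} (h : HasJet2 γ a v w) :
    HasJet2 (fun t => -γ t) (-a) (-v) (-w) := by
  obtain ⟨rfl, γ', h1, rfl, h3⟩ := h
  refine ⟨rfl, fun t => -γ' t, ?_, rfl, h3.neg⟩
  filter_upwards [h1] with t ht using ht.neg

theorem sub {γ δ : ℝ → E} {a v w a' v' w' : E} (h : HasJet2 γ a v w) (h' : HasJet2 δ a' v' w') :
    HasJet2 (fun t => γ t - δ t) (a - a') (v - v') (w - w') := by
  simpa only [sub_eq_add_neg] using h.add h'.neg

theorem smul {γ : ℝ → E} {f : ℝ → ℝ} {a v w : E} {a' v' w' : ℝ} (h' : HasJet2 f a' v' w')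
    (h : HasJet2 γ a v w) :
    HasJet2 (fun t => f t • γ t) (a' • a) (a' • v + v' • a)
      (a' • w + (2 * v') • v + w' • a) := by
  have h0 := h.hasDerivAt
  have k0 := h'.hasDerivAt
  obtain ⟨rfl, γ', h1, rfl, h3⟩ := h
  obtain ⟨rfl, f', k1, rfl, k3⟩ := h'
  refine ⟨rfl, fun t => f t • γ' t + f' t • γ t, ?_, rfl, ?_⟩
  · filter_upwards [h1, k1] with t ht kt using kt.smul ht
  · refine ((k0.smul h3).add (k3.smul h0)).congr_deriv ?_
    module

theorem mul {f g : ℝ → ℝ} {a v w a' v' w' : ℝ} (h : HasJet2 f a v w) (h' : HasJet2 g a' v' w') :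
    HasJet2 (fun t => f t * g t) (a * a') (a * v' + v * a') (a * w' + 2 * v * v' + w * a') :=
  h.smul h'

theorem inner {F : Type*} [NormedAddCommGroup F] [InnerProductSpace ℝ F]
    {γ δ : ℝ → F} {a v w a' v' w' : F} (h : HasJet2 γ a v w) (h' : HasJet2 δ a' v' w') :
    HasJet2 (fun t => ⟪γ t, δ t⟫) ⟪a, a'⟫ (⟪a, v'⟫ + ⟪v, a'⟫)
      (⟪a, w'⟫ + 2 * ⟪v, v'⟫ + ⟪w, a'⟫) := by
  have h0 := h.hasDerivAt
  have k0 := h'.hasDerivAt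
  obtain ⟨rfl, γ', h1, rfl, h3⟩ := h
  obtain ⟨rfl, δ', k1, rfl, k3⟩ := h'
  refine ⟨rfl, fun t => ⟪γ t, δ' t⟫ + ⟪γ' t, δ t⟫, ?_, rfl, ?_⟩
  · filter_upwards [h1, k1] with t ht kt using ht.inner ℝ kt
  · refine ((h0.inner ℝ k3).add (h3.inner ℝ k0)).congr_deriv ?_
    ring

theorem comp {f φ φ' : ℝ → ℝ} {a v w c : ℝ} (h : HasJet2 f a v w)
    (hφ : ∀ᶠ y in 𝓝 a, HasDerivAt φ (φ' y) y) (hφ' : HasDerivAt φ' c a) :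
    HasJet2 (fun t => φ (f t)) (φ a) (φ' a * v) (φ' a * w + c * v ^ 2) := by
  have h0 := h.hasDerivAt
  obtain ⟨rfl, f', h1, rfl, h3⟩ := h
  refine ⟨rfl, fun t => φ' (f t) * f' t, ?_, rfl, ?_⟩
  · filter_upwards [h1, h0.continuousAt.eventually hφ] with t ht kt using kt.comp t ht
  · refine ((hφ'.comp 0 h0).mul h3).congr_deriv ?_
    simp only [Function.comp_apply]
    ring

theorem exp {f : ℝ → ℝ} {a v w : ℝ} (h : HasJet2 f a v w) :
    HasJet2 (fun t => Real.exp (f t)) (Real.exp a) (Real.exp a * v)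
      (Real.exp a * w + Real.exp a * v ^ 2) :=
  h.comp (.of_forall fun y => Real.hasDerivAt_exp y) (Real.hasDerivAt_exp a)

theorem inv {f : ℝ → ℝ} {a v w : ℝ} (h : HasJet2 f a v w) (ha : a ≠ 0) :
    HasJet2 (fun t => (f t)⁻¹) a⁻¹ (-(a ^ 2)⁻¹ * v) (-(a ^ 2)⁻¹ * w + 2 * (a ^ 3)⁻¹ * v ^ 2) := by
  refine h.comp (φ' := fun y => -(y ^ 2)⁻¹) ?_ ?_
  · filter_upwards [isOpen_ne.mem_nhds ha] with y hy using hasDerivAt_inv hy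
  · refine (((hasDerivAt_pow 2 a).inv (pow_ne_zero 2 ha)).neg).congr_deriv ?_
    field_simp
    push_cast
    ring

theorem sqrt {f : ℝ → ℝ} {v w : ℝ} (h : HasJet2 f 1 v w) :
    HasJet2 (fun t => √(f t)) 1 (v / 2) (w / 2 - v ^ 2 / 4) := by
  have key := h.comp (φ := Real.sqrt) (φ' := fun y => 1 / (2 * √y)) (c := -1 / 4) ?_ ?_
  · convert key using 1 <;> simp <;> ring
  · filter_upwards [isOpen_ne.mem_nhds (one_ne_zero : (1 : ℝ) ≠ 0)] with y hy
    exact Real.hasDerivAt_sqrt hy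
  · have h1 := ((Real.hasDerivAt_sqrt (one_ne_zero : (1 : ℝ) ≠ 0)).const_mul 2).inv (by simp)
    simp only [one_div]
    refine h1.congr_deriv ?_
    simp
    norm_num

theorem hasDerivAt_of_isLocalMin {f : ℝ → ℝ} {a v w : ℝ} (h : HasJet2 f a v w)
    (hmin : ∀ᶠ t in 𝓝 0, a ≤ f t) : v = 0 ∧ 0 ≤ w := by
  obtain ⟨rfl, f', h1, rfl, h3⟩ := h
  have hv : f' 0 = 0 := IsLocalMin.hasDerivAt_eq_zero hmin h1.self_of_nhds
  refine ⟨hv, ?_⟩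
  by_contra! hw
  have hneg : ∀ᶠ t in 𝓝[>] (0 : ℝ), f' t < 0 := by
    have := (hasDerivAt_iff_tendsto_slope.1 h3).mono_left
      (nhdsWithin_mono (0 : ℝ) (fun t (ht : (0 : ℝ) < t) => ht.ne'))
    filter_upwards [this.eventually (gt_mem_nhds hw), self_mem_nhdsWithin] with t ht ht0
    rw [slope_def_field, hv, sub_zero, sub_zero, div_lt_iff₀ ht0, zero_mul] at ht
    exact ht
  obtain ⟨η, hη, hη'⟩ := mem_nhdsGT_iff_exists_Ioo_subset.1 hneg
  obtain ⟨r, hr, hr'⟩ := Metric.eventually_nhds_iff.1 (h1.and hmin)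
  have hη0 : (0 : ℝ) < η := hη
  set s := min η r / 2 with hs
  have hs0 : 0 < s := by positivity
  have hsη : s < η := by have := min_le_left η r; linarith [lt_min hη0 hr]
  have hsr : s < r := by have := min_le_right η r; linarith [lt_min hη0 hr]
  have hd : ∀ t ∈ Icc 0 s, HasDerivAt f (f' t) t := fun t ht =>
    (hr' (by rw [Real.dist_eq, sub_zero, abs_of_nonneg ht.1]; exact ht.2.trans_lt hsr)).1
  obtain ⟨c, hc, hc'⟩ := exists_hasDerivAt_eq_slope f f' hs0
    (fun t ht => (hd t ht).continuousAt.continuousWithinAt)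
    (fun t ht => hd t ⟨ht.1.le, ht.2.le⟩)
  have h4 : f' c < 0 := hη' ⟨hc.1, hc.2.trans hsη⟩
  have h5 := (hr' (y := s) (by rw [Real.dist_eq, sub_zero, abs_of_pos hs0]; exact hsr)).2
  rw [hc', sub_zero, div_lt_iff₀ hs0, zero_mul] at h4
  linarith

end HasJet2

end Jets

section PlanarTopology

open Filter Topology Set

/-- Along a path from `b` to `b'`, the function `(z - b) / (z - b')` has a continuous logarithm
off the path. -/
theorem exists_log_off_path {b b' : ℂ} (γ : Path b b') :
    ∃ l : ℂ → ℂ, ContinuousOn l (range γ)ᶜ ∧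
      ∀ z ∈ (range γ)ᶜ, Complex.exp (l z) = (z - b) / (z - b') := by
  classical
  let A := {z : ℂ // z ∈ (range γ)ᶜ}
  have hne : ∀ (t : unitInterval) (z : A), z.1 - γ t ≠ 0 := fun t z h =>
    z.2 ⟨t, (sub_eq_zero.1 h).symm⟩
  let H : C(unitInterval × A, {z : ℂ // z ≠ 0}) :=
    ⟨fun q : unitInterval × A => ⟨(q.2.1 - γ 0) / (q.2.1 - γ q.1), div_ne_zero (hne 0 q.2) (hne q.1 q.2)⟩, by
      refine Continuous.subtype_mk (Continuous.div ?_ ?_ fun q : unitInterval × A => hne q.1 q.2) _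
      · exact (continuous_subtype_val.comp continuous_snd).sub continuous_const
      · exact (continuous_subtype_val.comp continuous_snd).sub (γ.continuous.comp continuous_fst)⟩
  have H0 : ∀ a : A, H (0, a) =
      (fun z : ℂ ↦ (⟨_, z.exp_ne_zero⟩ : {z : ℂ // z ≠ 0})) ((ContinuousMap.const A (0 : ℂ)) a) := by
    intro a
    refine Subtype.ext ?_
    simp only [H, ContinuousMap.coe_mk, ContinuousMap.const_apply, Complex.exp_zero]
    exact div_self (hne 0 a)
  let G := Complex.isCoveringMap_exp.liftHomotopy H (ContinuousMap.const A 0) H0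
  have hG : ∀ q : unitInterval × A, Complex.exp (G q) = (q.2.1 - γ 0) / (q.2.1 - γ q.1) := fun q =>
    congrArg Subtype.val (congrFun (Complex.isCoveringMap_exp.liftHomotopy_lifts H
      (ContinuousMap.const A 0) H0) q)
  refine ⟨fun z => if hz : z ∈ (range γ)ᶜ then G (1, ⟨z, hz⟩) else 0, ?_, ?_⟩
  · rw [continuousOn_iff_continuous_domRestrict]
    have : (range γ)ᶜ.domRestrict (fun z => if hz : z ∈ (range γ)ᶜ then G (1, ⟨z, hz⟩) else 0) =
        fun a : A => G (1, a) := by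
      funext a
      exact dif_pos a.2
    rw [this]
    exact G.continuous.comp (by fun_prop)
  · intro z hz
    simp only [dif_pos hz]
    rw [hG]
    simp

/-- Two continuous logarithms of the same function differ by a constant on a preconnected set. -/
theorem logs_differ_by_const {P : Set ℂ} (hP : IsPreconnected P) {l₁ l₂ : ℂ → ℂ}
    (h₁ : ContinuousOn l₁ P) (h₂ : ContinuousOn l₂ P)
    (he : ∀ z ∈ P, Complex.exp (l₁ z) = Complex.exp (l₂ z)) :
    ∃ c, Complex.exp c = 1 ∧ ∀ z ∈ P, l₁ z = l₂ z + c := by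
  rcases P.eq_empty_or_nonempty with rfl | ⟨a, ha⟩
  · exact ⟨0, by simp, by simp⟩
  have hc : Complex.exp (l₁ a - l₂ a) = 1 := by
    rw [Complex.exp_sub, he a ha, div_self (Complex.exp_ne_zero _)]
  refine ⟨l₁ a - l₂ a, hc, ?_⟩
  refine Complex.isCoveringMap_exp.eqOn_of_comp_eqOn hP h₁ (h₂.add continuousOn_const) ?_ ha ?_
  · intro z hz
    refine Subtype.ext ?_
    simp only [Function.comp_apply]
    rw [Complex.exp_add, hc, mul_one, he z hz]
  · simp

/-- The function `(z - b) / (z - b')` has no continuous logarithm on a punctured neighbourhood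
of `b`. -/
theorem no_log_punctured_nhds {b b' : ℂ} (hb : b ≠ b') {N : Set ℂ} (hN : N ∈ 𝓝 b) {l : ℂ → ℂ}
    (hl : ContinuousOn l (N \ {b, b'}))
    (he : ∀ z ∈ N \ {b, b'}, Complex.exp (l z) = (z - b) / (z - b')) : False := by
  have hd : 0 < dist b b' := dist_pos.2 hb
  obtain ⟨r, hr, hrN⟩ := Metric.mem_nhds_iff.1 hN
  set ρ := min r (dist b b') / 2 with hρ
  have hρ0 : 0 < ρ := by positivity
  have hρr : ρ < r := by have := min_le_left r (dist b b'); linarith [lt_min hr hd]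
  have hρd : ρ < dist b b' := by have := min_le_right r (dist b b'); linarith [lt_min hr hd]
  let c : ℝ → ℂ := fun θ => b + ρ * Complex.exp (θ * Complex.I)
  have hcc : Continuous c := by fun_prop
  have hcb : ∀ θ, ‖c θ - b‖ = ρ := by
    intro θ
    simp only [c, add_sub_cancel_left, norm_mul, Complex.norm_real, Real.norm_eq_abs,
      Complex.norm_exp_ofReal_mul_I, mul_one, abs_of_pos hρ0]
  have hcN : ∀ θ, c θ ∈ N \ {b, b'} := by
    intro θ
    refine ⟨hrN (by rw [Metric.mem_ball, dist_eq_norm, hcb]; exact hρr), ?_⟩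
    rintro (h | h)
    · have := hcb θ
      rw [h, sub_self, norm_zero] at this
      exact hρ0.ne this
    · have := hcb θ
      rw [mem_singleton_iff.1 h, ← dist_eq_norm, dist_comm] at this
      exact hρd.ne' this
  have hbb : b - b' ≠ 0 := sub_ne_zero.2 hb
  have hslit : ∀ θ, (c θ - b') / (b - b') ∈ Complex.slitPlane := by
    intro θ
    have h1 : (c θ - b') / (b - b') = 1 + (c θ - b) / (b - b') := by
      field_simp
      ring
    have h2 : ‖(c θ - b) / (b - b')‖ < 1 := by
      rw [norm_div, hcb, div_lt_one (norm_pos_iff.2 hbb), ← dist_eq_norm]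
      exact hρd
    left
    rw [h1, Complex.add_re, Complex.one_re]
    have := (abs_le.1 (Complex.abs_re_le_norm ((c θ - b) / (b - b')))).1
    linarith
  let L : ℝ → ℂ := fun θ => l (c θ) + Complex.log ((c θ - b') / (b - b')) - θ * Complex.I
  have hL : Continuous L := by
    refine ((hl.comp_continuous hcc hcN).add ?_).sub (by fun_prop)
    exact Continuous.clog (by fun_prop) hslit
  have hexp : ∀ θ, Complex.exp (L θ) = ρ / (b - b') := by
    intro θ
    have h3 : c θ - b' ≠ 0 := fun h => (hcN θ).2 (Or.inr (sub_eq_zero.1 h))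
    simp only [L]
    rw [Complex.exp_sub, Complex.exp_add, he _ (hcN θ), Complex.exp_log
      (Complex.slitPlane_ne_zero (hslit θ))]
    have h4 : c θ - b = ρ * Complex.exp (θ * Complex.I) := by simp [c]
    have h5 := Complex.exp_ne_zero (θ * Complex.I)
    rw [h4]
    field_simp
  have key := Complex.isCoveringMap_exp.constOn_of_comp (g := L) isPreconnected_univ
    hL.continuousOn (fun a _ a' _ => Subtype.ext ((hexp a).trans (hexp a').symm))
    (mem_univ 0) (mem_univ (2 * Real.pi))
  have hc2 : c (2 * Real.pi) = c 0 := by simp [c]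
  simp only [L, hc2] at key
  have : (2 * Real.pi * Complex.I : ℂ) = 0 := by
    push_cast at key
    linear_combination key
  exact Complex.two_pi_I_ne_zero this

theorem joinedIn_image_segment {φ : ℝ → ℂ} {s : Set ℝ} {a b : ℝ} (hab : a ≤ b)
    (hs : Icc a b ⊆ s) (hφ : ContinuousOn φ s) : JoinedIn (φ '' Icc a b) (φ a) (φ b) := by
  have h : IsPathConnected (Icc a b) := (convex_Icc a b).isPathConnected ⟨a, left_mem_Icc.2 hab⟩
  exact (h.image' (hφ.mono hs)).joinedIn _ (mem_image_of_mem _ (left_mem_Icc.2 hab)) _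
    (mem_image_of_mem _ (right_mem_Icc.2 hab))

/-- A planar saddle: two disjoint connected open sets cannot contain the two punctured axes of
a topological square in the plane, respectively. -/
theorem planar_saddle_false {Φ : ℝ × ℝ → ℂ} {V₁ V₂ : Set ℂ}
    (hc : ContinuousOn Φ (Metric.ball 0 1)) (hi : InjOn Φ (Metric.ball 0 1))
    (ho : ∀ U ⊆ Metric.ball (0 : ℝ × ℝ) 1, IsOpen U → IsOpen (Φ '' U))
    (hV₁ : IsPreconnected V₁) (hV₂ : IsOpen V₂) (hV₂' : IsPreconnected V₂)
    (hd : Disjoint V₁ V₂) (h0 : Φ 0 ∉ V₁) (h0' : Φ 0 ∉ V₂)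
    (hx : ∀ x : ℝ, |x| < 1 → x ≠ 0 → Φ (x, 0) ∈ V₁)
    (hy : ∀ y : ℝ, |y| < 1 → y ≠ 0 → Φ (0, y) ∈ V₂) : False := by
  have mem_ball : ∀ (x y r : ℝ), (x, y) ∈ Metric.ball (0 : ℝ × ℝ) r ↔ |x| < r ∧ |y| < r := by
    intro x y r
    rw [Metric.mem_ball, Prod.dist_eq, max_lt_iff]
    simp
  have hsub : ∀ r ≤ (1 : ℝ), Metric.ball (0 : ℝ × ℝ) r ⊆ Metric.ball 0 1 := fun r hr =>
    Metric.ball_subset_ball hr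
  let φ : ℝ → ℂ := fun y => Φ (0, y)
  have hφ : ContinuousOn φ (Ioo (-1) 1) := by
    refine hc.comp (by fun_prop) fun y hy => ?_
    rw [mem_ball]
    exact ⟨by simp, abs_lt.2 hy⟩
  have hhalf : |(1 / 2 : ℝ)| < 1 := by rw [abs_of_pos] <;> norm_num
  have hhalf' : |(-(1 / 2) : ℝ)| < 1 := by rw [abs_neg]; exact hhalf
  have hJ : JoinedIn V₂ (φ (1 / 2)) (φ (-(1 / 2))) := by
    have hcon : IsConnected V₂ := ⟨⟨_, hy (1 / 2) hhalf (by norm_num)⟩, hV₂'⟩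
    exact ((hV₂.isConnected_iff_isPathConnected).1 hcon).joinedIn _
      (hy (1 / 2) hhalf (by norm_num)) _ (hy _ hhalf' (by norm_num))
  obtain ⟨J, hJ⟩ := hJ
  have hJc : IsClosed (range J) := (isCompact_range J.continuous).isClosed
  have hJV : range J ⊆ V₂ := by rintro _ ⟨t, rfl⟩; exact hJ t
  obtain ⟨δ, hδ0, hδ1, hδJ⟩ : ∃ δ : ℝ, 0 < δ ∧ δ < 1 / 2 ∧
      ∀ z ∈ Metric.ball (0 : ℝ × ℝ) δ, Φ z ∉ range J := by
    have h1 : ContinuousAt Φ 0 := hc.continuousAt (Metric.ball_mem_nhds _ one_pos)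
    have h2 := h1.eventually (hJc.isOpen_compl.mem_nhds fun h => h0' (hJV h))
    obtain ⟨r, hr, hr'⟩ := Metric.eventually_nhds_iff_ball.1 h2
    refine ⟨min r (1 / 3), by positivity, (min_le_right _ _).trans_lt (by norm_num), ?_⟩
    exact fun z hz => hr' z (Metric.ball_subset_ball (min_le_left _ _) hz)
  have hB : Metric.ball (0 : ℝ × ℝ) δ ⊆ Metric.ball 0 1 := hsub δ (by linarith)
  set N := Φ '' Metric.ball (0 : ℝ × ℝ) δ with hN
  have hNo : IsOpen N := ho _ hB Metric.isOpen_ball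
  set b := φ (δ / 2) with hb
  set b' := φ (-(δ / 2)) with hb'
  set Kσ := φ '' Icc (-(δ / 2)) (δ / 2) with hKσ
  set Kβ := φ '' Icc (δ / 2) (1 / 2) ∪ range J ∪ φ '' Icc (-(1 / 2)) (-(δ / 2)) with hKβ
  have hIcc : ∀ x y : ℝ, -(1 / 2) ≤ x → y ≤ 1 / 2 → Icc x y ⊆ Ioo (-1) 1 := fun x y hx hy z hz =>
    ⟨by linarith [hz.1], by linarith [hz.2]⟩
  have hclosed : ∀ x y : ℝ, -(1 / 2) ≤ x → y ≤ 1 / 2 → IsClosed (φ '' Icc x y) :=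
    fun x y hx hy => (isCompact_Icc.image_of_continuousOn (hφ.mono (hIcc x y hx hy))).isClosed
  have hKσc : IsClosed Kσ := hclosed _ _ (by linarith) (by linarith)
  have hKβc : IsClosed Kβ := ((hclosed _ _ (by linarith) le_rfl).union hJc).union
    (hclosed _ _ le_rfl (by linarith))
  -- the inner arc
  obtain ⟨σ, hσ⟩ : JoinedIn Kσ b b' :=
    (joinedIn_image_segment (by linarith) (hIcc _ _ (by linarith) (by linarith)) hφ).symm
  -- the outer arc
  obtain ⟨β, hβ⟩ : JoinedIn Kβ b b' := by
    have h1 : JoinedIn (φ '' Icc (δ / 2) (1 / 2)) b (φ (1 / 2)) :=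
      joinedIn_image_segment (by linarith) (hIcc _ _ (by linarith) le_rfl) hφ
    have h2 : JoinedIn (range J) (φ (1 / 2)) (φ (-(1 / 2))) := ⟨J, fun t => mem_range_self t⟩
    have h3 : JoinedIn (φ '' Icc (-(1 / 2)) (-(δ / 2))) (φ (-(1 / 2))) b' :=
      joinedIn_image_segment (by linarith) (hIcc _ _ le_rfl (by linarith)) hφ
    refine ((h1.mono ?_).trans (h2.mono ?_)).trans (h3.mono ?_)
    · exact subset_union_left.trans subset_union_left
    · exact subset_union_right.trans subset_union_left
    · exact subset_union_right
  have hσr : ∀ z ∈ Kσ, ∃ y, |y| ≤ δ / 2 ∧ z = φ y := by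
    rintro _ ⟨y, hy, rfl⟩
    exact ⟨y, abs_le.2 hy, rfl⟩
  have hβr : ∀ z ∈ Kβ, (∃ y, δ / 2 ≤ |y| ∧ |y| ≤ 1 / 2 ∧ z = φ y) ∨ z ∈ range J := by
    rintro _ ((⟨y, hy, rfl⟩ | h) | ⟨y, hy, rfl⟩)
    · have : |y| = y := abs_of_nonneg (by linarith [hy.1])
      exact Or.inl ⟨y, by rw [this]; exact hy.1, by rw [this]; exact hy.2, rfl⟩
    · exact Or.inr h
    · have : |y| = -y := abs_of_nonpos (by linarith [hy.2])
      exact Or.inl ⟨y, by rw [this]; linarith [hy.2], by rw [this]; linarith [hy.1], rfl⟩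
  have hφV : ∀ y, |y| < 1 → φ y ∉ V₁ := by
    intro y hy1 hyV
    rcases eq_or_ne y 0 with rfl | hne
    · exact h0 hyV
    · exact Set.disjoint_left.1 hd hyV (hy y hy1 hne)
  have hφinj : ∀ x y y' : ℝ, (x, y) ∈ Metric.ball (0 : ℝ × ℝ) 1 → |y'| < 1 →
      Φ (x, y) = φ y' → x = 0 ∧ y = y' := by
    intro x y y' h h' he
    have := hi h ((mem_ball 0 y' 1).2 ⟨by simp, h'⟩) he
    exact Prod.mk_inj.1 this
  set P : Set ℂ := Φ '' (Metric.ball 0 δ ∩ {z | 0 < z.1}) ∪ V₁ ∪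
    Φ '' (Metric.ball 0 δ ∩ {z | z.1 < 0}) with hP
  have hPc : IsPreconnected P := by
    have hconv : ∀ C : Set (ℝ × ℝ), Convex ℝ C →
        IsPreconnected (Φ '' (Metric.ball 0 δ ∩ C)) := fun C hC =>
      (((convex_ball (0 : ℝ × ℝ) δ).inter hC).isPreconnected).image _
        (hc.mono (inter_subset_left.trans hB))
    have hm : (δ / 2, (0 : ℝ)) ∈ Metric.ball (0 : ℝ × ℝ) δ :=
      (mem_ball _ _ _).2 ⟨by rw [abs_of_pos] <;> linarith, by simpa using hδ0⟩
    have hm' : (-(δ / 2), (0 : ℝ)) ∈ Metric.ball (0 : ℝ × ℝ) δ :=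
      (mem_ball _ _ _).2 ⟨by rw [abs_neg, abs_of_pos] <;> linarith, by simpa using hδ0⟩
    refine IsPreconnected.union (Φ (-(δ / 2), 0)) (Or.inr ?_) ⟨_, ⟨hm', ?_⟩, rfl⟩
      (IsPreconnected.union (Φ (δ / 2, 0)) ⟨_, ⟨hm, ?_⟩, rfl⟩ ?_ ?_ hV₁) ?_
    · exact hx _ ((mem_ball _ _ _).1 (hB hm')).1 (by linarith)
    · exact neg_neg_of_pos (half_pos hδ0)
    · exact half_pos hδ0
    · exact hx _ ((mem_ball _ _ _).1 (hB hm)).1 (by linarith)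
    · exact hconv _ ((convex_Ioi (0 : ℝ)).linear_preimage (LinearMap.fst ℝ ℝ ℝ))
    · exact hconv _ ((convex_Iio (0 : ℝ)).linear_preimage (LinearMap.fst ℝ ℝ ℝ))
  have hPaxis : ∀ y, |y| < 1 → φ y ∉ P := by
    rintro y hy1 ((⟨⟨u, v⟩, ⟨hz, hz'⟩, he⟩ | h) | ⟨⟨u, v⟩, ⟨hz, hz'⟩, he⟩)
    · exact (ne_of_gt hz') (hφinj u v y (hB hz) hy1 he).1
    · exact hφV y hy1 h
    · exact (ne_of_lt hz') (hφinj u v y (hB hz) hy1 he).1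
  have hPσ : P ⊆ Kσᶜ := by
    intro z hz hzσ
    obtain ⟨y, hy1, rfl⟩ := hσr z hzσ
    exact hPaxis y (by linarith) hz
  have hPβ : P ⊆ Kβᶜ := by
    intro z hz hzβ
    rcases hβr z hzβ with ⟨y, -, hy1, rfl⟩ | hzJ
    · exact hPaxis y (by linarith) hz
    · rcases hz with (⟨q, ⟨hq, -⟩, rfl⟩ | h) | ⟨q, ⟨hq, -⟩, rfl⟩
      · exact hδJ q hq hzJ
      · exact Set.disjoint_left.1 hd h (hJV hzJ)
      · exact hδJ q hq hzJ
  have hNP : ∀ z ∈ N, z ∉ Kβ → z ∉ Kσ → z ∈ P := by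
    rintro _ ⟨⟨u, v⟩, hz, rfl⟩ hzβ hzσ
    rcases lt_trichotomy u 0 with hu | rfl | hu
    · exact Or.inr ⟨_, ⟨hz, hu⟩, rfl⟩
    · exfalso
      have hv := abs_lt.1 ((mem_ball _ _ _).1 hz).2
      rcases le_or_gt v (-(δ / 2)) with h1 | h1
      · exact hzβ (Or.inr ⟨v, ⟨by linarith, h1⟩, rfl⟩)
      · rcases le_or_gt v (δ / 2) with h2 | h2
        · exact hzσ ⟨v, ⟨h1.le, h2⟩, rfl⟩
        · exact hzβ (Or.inl (Or.inl ⟨v, ⟨h2.le, by linarith⟩, rfl⟩))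
    · exact Or.inl (Or.inl ⟨_, ⟨hz, hu⟩, rfl⟩)
  have hcross : ∀ z ∈ N \ {b, b'}, z ∈ Kβ → z ∉ Kσ := by
    rintro _ ⟨⟨⟨u, v⟩, hz, rfl⟩, hzb⟩ hzβ hzσ
    obtain ⟨y, hy1, hye⟩ := hσr _ hzσ
    obtain ⟨rfl, rfl⟩ := hφinj u v y (hB hz) (by linarith) hye
    rcases hβr _ hzβ with ⟨y', hy2, hy3, hye'⟩ | hzJ
    · obtain ⟨-, rfl⟩ := hφinj 0 v y' (hB hz) (by linarith) hye'
      have h4 : |v| = δ / 2 := le_antisymm hy1 hy2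
      rcases (abs_eq (by linarith)).1 h4 with rfl | rfl
      · exact hzb (Or.inl rfl)
      · exact hzb (Or.inr rfl)
    · exact hδJ _ hz hzJ
  obtain ⟨l₁, hl₁, he₁⟩ := exists_log_off_path β
  obtain ⟨l₂, hl₂, he₂⟩ := exists_log_off_path σ
  have hβsub : Kβᶜ ⊆ (range β)ᶜ := compl_subset_compl.2 (by rintro _ ⟨t, rfl⟩; exact hβ t)
  have hσsub : Kσᶜ ⊆ (range σ)ᶜ := compl_subset_compl.2 (by rintro _ ⟨t, rfl⟩; exact hσ t)
  obtain ⟨c, hc1, hc2⟩ := logs_differ_by_const hPc (hl₁.mono (hPβ.trans hβsub))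
    (hl₂.mono (hPσ.trans hσsub)) fun z hz => by
      rw [he₁ z (hβsub (hPβ hz)), he₂ z (hσsub (hPσ hz))]
  classical
  let l : ℂ → ℂ := fun z => if z ∈ Kβ then l₂ z + c else l₁ z
  have hl1 : ∀ z ∈ Kβᶜ, l z = l₁ z := fun z hz => if_neg hz
  have hl2 : ∀ z ∈ N, z ∉ Kσ → l z = l₂ z + c := by
    intro z hz hzσ
    by_cases hzβ : z ∈ Kβ
    · exact if_pos hzβ
    · exact (if_neg hzβ).trans (hc2 z (hNP z hz hzβ hzσ))
  have hbb : b ≠ b' := by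
    intro h
    have := (hφinj 0 (δ / 2) (-(δ / 2)) ((mem_ball _ _ _).2 ⟨by simp, by
      rw [abs_of_pos] <;> linarith⟩) (by rw [abs_neg, abs_of_pos] <;> linarith) h).2
    linarith
  have hbN : b ∈ N := ⟨(0, δ / 2), (mem_ball _ _ _).2 ⟨by simpa using hδ0, by
    rw [abs_of_pos] <;> linarith⟩, rfl⟩
  refine no_log_punctured_nhds hbb (hNo.mem_nhds hbN) (l := l) ?_ ?_
  · intro z hz
    refine ContinuousAt.continuousWithinAt ?_
    by_cases hzβ : z ∈ Kβ
    · have hzσ := hcross z hz hzβ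
      have h1 : ContinuousAt (fun z => l₂ z + c) z :=
        ((hl₂.mono hσsub).continuousAt (hKσc.isOpen_compl.mem_nhds hzσ)).add continuousAt_const
      refine h1.congr ?_
      filter_upwards [hNo.mem_nhds hz.1, hKσc.isOpen_compl.mem_nhds hzσ] with y hy hy'
      exact (hl2 y hy hy').symm
    · have h1 : ContinuousAt l₁ z :=
        (hl₁.mono hβsub).continuousAt (hKβc.isOpen_compl.mem_nhds hzβ)
      refine h1.congr ?_
      filter_upwards [hKβc.isOpen_compl.mem_nhds hzβ] with y hy
      exact (hl1 y hy).symm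
  · intro z hz
    by_cases hzβ : z ∈ Kβ
    · have hzσ := hcross z hz hzβ
      rw [hl2 z hz.1 hzσ, Complex.exp_add, hc1, mul_one, he₂ z (hσsub hzσ)]
    · rw [hl1 z hzβ, he₁ z (hβsub hzβ)]

end PlanarTopology

section PartialDerivatives

open Filter Topology Set

/-- The partial derivative in the first variable. -/
def dx (g : ℝ × ℝ → ℝ) (z : ℝ × ℝ) : ℝ := fderiv ℝ g z (1, 0)

/-- The partial derivative in the second variable. -/
def dy (g : ℝ × ℝ → ℝ) (z : ℝ × ℝ) : ℝ := fderiv ℝ g z (0, 1)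

theorem fderiv_eq_dx_dy (g : ℝ × ℝ → ℝ) (z : ℝ × ℝ) (a b : ℝ) :
    fderiv ℝ g z (a, b) = a * dx g z + b * dy g z := by
  have : ((a, b) : ℝ × ℝ) = a • (1, 0) + b • (0, 1) := by ext <;> simp
  rw [this, map_add, map_smul, map_smul]
  rfl

theorem ContDiffAt.dx {g : ℝ × ℝ → ℝ} {z : ℝ × ℝ} {n m : WithTop ℕ∞} (h : ContDiffAt ℝ n g z)
    (hm : m + 1 ≤ n) : ContDiffAt ℝ m (dx g) z :=
  (h.fderiv_right hm).clm_apply contDiffAt_const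

theorem ContDiffAt.dy {g : ℝ × ℝ → ℝ} {z : ℝ × ℝ} {n m : WithTop ℕ∞} (h : ContDiffAt ℝ n g z)
    (hm : m + 1 ≤ n) : ContDiffAt ℝ m (dy g) z :=
  (h.fderiv_right hm).clm_apply contDiffAt_const

theorem dx_dy_comm {g : ℝ × ℝ → ℝ} {z : ℝ × ℝ} (h : ContDiffAt ℝ 2 g z) :
    dx (dy g) z = dy (dx g) z := by
  have hs : IsSymmSndFDerivAt ℝ g z := h.isSymmSndFDerivAt (by simp)
  have hd : DifferentiableAt ℝ (fderiv ℝ g) z :=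
    (h.fderiv_right (m := 1) (by norm_num)).differentiableAt (by norm_num)
  have h1 : ∀ v w : ℝ × ℝ, fderiv ℝ (fun y => fderiv ℝ g y v) z w =
      fderiv ℝ (fderiv ℝ g) z w v := by
    intro v w
    rw [fderiv_clm_apply hd (differentiableAt_const v)]
    simp
  have h2 := hs (1, 0) (0, 1)
  rw [← h1, ← h1] at h2
  exact h2

theorem hasJet2_line {g : ℝ × ℝ → ℝ} {z : ℝ × ℝ} (h : ContDiffAt ℝ 2 g z) (e : ℝ × ℝ) :
    HasJet2 (fun t : ℝ => g (z + t • e)) (g z) (fderiv ℝ g z e)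
      (fderiv ℝ (fun y => fderiv ℝ g y e) z e) := by
  have hline : ∀ t : ℝ, HasDerivAt (fun t : ℝ => z + t • e) e t := fun t => by
    simpa using ((hasDerivAt_id t).smul_const e).const_add z
  have hz : z + (0 : ℝ) • e = z := by simp
  refine ⟨by simp, fun t => fderiv ℝ g (z + t • e) e, ?_, by simp, ?_⟩
  · have h1 : ∀ᶠ y in 𝓝 z, ContDiffAt ℝ 2 g y := h.eventually (by simp)
    have h2 : Tendsto (fun t : ℝ => z + t • e) (𝓝 0) (𝓝 z) := by
      have := (hline 0).continuousAt.tendsto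
      rwa [hz] at this
    filter_upwards [h2.eventually h1] with t ht
    exact (ht.differentiableAt (by norm_num)).hasFDerivAt.comp_hasDerivAt t (hline t)
  · have h1 : ContDiffAt ℝ 1 (fun y => fderiv ℝ g y e) z :=
      (h.fderiv_right (m := 1) (by norm_num)).clm_apply contDiffAt_const
    have h2 := (h1.differentiableAt (by norm_num)).hasFDerivAt
    rw [← hz] at h2
    have h3 := h2.comp_hasDerivAt (0 : ℝ) (hline 0)
    rwa [hz] at h3

theorem hasJet2_x {g : ℝ × ℝ → ℝ} {z : ℝ × ℝ} (h : ContDiffAt ℝ 2 g z) :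
    HasJet2 (fun t : ℝ => g (z + (t, 0))) (g z) (dx g z) (dx (dx g) z) := by
  have h1 := hasJet2_line h (1, 0)
  simp only [Prod.smul_mk, smul_eq_mul, mul_one, mul_zero] at h1
  exact h1

theorem hasJet2_y {g : ℝ × ℝ → ℝ} {z : ℝ × ℝ} (h : ContDiffAt ℝ 2 g z) :
    HasJet2 (fun t : ℝ => g (z + (0, t))) (g z) (dy g z) (dy (dy g) z) := by
  have h1 := hasJet2_line h (0, 1)
  simp only [Prod.smul_mk, smul_eq_mul, mul_one, mul_zero] at h1
  exact h1

end PartialDerivatives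

section GraphCharts

open Filter Topology Set

/-- Coordinates of the projection to the first two vectors of an orthonormal basis. -/
def pr (b : OrthonormalBasis (Fin 3) ℝ E3) (m : E3) : ℝ × ℝ := (⟪b 0, m⟫, ⟪b 1, m⟫)

/-- The graph parametrization over the plane spanned by the first two basis vectors. -/
def gr (b : OrthonormalBasis (Fin 3) ℝ E3) (u : ℝ × ℝ → ℝ) (z : ℝ × ℝ) : E3 :=
  z.1 • b 0 + z.2 • b 1 + u z • b 2

/-- A local description of `S` near `p` as the graph of `u` over `O`, in the frame `b`. -/
structure IsGraphChart (S : Surface3) (b : OrthonormalBasis (Fin 3) ℝ E3) (p : E3)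
    (O : Set (ℝ × ℝ)) (u : ℝ × ℝ → ℝ) : Prop where
  isOpen : IsOpen O
  base_mem : pr b p ∈ O
  smooth : ∀ z ∈ O, ContDiffAt ℝ 4 u z
  mem : ∀ z ∈ O, gr b u z ∈ S.carrier
  gr_base : gr b u (pr b p) = p
  surj : ∃ V : Set E3, IsOpen V ∧ p ∈ V ∧ ∀ m ∈ S.carrier, m ∈ V → pr b m ∈ O ∧ gr b u (pr b m) = m
  normal : ∀ z ∈ O, S.ν (gr b u z) = (√(1 + dx u z ^ 2 + dy u z ^ 2))⁻¹ •
    (b 2 - dx u z • b 0 - dy u z • b 1)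

theorem Surface3.exists_nhds_normal (S : Surface3) {p : E3} (hp : p ∈ S.carrier) :
    ∃ U : Set E3, IsOpen U ∧ p ∈ U ∧ ∃ f : E3 → ℝ, (∀ x ∈ U, ContDiffAt ℝ 5 f x) ∧
      (∀ x ∈ U, (x ∈ S.carrier ↔ f x = 0)) ∧
      (∀ x ∈ U, gradient f x ≠ 0 ∧ S.ν x = ‖gradient f x‖⁻¹ • gradient f x) ∧
      ∀ x ∈ U, ContDiffAt ℝ 4 S.ν x := by
  obtain ⟨U, hU, hpU, f, hf, hfU, hg⟩ := S.localDef p hp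
  have hf5 : ∀ x ∈ U, ContDiffAt ℝ 5 f x := fun x hx =>
    (hf.contDiffAt (hU.mem_nhds hx)).of_le (WithTop.coe_le_coe.2 (le_top : (5 : ℕ∞) ≤ ⊤))
  refine ⟨U, hU, hpU, f, hf5, hfU, hg, fun x hx => ?_⟩
  have h1 : ContDiffAt ℝ 4 (gradient f) x :=
    (InnerProductSpace.toDual ℝ E3).symm.toContinuousLinearEquiv.contDiff.contDiffAt.comp x
      ((hf5 x hx).fderiv_right (m := 4) (by norm_num))
  have h2 : ContDiffAt ℝ 4 (fun y => ‖gradient f y‖⁻¹ • gradient f y) x :=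
    ((h1.norm ℝ (hg x hx).1).inv (norm_ne_zero_iff.2 (hg x hx).1)).smul h1
  refine h2.congr_of_eventuallyEq ?_
  filter_upwards [hU.mem_nhds hx] with y hy using (hg y hy).2

theorem Surface3.norm_normal (S : Surface3) {p : E3} (hp : p ∈ S.carrier) : ‖S.ν p‖ = 1 := by
  obtain ⟨U, hU, hpU, f, -, -, hg, -⟩ := S.exists_nhds_normal hp
  rw [(hg p hpU).2, norm_smul, norm_inv, norm_norm,
    inv_mul_cancel₀ (norm_ne_zero_iff.2 (hg p hpU).1)]

theorem Surface3.contDiffAt_normal (S : Surface3) {p : E3} (hp : p ∈ S.carrier) :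
    ContDiffAt ℝ 4 S.ν p := by
  obtain ⟨U, hU, hpU, f, -, -, -, h⟩ := S.exists_nhds_normal hp
  exact h p hpU

theorem Surface3.inner_fderiv_normal (S : Surface3) {p : E3} (hp : p ∈ S.carrier) (v : E3) :
    ⟪fderiv ℝ S.ν p v, S.ν p⟫ = 0 := by
  obtain ⟨U, hU, hpU, f, -, -, hg, h⟩ := S.exists_nhds_normal hp
  have hd : HasFDerivAt S.ν (fderiv ℝ S.ν p) p :=
    ((h p hpU).differentiableAt (by norm_num)).hasFDerivAt
  have h1 := (hd.inner ℝ hd).congr_of_eventuallyEq (f₁ := fun _ => (1 : ℝ)) (by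
    filter_upwards [hU.mem_nhds hpU] with y hy
    rw [real_inner_self_eq_norm_sq, (hg y hy).2, norm_smul, norm_inv, norm_norm,
      inv_mul_cancel₀ (norm_ne_zero_iff.2 (hg y hy).1), one_pow])
  have h2 := congrArg (fun L : E3 →L[ℝ] ℝ => L v) (h1.unique (hasFDerivAt_const (1 : ℝ) p))
  simp only [ContinuousLinearMap.comp_apply, ContinuousLinearMap.prod_apply,
    fderivInnerCLM_apply, zero_apply] at h2
  rw [real_inner_comm] at h2
  rw [real_inner_comm]
  linarith [real_inner_comm (fderiv ℝ S.ν p v) (S.ν p)]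

variable (b : OrthonormalBasis (Fin 3) ℝ E3)

theorem inner_basis_same (i : Fin 3) : ⟪b i, b i⟫ = (1 : ℝ) := by
  simp

theorem inner_basis_ne {i j : Fin 3} (h : i ≠ j) : ⟪b i, b j⟫ = (0 : ℝ) := b.orthonormal.2 h

theorem pr_gr (u : ℝ × ℝ → ℝ) (z : ℝ × ℝ) : pr b (gr b u z) = z := by
  simp only [pr, gr, inner_add_right, inner_smul_right, inner_basis_same]
  simp [inner_basis_ne b (show (0 : Fin 3) ≠ 1 by decide),
    inner_basis_ne b (show (0 : Fin 3) ≠ 2 by decide),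
    inner_basis_ne b (show (1 : Fin 3) ≠ 0 by decide),
    inner_basis_ne b (show (1 : Fin 3) ≠ 2 by decide)]

theorem inner_gr (u : ℝ × ℝ → ℝ) (z : ℝ × ℝ) : ⟪b 2, gr b u z⟫ = u z := by
  simp only [gr, inner_add_right, inner_smul_right, inner_basis_same]
  simp [inner_basis_ne b (show (2 : Fin 3) ≠ 1 by decide),
    inner_basis_ne b (show (2 : Fin 3) ≠ 0 by decide)]

theorem sum_inner_basis (m : E3) : (⟪b 0, m⟫ • b 0 + ⟪b 1, m⟫ • b 1 + ⟪b 2, m⟫ • b 2 : E3) = m := by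
  have := b.sum_repr' m
  rwa [Fin.sum_univ_three] at this

theorem continuous_pr : Continuous (pr b) := by
  unfold pr
  fun_prop

theorem hasFDerivAt_gr {u : ℝ × ℝ → ℝ} {z : ℝ × ℝ} (hu : DifferentiableAt ℝ u z) :
    HasFDerivAt (gr b u) ((ContinuousLinearMap.fst ℝ ℝ ℝ).smulRight (b 0) +
      (ContinuousLinearMap.snd ℝ ℝ ℝ).smulRight (b 1) + (fderiv ℝ u z).smulRight (b 2)) z :=
  (((ContinuousLinearMap.fst ℝ ℝ ℝ).hasFDerivAt.smul_const (b 0)).add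
    ((ContinuousLinearMap.snd ℝ ℝ ℝ).hasFDerivAt.smul_const (b 1))).add
    (hu.hasFDerivAt.smul_const (b 2))

theorem exists_isGraphChart (S : Surface3) {p : E3} (hp : p ∈ S.carrier) (hb : b 2 = S.ν p) :
    ∃ O u, IsGraphChart S b p O u := by
  obtain ⟨U, hU, hpU, f, hf, hfU, hg, hν⟩ := S.exists_nhds_normal hp
  let A : (ℝ × ℝ) × ℝ → E3 := fun q => q.1.1 • b 0 + q.1.2 • b 1 + q.2 • b 2
  let q₀ : (ℝ × ℝ) × ℝ := (pr b p, ⟪b 2, p⟫)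
  have hA : ContDiff ℝ 5 A := by fun_prop
  have hA0 : A q₀ = p := sum_inner_basis b p
  let F : (ℝ × ℝ) × ℝ → ℝ := fun q => f (A q)
  have hF : ContDiffAt ℝ 5 F q₀ := by
    have := hf p hpU
    rw [← hA0] at this
    exact this.comp q₀ hA.contDiffAt
  have hF0 : F q₀ = 0 := by
    simp only [F, hA0]
    exact (hfU p hpU).1 hp
  have hgp : gradient f p = ‖gradient f p‖ • b 2 := by
    rw [hb, (hg p hpU).2, smul_smul, mul_inv_cancel₀ (norm_ne_zero_iff.2 (hg p hpU).1), one_smul]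
  have hF2 : ∀ t : ℝ, fderiv ℝ F q₀ (0, t) = ‖gradient f p‖ * t := by
    intro t
    have h1 : HasFDerivAt f (fderiv ℝ f p) (A q₀) := by
      rw [hA0]
      exact ((hf p hpU).differentiableAt (by norm_num)).hasFDerivAt
    have h2 : HasFDerivAt A (fderiv ℝ A q₀) q₀ :=
      (hA.differentiable (by norm_num)).differentiableAt.hasFDerivAt
    have h3 : HasDerivAt (fun s : ℝ => A (q₀ + s • ((0 : ℝ × ℝ), t))) (t • b 2) 0 := by
      have : (fun s : ℝ => A (q₀ + s • ((0 : ℝ × ℝ), t))) = fun s => A q₀ + s • (t • b 2) := by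
        funext s
        simp only [A, Prod.fst_add, Prod.snd_add, Prod.smul_mk, smul_zero, add_zero, smul_eq_mul]
        module
      rw [this]
      simpa using ((hasDerivAt_id (0 : ℝ)).smul_const (t • b 2)).const_add (A q₀)
    have h4 : HasDerivAt (fun s : ℝ => q₀ + s • ((0 : ℝ × ℝ), t)) ((0 : ℝ × ℝ), t) 0 := by
      simpa using ((hasDerivAt_id (0 : ℝ)).smul_const ((0 : ℝ × ℝ), t)).const_add q₀
    have h5 : fderiv ℝ A q₀ (0, t) = t • b 2 := by
      have h2' := h2
      have hz : q₀ + (0 : ℝ) • ((0 : ℝ × ℝ), t) = q₀ := by simp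
      rw [← hz] at h2'
      have h6 := h2'.comp_hasDerivAt (0 : ℝ) h4
      rw [hz] at h6
      exact h6.unique h3
    have h7 : fderiv ℝ F q₀ = (fderiv ℝ f p).comp (fderiv ℝ A q₀) := (h1.comp q₀ h2).fderiv
    rw [h7, ContinuousLinearMap.comp_apply, h5, ← inner_gradient_left, hgp, inner_smul_left,
      inner_smul_right, norm_smul, inner_basis_same]
    simp
  have hgpos : 0 < ‖gradient f p‖ := norm_pos_iff.2 (hg p hpU).1
  have hinv : (fderiv ℝ F q₀ ∘L .inr ℝ (ℝ × ℝ) ℝ).IsInvertible := by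
    refine ⟨ContinuousLinearEquiv.unitsEquivAut ℝ (Units.mk0 _ hgpos.ne'), ?_⟩
    ext
    simp [hF2]
  have pn : (5 : WithTop ℕ∞) ≠ 0 := by norm_num
  let u := hF.implicitFunction pn hinv
  have hu0 : u (pr b p) = ⟪b 2, p⟫ := hF.implicitFunction_apply_self pn hinv
  have hus : ContDiffAt ℝ 4 u (pr b p) :=
    (hF.contDiffAt_implicitFunction pn hinv).of_le (by norm_num)
  have hgr0 : gr b u (pr b p) = p := by
    simp only [gr, hu0]
    exact sum_inner_basis b p
  have hgrc : ContinuousAt (gr b u) (pr b p) :=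
    (hasFDerivAt_gr b (hus.differentiableAt (by norm_num))).continuousAt
  have hpos : ∀ᶠ z in 𝓝 (pr b p), 0 < ⟪b 2, S.ν (gr b u z)⟫ := by
    have h1 : ContinuousAt (fun z => ⟪b 2, S.ν (gr b u z)⟫) (pr b p) := by
      have h2 : ContinuousAt S.ν (gr b u (pr b p)) := by
        rw [hgr0]
        exact (hν p hpU).continuousAt
      exact continuousAt_const.inner (h2.comp hgrc)
    refine h1.eventually (lt_mem_nhds ?_)
    change 0 < ⟪b 2, S.ν (gr b u (pr b p))⟫
    rw [hgr0, ← hb, inner_basis_same]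
    exact one_pos
  have hUe : ∀ᶠ z in 𝓝 (pr b p), gr b u z ∈ U :=
    hgrc.eventually (by rw [hgr0]; exact hU.mem_nhds hpU)
  obtain ⟨O, hO, hOo, hO0⟩ := eventually_nhds_iff.1 ((hus.eventually (by simp)).and
    ((hF.eventually_apply_implicitFunction pn hinv).and (hpos.and hUe)))
  obtain ⟨V, hV, hVo, hV0⟩ := eventually_nhds_iff.1
    (hF.eventually_apply_eq_iff_implicitFunction pn hinv)
  have hzero : ∀ z ∈ O, f (gr b u z) = 0 := fun z hz => (hO z hz).2.1.trans hF0
  refine ⟨O, u, hOo, hO0, fun z hz => (hO z hz).1, ?_, hgr0, ?_, ?_⟩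
  · exact fun z hz => (hfU _ (hO z hz).2.2.2).2 (hzero z hz)
  · refine ⟨U ∩ (pr b ⁻¹' O ∩ (fun m => (pr b m, ⟪b 2, m⟫)) ⁻¹' V), ?_, ⟨hpU, hO0, hV0⟩, ?_⟩
    · refine hU.inter ((hOo.preimage (continuous_pr b)).inter (hVo.preimage ?_))
      exact (continuous_pr b).prodMk (by fun_prop)
    · rintro m hm ⟨hmU, hmO, hmV⟩
      refine ⟨hmO, ?_⟩
      have hAm : A (pr b m, ⟪b 2, m⟫) = m := sum_inner_basis b m
      have h1 : u (pr b m) = ⟪b 2, m⟫ := (hV _ hmV).1 (by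
        rw [hF0]
        simp only [F, hAm]
        exact (hfU m hmU).1 hm)
      simp only [gr, h1]
      exact sum_inner_basis b m
  · intro z hz
    set x := gr b u z with hx
    have hxU : x ∈ U := (hO z hz).2.2.2
    have h1 : HasFDerivAt f (fderiv ℝ f x) x :=
      ((hf x hxU).differentiableAt (by norm_num)).hasFDerivAt
    have h2 := h1.comp z (hasFDerivAt_gr b ((hO z hz).1.differentiableAt (by norm_num)))
    have h3 := (h2.congr_of_eventuallyEq (f₁ := fun _ => (0 : ℝ)) (by
      filter_upwards [hOo.mem_nhds hz] with y hy
      exact (hzero y hy).symm)).unique (hasFDerivAt_const (0 : ℝ) z)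
    have h4 : ∀ v : ℝ × ℝ, ⟪gradient f x, v.1 • b 0 + v.2 • b 1 + fderiv ℝ u z v • b 2⟫ = 0 := by
      intro v
      have := congrArg (fun L : ℝ × ℝ →L[ℝ] ℝ => L v) h3
      rw [inner_gradient_left]
      simpa using this
    have h5 := h4 (1, 0)
    have h6 := h4 (0, 1)
    have e1 : fderiv ℝ u z (1, 0) = dx u z := rfl
    have e2 : fderiv ℝ u z (0, 1) = dy u z := rfl
    rw [e1] at h5
    rw [e2] at h6
    simp only [one_smul, zero_smul, add_zero, zero_add, inner_add_right, inner_smul_right] at h5 h6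
    set c := ⟪gradient f x, b 2⟫ with hc
    have hgx : gradient f x = c • (b 2 - dx u z • b 0 - dy u z • b 1) := by
      have h7 := (sum_inner_basis b (gradient f x)).symm
      rw [real_inner_comm, real_inner_comm _ (b 1), real_inner_comm _ (b 2), ← hc,
        show ⟪gradient f x, b 0⟫ = -(dx u z * c) by linarith,
        show ⟪gradient f x, b 1⟫ = -(dy u z * c) by linarith] at h7
      refine h7.trans ?_
      module
    have hnorm : ‖b 2 - dx u z • b 0 - dy u z • b 1‖ = √(1 + dx u z ^ 2 + dy u z ^ 2) := by
      rw [eq_comm, Real.sqrt_eq_iff_eq_sq (by positivity) (norm_nonneg _),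
        ← real_inner_self_eq_norm_sq]
      simp only [inner_sub_left, inner_sub_right, inner_smul_left, inner_smul_right,
        inner_basis_same, inner_basis_ne b (show (0 : Fin 3) ≠ 1 by decide),
        inner_basis_ne b (show (0 : Fin 3) ≠ 2 by decide),
        inner_basis_ne b (show (1 : Fin 3) ≠ 0 by decide),
        inner_basis_ne b (show (1 : Fin 3) ≠ 2 by decide),
        inner_basis_ne b (show (2 : Fin 3) ≠ 1 by decide),
        inner_basis_ne b (show (2 : Fin 3) ≠ 0 by decide)]
      simp
      ring
    have hcpos : 0 < c := by
      have h8 := (hO z hz).2.2.1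
      rw [(hg x hxU).2, inner_smul_right, real_inner_comm, ← hc] at h8
      by_contra! hc0
      have := mul_nonpos_of_nonneg_of_nonpos
        (inv_nonneg.2 (norm_nonneg (gradient f x))) hc0
      linarith
    rw [(hg x hxU).2, hgx, norm_smul, hnorm, Real.norm_eq_abs, abs_of_pos hcpos, smul_smul,
      mul_inv]
    congr 1
    field_simp

end GraphCharts

section ChartGeometry

open Filter Topology Set

variable {S : Surface3} {b : OrthonormalBasis (Fin 3) ℝ E3} {p : E3} {O : Set (ℝ × ℝ)}
  {u : ℝ × ℝ → ℝ}

theorem meanCurv_eq_sum (S : Surface3) (x : E3) (b : OrthonormalBasis (Fin 3) ℝ E3) :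
    meanCurv S x = ∑ i, ⟪fderiv ℝ S.ν x (b i), b i⟫ := by
  have h1 := LinearMap.trace_eq_sum_inner (fderiv ℝ S.ν x : E3 →ₗ[ℝ] E3) b
  have h2 := LinearMap.trace_eq_sum_inner (fderiv ℝ S.ν x : E3 →ₗ[ℝ] E3)
    (EuclideanSpace.basisFun (Fin 3) ℝ)
  rw [meanCurv]
  calc _ = ∑ i, ⟪EuclideanSpace.basisFun (Fin 3) ℝ i,
        (fderiv ℝ S.ν x : E3 →ₗ[ℝ] E3) (EuclideanSpace.basisFun (Fin 3) ℝ i)⟫ := by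
        refine Finset.sum_congr rfl fun i _ => ?_
        rw [real_inner_comm, EuclideanSpace.basisFun_apply]
        rfl
    _ = _ := by
        rw [← h2, h1]
        exact Finset.sum_congr rfl fun i _ => real_inner_comm _ _

namespace IsGraphChart

variable (h : IsGraphChart S b p O u)

include h

theorem u_base : u (pr b p) = ⟪b 2, p⟫ := by
  rw [← inner_gr b u (pr b p), h.gr_base]

theorem smooth_base : ContDiffAt ℝ 4 u (pr b p) := h.smooth _ h.base_mem

theorem Du_base (hb : b 2 = S.ν p) : dx u (pr b p) = 0 ∧ dy u (pr b p) = 0 := by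
  have h1 := h.normal _ h.base_mem
  rw [h.gr_base, ← hb] at h1
  have h2 := congrArg (fun v => ⟪b 0, v⟫) h1
  have h3 := congrArg (fun v => ⟪b 1, v⟫) h1
  have hW : (√(1 + dx u (pr b p) ^ 2 + dy u (pr b p) ^ 2))⁻¹ ≠ 0 :=
    inv_ne_zero (Real.sqrt_ne_zero'.2 (by positivity))
  simp only [inner_sub_right, inner_smul_right, inner_basis_same,
    inner_basis_ne b (show (0 : Fin 3) ≠ 1 by decide),
    inner_basis_ne b (show (0 : Fin 3) ≠ 2 by decide),
    inner_basis_ne b (show (1 : Fin 3) ≠ 0 by decide),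
    inner_basis_ne b (show (1 : Fin 3) ≠ 2 by decide)] at h2 h3
  constructor
  · rcases mul_eq_zero.1 h2.symm with h4 | h4
    · exact absurd h4 hW
    · linarith
  · rcases mul_eq_zero.1 h3.symm with h4 | h4
    · exact absurd h4 hW
    · linarith

/-- The second fundamental form in graph coordinates. -/
theorem inner_fderiv_normal {z : ℝ × ℝ} (hz : z ∈ O) (e e' : ℝ × ℝ) :
    √(1 + dx u z ^ 2 + dy u z ^ 2) *
      ⟪fderiv ℝ S.ν (gr b u z) (e.1 • b 0 + e.2 • b 1 + fderiv ℝ u z e • b 2),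
        e'.1 • b 0 + e'.2 • b 1 + fderiv ℝ u z e' • b 2⟫ =
      -(e'.1 * fderiv ℝ (dx u) z e + e'.2 * fderiv ℝ (dy u) z e) := by
  have hu := h.smooth z hz
  have hux : DifferentiableAt ℝ (dx u) z := (hu.dx (m := 3) (by norm_num)).differentiableAt
    (by norm_num)
  have huy : DifferentiableAt ℝ (dy u) z := (hu.dy (m := 3) (by norm_num)).differentiableAt
    (by norm_num)
  set W : ℝ × ℝ → ℝ := fun y => √(1 + dx u y ^ 2 + dy u y ^ 2) with hW
  have hWpos : ∀ y, 0 < W y := fun y => Real.sqrt_pos.2 (by positivity)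
  have hWd : DifferentiableAt ℝ W z := by
    refine DifferentiableAt.sqrt (by fun_prop) (by positivity)
  have hν : HasFDerivAt S.ν (fderiv ℝ S.ν (gr b u z)) (gr b u z) :=
    ((S.contDiffAt_normal (h.mem z hz)).differentiableAt (by norm_num)).hasFDerivAt
  have h1 := hν.comp z (hasFDerivAt_gr b (hu.differentiableAt (by norm_num)))
  have h2 := hWd.hasFDerivAt.smul h1
  have h3 : HasFDerivAt (fun y => b 2 - dx u y • b 0 - dy u y • b 1)
      ((0 - (fderiv ℝ (dx u) z).smulRight (b 0)) - (fderiv ℝ (dy u) z).smulRight (b 1)) z :=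
    ((hasFDerivAt_const (b 2) z).sub (hux.hasFDerivAt.smul_const (b 0))).sub
      (huy.hasFDerivAt.smul_const (b 1))
  have h4 := (h3.congr_of_eventuallyEq (f₁ := fun y => W y • S.ν (gr b u y)) (by
    filter_upwards [h.isOpen.mem_nhds hz] with y hy
    rw [h.normal y hy, smul_smul, mul_inv_cancel₀ (hWpos y).ne', one_smul])).unique h2
  have h5 := congrArg (fun L : ℝ × ℝ →L[ℝ] E3 =>
    ⟪L e, e'.1 • b 0 + e'.2 • b 1 + fderiv ℝ u z e' • b 2⟫) h4
  have hn : ⟪S.ν (gr b u z), e'.1 • b 0 + e'.2 • b 1 + fderiv ℝ u z e' • b 2⟫ = 0 := by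
    obtain ⟨c, d⟩ := e'
    rw [h.normal z hz, fderiv_eq_dx_dy]
    simp only [inner_sub_left, inner_add_right, inner_smul_right, inner_smul_left, inner_basis_same,
      inner_basis_ne b (show (0 : Fin 3) ≠ 1 by decide),
      inner_basis_ne b (show (0 : Fin 3) ≠ 2 by decide),
      inner_basis_ne b (show (1 : Fin 3) ≠ 0 by decide),
      inner_basis_ne b (show (1 : Fin 3) ≠ 2 by decide),
      inner_basis_ne b (show (2 : Fin 3) ≠ 0 by decide),
      inner_basis_ne b (show (2 : Fin 3) ≠ 1 by decide)]
    simp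
    ring_nf
  simp only [add_apply, smul_apply, neg_apply, ContinuousLinearMap.comp_apply,
    ContinuousLinearMap.smulRight_apply, sub_apply, Function.comp_apply,
    inner_add_left, inner_smul_left, hn, mul_zero, add_zero, zero_sub, inner_sub_left,
    inner_neg_left, ContinuousLinearMap.coe_fst', ContinuousLinearMap.coe_snd'] at h5
  refine h5.symm.trans ?_
  simp only [inner_add_right, inner_smul_right, inner_basis_same,
      inner_basis_ne b (show (0 : Fin 3) ≠ 1 by decide),
      inner_basis_ne b (show (0 : Fin 3) ≠ 2 by decide),
      inner_basis_ne b (show (1 : Fin 3) ≠ 0 by decide),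
      inner_basis_ne b (show (1 : Fin 3) ≠ 2 by decide)]
  simp
  ring

/-- The shrinker equation in graph coordinates. -/
theorem pde (hS : IsShrinker S) {z : ℝ × ℝ} (hz : z ∈ O) :
    (1 + dy u z ^ 2) * dx (dx u) z - 2 * dx u z * dy u z * dy (dx u) z +
      (1 + dx u z ^ 2) * dy (dy u) z =
      -(1 / 2) * (1 + dx u z ^ 2 + dy u z ^ 2) * (u z - z.1 * dx u z - z.2 * dy u z) := by
  have hu := h.smooth z hz
  have hcomm : dx (dy u) z = dy (dx u) z := dx_dy_comm (hu.of_le (by norm_num))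
  set W := √(1 + dx u z ^ 2 + dy u z ^ 2) with hW
  have hWpos : 0 < W := Real.sqrt_pos.2 (by positivity)
  have hW2 : W ^ 2 = 1 + dx u z ^ 2 + dy u z ^ 2 := Real.sq_sqrt (by positivity)
  set L := fderiv ℝ S.ν (gr b u z) with hL
  have key := fun e e' => h.inner_fderiv_normal hz e e'
  have h11 := key (1, 0) (1, 0)
  have h12 := key (1, 0) (0, 1)
  have h21 := key (0, 1) (1, 0)
  have h22 := key (0, 1) (0, 1)
  simp only [fderiv_eq_dx_dy, one_smul, zero_smul, one_mul, zero_mul, add_zero, zero_add,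
    map_add, map_smul, inner_add_left, inner_add_right, inner_smul_left, inner_smul_right,
    ← hW, ← hL, hcomm] at h11 h12 h21 h22
  have hN : ∀ v, ⟪L v, b 2⟫ = dx u z * ⟪L v, b 0⟫ + dy u z * ⟪L v, b 1⟫ := by
    intro v
    have h1 := S.inner_fderiv_normal (h.mem z hz) v
    rw [h.normal z hz, inner_smul_right] at h1
    have h2 := (mul_eq_zero.1 h1).resolve_left (inv_ne_zero hWpos.ne')
    simp only [inner_sub_right, inner_smul_right] at h2
    linarith
  have htr := hS (gr b u z) (h.mem z hz)
  rw [meanCurv_eq_sum S _ b, Fin.sum_univ_three, ← hL, hN (b 2), h.normal z hz,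
    inner_smul_right] at htr
  have hgr : ⟪gr b u z, b 2 - dx u z • b 0 - dy u z • b 1⟫ =
      u z - z.1 * dx u z - z.2 * dy u z := by
    simp only [gr, inner_sub_right, inner_add_left, inner_smul_right, inner_smul_left,
      inner_basis_same,
      inner_basis_ne b (show (0 : Fin 3) ≠ 1 by decide),
      inner_basis_ne b (show (0 : Fin 3) ≠ 2 by decide),
      inner_basis_ne b (show (1 : Fin 3) ≠ 0 by decide),
      inner_basis_ne b (show (1 : Fin 3) ≠ 2 by decide),
      inner_basis_ne b (show (2 : Fin 3) ≠ 0 by decide),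
      inner_basis_ne b (show (2 : Fin 3) ≠ 1 by decide)]
    simp
    ring
  rw [hgr, ← hW] at htr
  simp only [hN, conj_trivial] at h11 h12 h21 h22
  have h3 : W * (⟪L (b 0), b 0⟫ + ⟪L (b 1), b 1⟫ +
      (dx u z * ⟪L (b 2), b 0⟫ + dy u z * ⟪L (b 2), b 1⟫)) =
      1 / 2 * (u z - z.1 * dx u z - z.2 * dy u z) := by
    rw [htr]
    field_simp
  rw [← hW2]
  have h4 : W ^ 2 * (W * (⟪L (b 0), b 0⟫ + ⟪L (b 1), b 1⟫ +
      (dx u z * ⟪L (b 2), b 0⟫ + dy u z * ⟪L (b 2), b 1⟫))) =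
      -((1 + dy u z ^ 2) * dx (dx u) z - 2 * dx u z * dy u z * dy (dx u) z +
      (1 + dx u z ^ 2) * dy (dy u) z) := by
    rw [hW2]
    linear_combination (1 + dy u z ^ 2) * h11 - dx u z * dy u z * h12 - dx u z * dy u z * h21 +
      (1 + dx u z ^ 2) * h22
  rw [h3] at h4
  linarith

/-- The Hessian of the graph function at the base point is minus the second fundamental form. -/
theorem hessian_base (hb : b 2 = S.ν p) :
    dy (dx u) (pr b p) = -⟪fderiv ℝ S.ν p (b 0), b 1⟫ ∧
      dy (dx u) (pr b p) = -⟪fderiv ℝ S.ν p (b 1), b 0⟫ := by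
  obtain ⟨h1, h2⟩ := h.Du_base hb
  have hcomm : dx (dy u) (pr b p) = dy (dx u) (pr b p) :=
    dx_dy_comm (h.smooth_base.of_le (by norm_num))
  have h3 := h.inner_fderiv_normal h.base_mem (1, 0) (0, 1)
  have h4 := h.inner_fderiv_normal h.base_mem (0, 1) (1, 0)
  simp only [fderiv_eq_dx_dy, h1, h2, hcomm, h.gr_base] at h3 h4
  simp at h3 h4
  exact ⟨by linarith, by linarith⟩

end IsGraphChart

end ChartGeometry

section Frames

open Filter Topology Set

theorem exists_basis_of_unit {v : E3} (hv : ‖v‖ = 1) :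
    ∃ b : OrthonormalBasis (Fin 3) ℝ E3, b 2 = v := by
  have h1 : Orthonormal ℝ (({2} : Set (Fin 3)).domRestrict fun _ => v) := by
    rw [orthonormal_iff_ite]
    rintro ⟨i, rfl⟩ ⟨j, rfl⟩
    simp [hv]
  obtain ⟨b, hb⟩ := h1.exists_orthonormalBasis_extension_of_card_eq (by simp)
  exact ⟨b, hb 2 rfl⟩

theorem exists_basis_of_orthonormal {e f v : E3} (he : ‖e‖ = 1) (hf : ‖f‖ = 1) (hv : ‖v‖ = 1)
    (hef : ⟪e, f⟫ = 0) (hev : ⟪e, v⟫ = 0) (hfv : ⟪f, v⟫ = 0) :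
    ∃ b : OrthonormalBasis (Fin 3) ℝ E3, b 0 = e ∧ b 1 = f ∧ b 2 = v := by
  have h0 : Orthonormal ℝ ![e, f, v] := by
    rw [orthonormal_iff_ite]
    intro i j
    fin_cases i <;> fin_cases j <;>
      simp [he, hf, hv, hef, hev, hfv, real_inner_comm e, real_inner_comm f]
  have h1 : Orthonormal ℝ ((univ : Set (Fin 3)).domRestrict ![e, f, v]) :=
    h0.comp _ Subtype.val_injective
  obtain ⟨b, hb⟩ := h1.exists_orthonormalBasis_extension_of_card_eq (by simp)
  exact ⟨b, hb 0 (mem_univ _), hb 1 (mem_univ _), hb 2 (mem_univ _)⟩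

/-- Around every point there is a graph chart whose Hessian is diagonal at the base point. -/
theorem exists_diagonal_chart (S : Surface3) {p : E3} (hp : p ∈ S.carrier) :
    ∃ b O u, b 2 = S.ν p ∧ IsGraphChart S b p O u ∧ dy (dx u) (pr b p) = 0 := by
  obtain ⟨b, hb⟩ := exists_basis_of_unit (S.norm_normal hp)
  set L := fderiv ℝ S.ν p with hL
  let e : ℝ → E3 := fun θ => Real.cos θ • b 0 + Real.sin θ • b 1
  let f : ℝ → E3 := fun θ => -Real.sin θ • b 0 + Real.cos θ • b 1
  have hsymm : ⟪L (b 0), b 1⟫ = ⟪L (b 1), b 0⟫ := by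
    obtain ⟨O, u, h⟩ := exists_isGraphChart b S hp hb
    have := h.hessian_base hb
    linarith [this.1, this.2]
  have hcont : Continuous fun θ => ⟪L (e θ), f θ⟫ := by
    have := L.continuous
    fun_prop
  obtain ⟨θ, hθ⟩ : ∃ θ, ⟪L (e θ), f θ⟫ = 0 := by
    have h0 : ⟪L (e 0), f 0⟫ = ⟪L (b 0), b 1⟫ := by simp [e, f]
    have h1 : ⟪L (e (Real.pi / 2)), f (Real.pi / 2)⟫ = -⟪L (b 0), b 1⟫ := by
      simp [e, f, hsymm]
    rcases le_total 0 ⟪L (b 0), b 1⟫ with h2 | h2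
    · have := mem_range_of_exists_le_of_exists_ge (c := (0 : ℝ)) hcont
        ⟨Real.pi / 2, by rw [h1]; linarith⟩ ⟨0, by rw [h0]; linarith⟩
      exact this
    · have := mem_range_of_exists_le_of_exists_ge (c := (0 : ℝ)) hcont
        ⟨0, by rw [h0]; linarith⟩ ⟨Real.pi / 2, by rw [h1]; linarith⟩
      exact this
  have hsc := Real.sin_sq_add_cos_sq θ
  have hee : ⟪e θ, e θ⟫ = 1 := by
    simp only [e, inner_add_left, inner_add_right, inner_smul_left, inner_smul_right,
      inner_basis_same, inner_basis_ne b (show (0 : Fin 3) ≠ 1 by decide),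
      inner_basis_ne b (show (1 : Fin 3) ≠ 0 by decide), conj_trivial]
    linarith
  have hff : ⟪f θ, f θ⟫ = 1 := by
    simp only [f, inner_add_left, inner_add_right, inner_smul_left, inner_smul_right,
      inner_basis_same, inner_basis_ne b (show (0 : Fin 3) ≠ 1 by decide),
      inner_basis_ne b (show (1 : Fin 3) ≠ 0 by decide), conj_trivial]
    linarith
  have hef : ⟪e θ, f θ⟫ = 0 := by
    simp only [e, f, inner_add_left, inner_add_right, inner_smul_left, inner_smul_right,
      inner_basis_same, inner_basis_ne b (show (0 : Fin 3) ≠ 1 by decide),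
      inner_basis_ne b (show (1 : Fin 3) ≠ 0 by decide), conj_trivial]
    ring
  have hev : ⟪e θ, S.ν p⟫ = 0 := by
    simp [← hb, e, inner_add_left, inner_smul_left,
      inner_basis_ne b (show (0 : Fin 3) ≠ 2 by decide),
      inner_basis_ne b (show (1 : Fin 3) ≠ 2 by decide)]
  have hfv : ⟪f θ, S.ν p⟫ = 0 := by
    simp [← hb, f, inner_add_left, inner_smul_left,
      inner_basis_ne b (show (0 : Fin 3) ≠ 2 by decide),
      inner_basis_ne b (show (1 : Fin 3) ≠ 2 by decide)]
  obtain ⟨b', hb0, hb1, hb2⟩ := exists_basis_of_orthonormal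
    ((pow_eq_one_iff_of_nonneg (norm_nonneg (e θ)) two_ne_zero).1
      ((real_inner_self_eq_norm_sq (e θ)).symm.trans hee))
    ((pow_eq_one_iff_of_nonneg (norm_nonneg (f θ)) two_ne_zero).1
      ((real_inner_self_eq_norm_sq (f θ)).symm.trans hff))
    (S.norm_normal hp) hef hev hfv
  obtain ⟨O, u, h⟩ := exists_isGraphChart b' S hp hb2
  refine ⟨b', O, u, hb2, h, ?_⟩
  rw [(h.hessian_base hb2).1, hb0, hb1, ← hL, hθ, neg_zero]

namespace IsGraphChart

variable {S : Surface3} {b : OrthonormalBasis (Fin 3) ℝ E3} {p : E3} {O : Set (ℝ × ℝ)}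
  {u : ℝ × ℝ → ℝ} (h : IsGraphChart S b p O u)

include h

theorem eventually_line_mem {z : ℝ × ℝ} (hz : z ∈ O) (e : ℝ × ℝ) :
    ∀ᶠ t : ℝ in 𝓝 0, z + t • e ∈ O := by
  have h1 : ContinuousAt (fun t : ℝ => z + t • e) 0 := by fun_prop
  exact h1.eventually (h.isOpen.mem_nhds (by simpa using hz))

theorem eventually_x_mem {z : ℝ × ℝ} (hz : z ∈ O) : ∀ᶠ t : ℝ in 𝓝 0, z + (t, 0) ∈ O := by
  filter_upwards [h.eventually_line_mem hz (1, 0)] with t ht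
  simpa using ht

theorem eventually_y_mem {z : ℝ × ℝ} (hz : z ∈ O) : ∀ᶠ t : ℝ in 𝓝 0, z + (0, t) ∈ O := by
  filter_upwards [h.eventually_line_mem hz (0, 1)] with t ht
  simpa using ht

theorem hasJet2_gr_line {z : ℝ × ℝ} (hz : z ∈ O) (e : ℝ × ℝ) :
    HasJet2 (fun t : ℝ => gr b u (z + t • e)) (gr b u z)
      (e.1 • b 0 + e.2 • b 1 + fderiv ℝ u z e • b 2)
      (fderiv ℝ (fun y => fderiv ℝ u y e) z e • b 2) := by
  have h1 := hasJet2_line ((h.smooth z hz).of_le (by norm_num : (2 : WithTop ℕ∞) ≤ 4)) e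
  have hlin : ∀ a c : ℝ, HasJet2 (fun t : ℝ => a + t * c) a c 0 := fun a c => by
    simpa using (HasJet2.const a).add ((HasJet2.affine 0).mul (HasJet2.const c))
  have h2 := (((hlin z.1 e.1).smul (HasJet2.const (b 0))).add
    ((hlin z.2 e.2).smul (HasJet2.const (b 1)))).add (h1.smul (HasJet2.const (b 2)))
  simpa [gr] using h2

/-- Curves in the surface along the two frame directions at the base point. -/
theorem exists_curves (hS : IsShrinker S) (hb : b 2 = S.ν p) :
    ∃ (γ δ : ℝ → E3) (r t : ℝ), (∀ᶠ s in 𝓝 0, γ s ∈ S.carrier) ∧ (∀ᶠ s in 𝓝 0, δ s ∈ S.carrier) ∧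
      HasJet2 γ p (b 0) (r • S.ν p) ∧ HasJet2 δ p (b 1) (t • S.ν p) ∧
      r + t = -(1 / 2) * ⟪p, S.ν p⟫ := by
  obtain ⟨h1, h2⟩ := h.Du_base hb
  refine ⟨fun t => gr b u (pr b p + t • (1, 0)), fun t => gr b u (pr b p + t • (0, 1)),
    dx (dx u) (pr b p), dy (dy u) (pr b p), ?_, ?_, ?_, ?_, ?_⟩
  · filter_upwards [h.eventually_line_mem h.base_mem (1, 0)] with t ht using h.mem _ ht
  · filter_upwards [h.eventually_line_mem h.base_mem (0, 1)] with t ht using h.mem _ ht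
  · have h3 := h.hasJet2_gr_line h.base_mem (1, 0)
    have e1 : fderiv ℝ u (pr b p) (1, 0) = 0 := h1
    rw [h.gr_base, e1, hb] at h3
    simp only [one_smul, zero_smul, add_zero] at h3
    exact h3
  · have h3 := h.hasJet2_gr_line h.base_mem (0, 1)
    have e1 : fderiv ℝ u (pr b p) (0, 1) = 0 := h2
    rw [h.gr_base, e1, hb] at h3
    simp only [one_smul, zero_smul, add_zero, zero_add] at h3
    exact h3
  · have h3 := h.pde hS h.base_mem
    rw [h1, h2, h.u_base, hb, real_inner_comm] at h3
    linarith

end IsGraphChart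

theorem exists_curves_of_orthonormal {S : Surface3} (hS : IsShrinker S) {p e f : E3}
    (hp : p ∈ S.carrier) (he : ‖e‖ = 1) (hf : ‖f‖ = 1) (hef : ⟪e, f⟫ = 0)
    (hev : ⟪e, S.ν p⟫ = 0) (hfv : ⟪f, S.ν p⟫ = 0) :
    ∃ (γ δ : ℝ → E3) (r t : ℝ), (∀ᶠ s in 𝓝 0, γ s ∈ S.carrier) ∧ (∀ᶠ s in 𝓝 0, δ s ∈ S.carrier) ∧
      HasJet2 γ p e (r • S.ν p) ∧ HasJet2 δ p f (t • S.ν p) ∧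
      r + t = -(1 / 2) * ⟪p, S.ν p⟫ := by
  obtain ⟨b, rfl, rfl, hb⟩ := exists_basis_of_orthonormal he hf (S.norm_normal hp) hef hev hfv
  obtain ⟨O, u, h⟩ := exists_isGraphChart b S hp hb
  exact h.exists_curves hS hb

end Frames

section TwoPiece

open Filter Topology Set

theorem HasJet2.tendsto {E : Type*} [NormedAddCommGroup E] [NormedSpace ℝ E] {γ : ℝ → E}
    {a v w : E} (h : HasJet2 γ a v w) : Tendsto γ (𝓝 0) (𝓝 a) := by
  have := h.hasDerivAt.continuousAt.tendsto
  rwa [h.1] at this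

theorem exists_frame {S : Surface3} (hS : IsShrinker S) {p : E3} (hp : p ∈ S.carrier) :
    ∃ (b : OrthonormalBasis (Fin 3) ℝ E3) (γ δ : ℝ → E3) (r t : ℝ), b 2 = S.ν p ∧
      (∀ᶠ s in 𝓝 0, γ s ∈ S.carrier) ∧ (∀ᶠ s in 𝓝 0, δ s ∈ S.carrier) ∧
      HasJet2 γ p (b 0) (r • S.ν p) ∧ HasJet2 δ p (b 1) (t • S.ν p) ∧
      r + t = -(1 / 2) * ⟪p, S.ν p⟫ := by
  obtain ⟨b, hb⟩ := exists_basis_of_unit (S.norm_normal hp)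
  obtain ⟨O, u, h⟩ := exists_isGraphChart b S hp hb
  obtain ⟨γ, δ, r, t, h⟩ := h.exists_curves hS hb
  exact ⟨b, γ, δ, r, t, hb, h⟩

theorem inner_eq_sum_basis (b : OrthonormalBasis (Fin 3) ℝ E3) (v w : E3) :
    ⟪v, w⟫ = ⟪v, b 0⟫ * ⟪w, b 0⟫ + ⟪v, b 1⟫ * ⟪w, b 1⟫ + ⟪v, b 2⟫ * ⟪w, b 2⟫ := by
  have := b.sum_inner_mul_inner v w
  rw [Fin.sum_univ_three] at this
  rw [← this, real_inner_comm w, real_inner_comm w, real_inner_comm w]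

theorem hasJet2_two_point {γ δ : ℝ → E3} {x y e f v w : E3} (hγ : HasJet2 γ x e v)
    (hδ : HasJet2 δ y f w) (a : E3) (κ ε : ℝ) :
    HasJet2 (fun τ => ⟪γ τ - δ τ, γ τ - δ τ⟫ - κ * ((⟪a, γ τ⟫ + ε) * (⟪a, δ τ⟫ + ε)))
      (⟪x - y, x - y⟫ - κ * ((⟪a, x⟫ + ε) * (⟪a, y⟫ + ε)))
      (2 * ⟪x - y, e - f⟫ - κ * (⟪a, e⟫ * (⟪a, y⟫ + ε) + (⟪a, x⟫ + ε) * ⟪a, f⟫))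
      (2 * ⟪e - f, e - f⟫ + 2 * ⟪x - y, v - w⟫
        - κ * (⟪a, v⟫ * (⟪a, y⟫ + ε) + 2 * ⟪a, e⟫ * ⟪a, f⟫ + (⟪a, x⟫ + ε) * ⟪a, w⟫)) := by
  have h1 := (hγ.sub hδ).inner (hγ.sub hδ)
  have h2 := (((HasJet2.const a).inner hγ).add (HasJet2.const ε)).mul
    (((HasJet2.const a).inner hδ).add (HasJet2.const ε))
  have h3 := h1.sub ((HasJet2.const κ).mul h2)
  convert h3 using 1
  · simp [real_inner_comm (x - y)]; ring
  · simp [real_inner_comm (x - y)]; ring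

set_option maxHeartbeats 1000000 in
theorem two_point_false {S : Surface3} (hS : IsShrinker S) {a x y : E3} (ha : ‖a‖ = 1)
    (hx : x ∈ S.carrier) (hy : y ∈ S.carrier) {κ ε : ℝ} (hκ : 0 < κ) (hε : 0 < ε)
    (hs : 0 < ⟪a, x⟫ + ε) (ht : 0 < ⟪a, y⟫ + ε)
    (h0 : ⟪x - y, x - y⟫ - κ * ((⟪a, x⟫ + ε) * (⟪a, y⟫ + ε)) = 0)
    (hmin : ∀ᶠ z : E3 × E3 in 𝓝 (x, y), z.1 ∈ S.carrier → z.2 ∈ S.carrier →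
      0 ≤ ⟪z.1 - z.2, z.1 - z.2⟫ - κ * ((⟪a, z.1⟫ + ε) * (⟪a, z.2⟫ + ε))) : False := by
  have key : ∀ {γ δ : ℝ → E3} {e f v w : E3}, (∀ᶠ τ in 𝓝 0, γ τ ∈ S.carrier) →
      (∀ᶠ τ in 𝓝 0, δ τ ∈ S.carrier) → HasJet2 γ x e v → HasJet2 δ y f w →
      2 * ⟪x - y, e - f⟫ - κ * (⟪a, e⟫ * (⟪a, y⟫ + ε) + (⟪a, x⟫ + ε) * ⟪a, f⟫) = 0 ∧
      0 ≤ 2 * ⟪e - f, e - f⟫ + 2 * ⟪x - y, v - w⟫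
        - κ * (⟪a, v⟫ * (⟪a, y⟫ + ε) + 2 * ⟪a, e⟫ * ⟪a, f⟫ + (⟪a, x⟫ + ε) * ⟪a, w⟫) := by
    intro γ δ e f v w h1 h2 hγ hδ
    have h3 := hasJet2_two_point hγ hδ a κ ε
    refine h3.hasDerivAt_of_isLocalMin ?_
    rw [h0]
    have hc : Tendsto (fun τ => (γ τ, δ τ)) (𝓝 0) (𝓝 (x, y)) :=
      hγ.tendsto.prodMk_nhds hδ.tendsto
    filter_upwards [h1, h2, hc.eventually hmin] with τ g1 g2 g3 using g3 g1 g2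
  obtain ⟨b, γ, δ, r, t, hb, hγ, hδ, jγ, jδ, hrt⟩ := exists_frame hS hx
  obtain ⟨b', γ', δ', r', t', hb', hγ', hδ', jγ', jδ', hrt'⟩ := exists_frame hS hy
  have cx : ∀ᶠ τ : ℝ in 𝓝 0, (fun _ => x) τ ∈ S.carrier := .of_forall fun _ => hx
  have cy : ∀ᶠ τ : ℝ in 𝓝 0, (fun _ => y) τ ∈ S.carrier := .of_forall fun _ => hy
  set s := ⟪a, x⟫ + ε with hs_def
  set σ := ⟪a, y⟫ + ε with hσ_def
  set W := x - y with hW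
  have k0 := (key hγ cy jγ (HasJet2.const y)).1
  have k1 := (key hδ cy jδ (HasJet2.const y)).1
  have l0 := (key cx hγ' (HasJet2.const x) jγ').1
  have l1 := (key cx hδ' (HasJet2.const x) jδ').1
  simp only [sub_zero, zero_sub, inner_neg_right, inner_zero_right, mul_zero, add_zero, zero_mul,
    zero_add] at k0 k1 l0 l1
  have hWW : ⟪W, W⟫ = κ * (s * σ) := by linarith
  have haa : ⟪a, a⟫ = 1 := by rw [real_inner_self_eq_norm_sq, ha]; norm_num
  have hWa : ⟪W, a⟫ = s - σ := by
    rw [hW, inner_sub_left, real_inner_comm, real_inner_comm a y]; simp [hs_def, hσ_def]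
  have hpos : 0 < κ * (s * σ) := by positivity
  -- the normal at `y` is parallel to the gradient there
  set D' := (2 : ℝ) • W + (κ * s) • a with hD'
  set D := (2 : ℝ) • W - (κ * σ) • a with hD
  have hD'0 : ⟪D', b' 0⟫ = 0 := by
    simp only [hD', inner_add_left, inner_smul_left, conj_trivial]; linarith
  have hD'1 : ⟪D', b' 1⟫ = 0 := by
    simp only [hD', inner_add_left, inner_smul_left, conj_trivial]; linarith
  have hD0 : ⟪D, b 0⟫ = 0 := by
    simp only [hD, inner_sub_left, inner_smul_left, conj_trivial]; linarith
  have hD1 : ⟪D, b 1⟫ = 0 := by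
    simp only [hD, inner_sub_left, inner_smul_left, conj_trivial]; linarith
  have nD' : ∀ v, ⟪D', v⟫ = ⟪D', S.ν y⟫ * ⟪v, S.ν y⟫ := fun v => by
    rw [inner_eq_sum_basis b', hD'0, hD'1, hb']; ring
  have nD : ∀ v, ⟪D, v⟫ = ⟪D, S.ν x⟫ * ⟪v, S.ν x⟫ := fun v => by
    rw [inner_eq_sum_basis b, hD0, hD1, hb]; ring
  have hD'D' : ⟪D', D'⟫ = s ^ 2 * κ * (4 + κ) := by
    simp only [hD', inner_add_left, inner_add_right, inner_smul_left, inner_smul_right,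
      conj_trivial, hWW, haa, real_inner_comm W a, hWa]
    ring
  have hD'ν : ⟪D', S.ν y⟫ ≠ 0 := by
    intro h
    have := nD' D'
    rw [h, hD'D'] at this
    have : 0 < s ^ 2 * κ * (4 + κ) := by positivity
    linarith
  let R : E3 → E3 := fun e => e - (2 * ⟪W, e⟫ / (κ * (s * σ))) • W
  have hWR : ∀ e, ⟪W, R e⟫ = -⟪W, e⟫ := fun e => by
    simp only [R, inner_sub_right, inner_smul_right, hWW]; field_simp; ring
  have hRR : ∀ e f, ⟪R e, R f⟫ = ⟪e, f⟫ := fun e f => by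
    have h1 : ⟪R e, R f⟫ = ⟪e, R f⟫ - (2 * ⟪W, e⟫ / (κ * (s * σ))) * ⟪W, R f⟫ := by
      simp only [R, inner_sub_left, inner_smul_left, conj_trivial]
    rw [h1, hWR]
    simp only [R, inner_sub_right, inner_smul_right, real_inner_comm W e]
    field_simp; ring
  have haR : ∀ e, ⟪a, R e⟫ = ⟪a, e⟫ - 2 * ⟪W, e⟫ / (κ * (s * σ)) * (s - σ) := fun e => by
    simp only [R, inner_sub_right, inner_smul_right, real_inner_comm W a, hWa]
  have hRν : ∀ e, ⟪D, e⟫ = 0 → ⟪R e, S.ν y⟫ = 0 := by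
    intro e he
    have h1 : ⟪D', R e⟫ = 0 := by
      simp only [hD, inner_sub_left, inner_smul_left, conj_trivial] at he
      have he' : ⟪W, e⟫ = κ * σ / 2 * ⟪a, e⟫ := by linarith
      simp only [hD', inner_add_left, inner_smul_left, conj_trivial, hWR, haR, he']
      field_simp; ring
    rw [nD'] at h1
    exact (mul_eq_zero.1 h1).resolve_left hD'ν
  have hunit : ∀ e : E3, ⟪e, e⟫ = 1 → ‖R e‖ = 1 := fun e he =>
    (pow_eq_one_iff_of_nonneg (norm_nonneg _) two_ne_zero).1
      ((real_inner_self_eq_norm_sq _).symm.trans ((hRR e e).trans he))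
  obtain ⟨γ₂, δ₂, r₂, t₂, hγ₂, hδ₂, jγ₂, jδ₂, hrt₂⟩ := exists_curves_of_orthonormal hS hy
    (hunit (b 0) (inner_basis_same b 0)) (hunit (b 1) (inner_basis_same b 1))
    ((hRR _ _).trans (inner_basis_ne b (show (0 : Fin 3) ≠ 1 by decide))) (hRν _ hD0) (hRν _ hD1)
  have m0 := (key hγ hγ₂ jγ jγ₂).2
  have m1 := (key hδ hδ₂ jδ jδ₂).2
  have hE : ∀ e, ⟪D, e⟫ = 0 → 2 * ⟪e - R e, e - R e⟫ - κ * (2 * ⟪a, e⟫ * ⟪a, R e⟫) = 0 := by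
    intro e he
    simp only [hD, inner_sub_left, inner_smul_left, conj_trivial] at he
    have he' : ⟪W, e⟫ = κ * σ / 2 * ⟪a, e⟫ := by linarith
    have h1 : e - R e = (2 * ⟪W, e⟫ / (κ * (s * σ))) • W := by simp [R]
    rw [h1, haR]
    simp only [inner_smul_left, inner_smul_right, conj_trivial, hWW, he']
    field_simp; ring
  have e0 := hE _ hD0
  have e1 := hE _ hD1
  have hsub : ∀ (c d : ℝ), ⟪W, c • S.ν x - d • S.ν y⟫ = c * ⟪W, S.ν x⟫ - d * ⟪W, S.ν y⟫ :=
    fun c d => by rw [inner_sub_right, inner_smul_right, inner_smul_right]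
  rw [hsub, inner_smul_right, inner_smul_right] at m0 m1
  have f1 : ⟪D, S.ν x⟫ = 2 * ⟪W, S.ν x⟫ - κ * σ * ⟪a, S.ν x⟫ := by
    simp only [hD, inner_sub_left, inner_smul_left, conj_trivial]
  have f2 : ⟪D', S.ν y⟫ = 2 * ⟪W, S.ν y⟫ + κ * s * ⟪a, S.ν y⟫ := by
    simp only [hD', inner_add_left, inner_smul_left, conj_trivial]
  have f3 : ⟪D, x⟫ - ⟪D', y⟫ = κ * ε * (s + σ) := by
    simp only [hD, hD', inner_add_left, inner_sub_left, inner_smul_left, conj_trivial]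
    have : ⟪W, x⟫ - ⟪W, y⟫ = κ * (s * σ) := by rw [← inner_sub_right, ← hW, hWW]
    have g1 : ⟪a, x⟫ = s - ε := by simp [hs_def]
    have g2 : ⟪a, y⟫ = σ - ε := by simp [hσ_def]
    rw [g1, g2]
    linear_combination 2 * this
  have hp : 0 < κ * ε * (s + σ) := by positivity
  have expand : 0 ≤ (r + t) * ⟪D, S.ν x⟫ - (r₂ + t₂) * ⟪D', S.ν y⟫ := by
    rw [f1, f2]
    linear_combination m0 + m1 + e0 + e1
  have nx := nD x
  have ny := nD' y
  rw [hrt, hrt₂] at expand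
  have : 0 ≤ -(1 / 2) * (κ * ε * (s + σ)) := by
    rw [← f3, nx, ny]
    linear_combination expand
  linarith only [this, hp]

end TwoPiece

section TwoPieceGlobal

open Filter Topology Set

theorem abs_inner_basis_le (b : OrthonormalBasis (Fin 3) ℝ E3) (i : Fin 3) (v : E3) :
    |⟪b i, v⟫| ≤ ‖v‖ := by
  have := abs_real_inner_le_norm (b i) v
  rwa [b.norm_eq_one, one_mul] at this

theorem norm_pr_sub_le (b : OrthonormalBasis (Fin 3) ℝ E3) (x y : E3) :
    ‖pr b x - pr b y‖ ≤ ‖x - y‖ := by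
  rw [Prod.norm_def]
  refine max_le ?_ ?_
  · have := abs_inner_basis_le b 0 (x - y)
    simpa [pr, inner_sub_right] using this
  · have := abs_inner_basis_le b 1 (x - y)
    simpa [pr, inner_sub_right] using this

/-- A function that is strictly differentiable at a point is positive along the segment between
two nearby points at which it is large compared to their distance. -/
theorem HasStrictFDerivAt.exists_segment_pos {F : Type*} [NormedAddCommGroup F] [NormedSpace ℝ F]
    {g : F → ℝ} {D : F →L[ℝ] ℝ} {z₀ : F} (hg : HasStrictFDerivAt g D z₀) {c : ℝ} (hc : 0 < c) :
    ∃ ρ > 0, ∀ z₁ ∈ Metric.ball z₀ ρ, ∀ z₂ ∈ Metric.ball z₀ ρ, 0 < g z₁ → 0 < g z₂ →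
      ‖z₂ - z₁‖ ^ 2 ≤ c * (g z₁ * g z₂) → ∀ z ∈ segment ℝ z₁ z₂, 0 < g z := by
  set L := ‖D‖ with hL
  have hL0 : 0 ≤ L := norm_nonneg _
  obtain ⟨η, hη, hηc⟩ : ∃ η > 0, c * (2 * η * (2 * η + L + η)) < 1 := by
    have h1 : Tendsto (fun η : ℝ => c * (2 * η * (2 * η + L + η))) (𝓝[>] 0) (𝓝 0) := by
      have : Continuous (fun η : ℝ => c * (2 * η * (2 * η + L + η))) := by fun_prop
      have h2 := this.tendsto 0
      simp only [mul_zero, zero_mul] at h2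
      exact h2.mono_left nhdsWithin_le_nhds
    obtain ⟨η, h2, h3⟩ := ((h1.eventually_lt_const one_pos).and self_mem_nhdsWithin).exists
    exact ⟨η, h3, h2⟩
  have h1 := hg.isLittleO.def hη
  rw [nhds_prod_eq, Metric.nhds_basis_ball.prod_self.eventually_iff] at h1
  obtain ⟨ρ, hρ, h1⟩ := h1
  have h2 : ∀ z ∈ Metric.ball z₀ ρ, ∀ z' ∈ Metric.ball z₀ ρ,
      |g z - g z' - D (z - z')| ≤ η * ‖z - z'‖ := fun z hz z' hz' => by
    simpa using h1 (x := (z, z')) ⟨hz, hz'⟩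
  refine ⟨ρ, hρ, fun z₁ hz₁ z₂ hz₂ hg₁ hg₂ hd z hz => ?_⟩
  have hzb : z ∈ Metric.ball z₀ ρ := (convex_ball z₀ ρ).segment_subset hz₁ hz₂ hz
  rw [segment_eq_image'] at hz
  obtain ⟨t, ⟨ht0, ht1⟩, rfl⟩ := hz
  set δ := ‖z₂ - z₁‖ with hδ
  have a1 := h2 _ hzb _ hz₁
  have a2 := h2 _ hz₂ _ hz₁
  rw [add_sub_cancel_left, map_smul, norm_smul, Real.norm_of_nonneg ht0, smul_eq_mul] at a1
  have hDle : |D (z₂ - z₁)| ≤ L * δ := D.le_opNorm _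
  have hδ0 : 0 ≤ δ := norm_nonneg _
  rw [abs_le] at a1 a2 hDle
  set d := D (z₂ - z₁)
  by_contra hneg
  push Not at hneg
  rw [← hδ] at a1 a2
  have htδ : t * δ ≤ δ := by nlinarith
  have b1 : (1 - t) * g z₁ + t * g z₂ ≤ 2 * (η * δ) := by nlinarith [a1.1, a2.2, mul_nonneg hη.le hδ0]
  -- the smaller value is at most `2 η δ` and the larger one at most `(3 η + L) δ`
  have b2 : g z₁ * g z₂ ≤ (2 * (η * δ)) * (2 * (η * δ) + (L * δ + η * δ)) := by
    rcases le_total (g z₁) (g z₂) with h | h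
    · have c1 : g z₁ ≤ 2 * (η * δ) := by nlinarith
      have c2 : g z₂ ≤ 2 * (η * δ) + (L * δ + η * δ) := by linarith [a2.2, hDle.2]
      exact mul_le_mul c1 c2 hg₂.le (by positivity)
    · have c1 : g z₂ ≤ 2 * (η * δ) := by nlinarith
      have c2 : g z₁ ≤ 2 * (η * δ) + (L * δ + η * δ) := by linarith [a2.1, hDle.1]
      rw [mul_comm (g z₁)]
      exact mul_le_mul c1 c2 hg₁.le (by positivity)
  have hδpos : 0 < δ := by
    rcases hδ0.eq_or_lt with h | h
    · rw [← h] at b1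
      nlinarith
    · exact h
  have b3 : δ ^ 2 ≤ c * (2 * η * (2 * η + L + η)) * δ ^ 2 := by
    refine hd.trans ((mul_le_mul_of_nonneg_left b2 hc.le).trans_eq ?_)
    ring
  nlinarith [pow_pos hδpos 2]

theorem exists_nhds_preconnected {S : Surface3} {p a : E3} (hp : p ∈ S.carrier) {c : ℝ}
    (hc : 0 < c) :
    ∃ N ∈ 𝓝 p, ∀ x ∈ S.carrier ∩ N, ∀ y ∈ S.carrier ∩ N, 0 < ⟪a, x⟫ → 0 < ⟪a, y⟫ →
      ‖y - x‖ ^ 2 ≤ c * (⟪a, x⟫ * ⟪a, y⟫) →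
      ∃ C ⊆ S.carrier ∩ {z | 0 < ⟪a, z⟫}, IsPreconnected C ∧ x ∈ C ∧ y ∈ C := by
  obtain ⟨b, hb⟩ := exists_basis_of_unit (S.norm_normal hp)
  obtain ⟨O, u, h⟩ := exists_isGraphChart b S hp hb
  have hsm : ∀ z ∈ O, ContDiffAt ℝ 4 (gr b u) z := fun z hz => by
    have := h.smooth z hz
    unfold gr
    fun_prop
  have hg : ContDiffAt ℝ 4 (fun z => ⟪a, gr b u z⟫) (pr b p) :=
    contDiffAt_const.inner ℝ (hsm _ h.base_mem)
  obtain ⟨ρ, hρ, hseg⟩ := (hg.hasStrictFDerivAt (by norm_num)).exists_segment_pos hc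
  obtain ⟨ρ', hρ', hO⟩ := Metric.isOpen_iff.1 h.isOpen _ h.base_mem
  obtain ⟨V, hV, hpV, hsurj⟩ := h.surj
  set r := min ρ ρ' with hr
  have hr0 : 0 < r := lt_min hρ hρ'
  refine ⟨V ∩ pr b ⁻¹' (Metric.ball (pr b p) r), inter_mem (hV.mem_nhds hpV)
    ((continuous_pr b).continuousAt.preimage_mem_nhds (Metric.ball_mem_nhds _ hr0)), ?_⟩
  rintro x ⟨hxM, hxV, hxr⟩ y ⟨hyM, hyV, hyr⟩ hax hay hxy
  obtain ⟨hxO, hgx⟩ := hsurj x hxM hxV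
  obtain ⟨hyO, hgy⟩ := hsurj y hyM hyV
  have hsub : segment ℝ (pr b x) (pr b y) ⊆ O :=
    ((convex_ball (pr b p) r).segment_subset hxr hyr).trans
      ((Metric.ball_subset_ball (min_le_right _ _)).trans hO)
  refine ⟨gr b u '' segment ℝ (pr b x) (pr b y), ?_, ?_, ?_, ?_⟩
  · rintro _ ⟨z, hz, rfl⟩
    refine ⟨h.mem _ (hsub hz), ?_⟩
    refine hseg _ (Metric.ball_subset_ball (min_le_left _ _) hxr) _
      (Metric.ball_subset_ball (min_le_left _ _) hyr) (by rwa [hgx]) (by rwa [hgy]) ?_ z hz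
    rw [hgx, hgy]
    exact (pow_le_pow_left₀ (norm_nonneg _) (norm_pr_sub_le b y x) 2).trans hxy
  · exact (convex_segment _ _).isPreconnected.image _
      fun z hz => (hsm z (hsub hz)).continuousAt.continuousWithinAt
  · exact ⟨_, left_mem_segment ℝ _ _, hgx⟩
  · exact ⟨_, right_mem_segment ℝ _ _, hgy⟩

theorem mul_shift_lt {A B κ c ε μ : ℝ} (hμ : 0 < μ) (hA : μ ≤ A) (hB : μ ≤ B) (hε : 0 < ε)
    (hc : 0 ≤ c) (hκ : κ ≤ c) (h : c * ((1 + ε / μ) * (1 + ε / μ)) < c + 1) :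
    κ * ((A + ε) * (B + ε)) < (c + 1) * (A * B) := by
  have aux : ∀ C, μ ≤ C → C + ε ≤ C * (1 + ε / μ) := fun C hC => by
    have : ε ≤ C * (ε / μ) := by
      rw [mul_div_assoc', le_div_iff₀ hμ, mul_comm ε]; gcongr
    linarith
  have hA0 : 0 < A := hμ.trans_le hA
  have hB0 : 0 < B := hμ.trans_le hB
  calc κ * ((A + ε) * (B + ε)) ≤ c * ((A * (1 + ε / μ)) * (B * (1 + ε / μ))) :=
        mul_le_mul hκ (mul_le_mul (aux A hA) (aux B hB) (by positivity) (by positivity))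
          (by positivity) hc
    _ = (c * ((1 + ε / μ) * (1 + ε / μ))) * (A * B) := by ring
    _ < _ := mul_lt_mul_of_pos_right h (by positivity)

set_option maxHeartbeats 1000000 in
/-- The part of a compact shrinker on one side of a plane through the origin is connected. -/
theorem isPreconnected_halfspace {S : Surface3} (hS : IsShrinker S) (hM : IsCompact S.carrier)
    {a : E3} (ha : ‖a‖ = 1) : IsPreconnected (S.carrier ∩ {z | 0 < ⟪a, z⟫}) := by
  intro V₁ V₂ hV₁ hV₂ hcov hne₁ hne₂
  by_contra hempty
  obtain ⟨x₀, ⟨hx₀M, hx₀a⟩, hx₀⟩ := hne₁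
  obtain ⟨y₀, ⟨hy₀M, hy₀a⟩, hy₀⟩ := hne₂
  simp only [mem_ofPred_eq] at hx₀a hy₀a
  have hdisj : ∀ z ∈ S.carrier, 0 < ⟪a, z⟫ → z ∈ V₁ → z ∈ V₂ → False :=
    fun z h1 h2 h3 h4 => hempty ⟨z, ⟨h1, h2⟩, h3, h4⟩
  have hac : Continuous fun z : E3 => ⟪a, z⟫ := by fun_prop
  let T : ℝ → Set (E3 × E3) := fun c => {q | q.1 ∈ S.carrier ∧ 0 < ⟪a, q.1⟫ ∧ q.1 ∈ V₁ ∧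
    q.2 ∈ S.carrier ∧ 0 < ⟪a, q.2⟫ ∧ q.2 ∈ V₂ ∧ ‖q.2 - q.1‖ ^ 2 ≤ c * (⟪a, q.1⟫ * ⟪a, q.2⟫)}
  have hT : ∀ c, 0 < c → IsCompact (T c) := by
    intro c hc
    refine (hM.prod hM).of_isClosed_subset ?_ fun q hq => ⟨hq.1, hq.2.2.2.1⟩
    refine isClosed_of_closure_subset fun ⟨x, y⟩ hq => ?_
    have hcl : ∀ {C : Set (E3 × E3)}, IsClosed C → T c ⊆ C → (x, y) ∈ C :=
      fun hC hsub => closure_minimal hsub hC hq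
    have hx : x ∈ S.carrier := hcl (hM.isClosed.preimage continuous_fst) fun q hq => hq.1
    have hy : y ∈ S.carrier := hcl (hM.isClosed.preimage continuous_snd) fun q hq => hq.2.2.2.1
    have hax : 0 ≤ ⟪a, x⟫ := hcl (C := {q | 0 ≤ ⟪a, q.1⟫})
      (isClosed_le continuous_const (hac.comp continuous_fst)) fun q hq => hq.2.1.le
    have hay : 0 ≤ ⟪a, y⟫ := hcl (C := {q | 0 ≤ ⟪a, q.2⟫})
      (isClosed_le continuous_const (hac.comp continuous_snd)) fun q hq => hq.2.2.2.2.1.le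
    have hxy : ‖y - x‖ ^ 2 ≤ c * (⟪a, x⟫ * ⟪a, y⟫) :=
      hcl (C := {q | ‖q.2 - q.1‖ ^ 2 ≤ c * (⟪a, q.1⟫ * ⟪a, q.2⟫)})
        (isClosed_le (by fun_prop) (by fun_prop)) fun q hq => hq.2.2.2.2.2.2
    have hfreq : ∃ᶠ q in 𝓝 (x, y), q ∈ T c := mem_closure_iff_frequently.1 hq
    by_cases hpos : 0 < ⟪a, x⟫ ∧ 0 < ⟪a, y⟫
    · refine ⟨hx, hpos.1, ?_, hy, hpos.2, ?_, hxy⟩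
      · refine (hcov ⟨hx, hpos.1⟩).resolve_right fun h => ?_
        obtain ⟨q, h1, h2⟩ := (hfreq.and_eventually
          (continuousAt_fst.preimage_mem_nhds (hV₂.mem_nhds h))).exists
        exact hdisj _ h1.1 h1.2.1 h1.2.2.1 h2
      · refine (hcov ⟨hy, hpos.2⟩).resolve_left fun h => ?_
        obtain ⟨q, h1, h2⟩ := (hfreq.and_eventually
          (continuousAt_snd.preimage_mem_nhds (hV₁.mem_nhds h))).exists
        exact hdisj _ h1.2.2.2.1 h1.2.2.2.2.1 h2 h1.2.2.2.2.2.1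
    · exfalso
      have hyx : y = x := by
        have h0 : ⟪a, x⟫ * ⟪a, y⟫ = 0 := by
          rcases hax.eq_or_lt with h | h
          · rw [← h, zero_mul]
          · rcases hay.eq_or_lt with h' | h'
            · rw [← h', mul_zero]
            · exact absurd ⟨h, h'⟩ hpos
        rw [h0, mul_zero] at hxy
        have : ‖y - x‖ = 0 := by nlinarith [norm_nonneg (y - x)]
        exact sub_eq_zero.1 (norm_eq_zero.1 this)
      rw [hyx] at hfreq
      obtain ⟨N, hN, hC⟩ := exists_nhds_preconnected (a := a) hx hc
      obtain ⟨q, h1, h2⟩ := (hfreq.and_eventually (prod_mem_nhds hN hN)).exists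
      obtain ⟨C, hCs, hCp, hC1, hC2⟩ := hC q.1 ⟨h1.1, h2.1⟩ q.2 ⟨h1.2.2.2.1, h2.2⟩ h1.2.1
        h1.2.2.2.2.1 h1.2.2.2.2.2.2
      obtain ⟨z, hz, hz1, hz2⟩ := hCp V₁ V₂ hV₁ hV₂ (hCs.trans hcov) ⟨_, hC1, h1.2.2.1⟩
        ⟨_, hC2, h1.2.2.2.2.2.1⟩
      exact hdisj z (hCs hz).1 (hCs hz).2 hz1 hz2
  set c₀ := ‖y₀ - x₀‖ ^ 2 / (⟪a, x₀⟫ * ⟪a, y₀⟫) with hc₀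
  have hc₀0 : 0 ≤ c₀ := by positivity
  have hmem₀ : (x₀, y₀) ∈ T (c₀ + 1) := by
    refine ⟨hx₀M, hx₀a, hx₀, hy₀M, hy₀a, hy₀, ?_⟩
    have h1 : ‖y₀ - x₀‖ ^ 2 = c₀ * (⟪a, x₀⟫ * ⟪a, y₀⟫) := by rw [hc₀]; field_simp
    have h2 : 0 < ⟪a, x₀⟫ * ⟪a, y₀⟫ := by positivity
    simp only [h1]
    linarith
  have hK := hT (c₀ + 1) (by linarith)
  obtain ⟨q₁, hq₁, hμ₁⟩ := hK.exists_isMinOn ⟨_, hmem₀⟩ (f := fun q => ⟪a, q.1⟫)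
    (hac.comp continuous_fst).continuousOn
  obtain ⟨q₂, hq₂, hμ₂⟩ := hK.exists_isMinOn ⟨_, hmem₀⟩ (f := fun q => ⟪a, q.2⟫)
    (hac.comp continuous_snd).continuousOn
  set μ := min ⟪a, q₁.1⟫ ⟪a, q₂.2⟫ with hμ
  have hμ0 : 0 < μ := lt_min hq₁.2.1 hq₂.2.2.2.2.1
  obtain ⟨ε, hε, hεc⟩ : ∃ ε > 0, c₀ * ((1 + ε / μ) * (1 + ε / μ)) < c₀ + 1 := by
    have h1 : Tendsto (fun ε : ℝ => c₀ * ((1 + ε / μ) * (1 + ε / μ))) (𝓝[>] 0) (𝓝 c₀) := by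
      have : Continuous (fun ε : ℝ => c₀ * ((1 + ε / μ) * (1 + ε / μ))) := by fun_prop
      have h2 := this.tendsto 0
      simp only [zero_div, add_zero, mul_one] at h2
      exact h2.mono_left nhdsWithin_le_nhds
    obtain ⟨ε, h2, h3⟩ := ((h1.eventually_lt_const (lt_add_one c₀)).and self_mem_nhdsWithin).exists
    exact ⟨ε, h3, h2⟩
  obtain ⟨⟨x, y⟩, hq, hmin⟩ := hK.exists_isMinOn ⟨_, hmem₀⟩
    (f := fun q => ‖q.2 - q.1‖ ^ 2 / ((⟪a, q.1⟫ + ε) * (⟪a, q.2⟫ + ε))) (by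
      refine ContinuousOn.div (by fun_prop) (by fun_prop) fun q hq => ?_
      have h1 := hq.2.1
      have h2 := hq.2.2.2.2.1
      positivity)
  replace hmin := isMinOn_iff.1 hmin
  simp only at hmin
  have ⟨hxM, hax, hx, hyM, hay, hy, hxy⟩ := hq
  simp only at hxM hax hx hyM hay hy hxy
  obtain ⟨κ, hκ⟩ : ∃ κ, κ = ‖y - x‖ ^ 2 / ((⟪a, x⟫ + ε) * (⟪a, y⟫ + ε)) := ⟨_, rfl⟩
  simp only [← hκ] at hmin
  have hne : y ≠ x := fun h => hdisj x hxM hax hx (h ▸ hy)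
  have hnorm : 0 < ‖y - x‖ := norm_pos_iff.2 (sub_ne_zero.2 hne)
  have hκ0 : 0 < κ := by rw [hκ]; positivity
  have hκeq : ‖y - x‖ ^ 2 = κ * ((⟪a, x⟫ + ε) * (⟪a, y⟫ + ε)) := by rw [hκ]; field_simp
  have hκle : κ ≤ c₀ := by
    refine (hmin (x₀, y₀) hmem₀).trans ?_
    dsimp only
    rw [hc₀]
    gcongr <;> linarith
  have hstrict : ‖y - x‖ ^ 2 < (c₀ + 1) * (⟪a, x⟫ * ⟪a, y⟫) :=
    hκeq.trans_lt (mul_shift_lt hμ0 ((min_le_left _ _).trans (isMinOn_iff.1 hμ₁ _ hq))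
      ((min_le_right _ _).trans (isMinOn_iff.1 hμ₂ _ hq)) hε hc₀0 hκle hεc)
  have hsq : ∀ v w : E3, ⟪v - w, v - w⟫ = ‖w - v‖ ^ 2 := fun v w => by
    rw [real_inner_self_eq_norm_sq, norm_sub_rev]
  refine two_point_false hS ha hxM hyM hκ0 hε (by linarith) (by linarith)
    (by rw [hsq, hκeq, sub_self]) ?_
  have n1 : ∀ᶠ z : E3 × E3 in 𝓝 (x, y), 0 < ⟪a, z.1⟫ :=
    continuousAt_const.eventually_lt (hac.comp continuous_fst).continuousAt hax
  have n2 : ∀ᶠ z : E3 × E3 in 𝓝 (x, y), 0 < ⟪a, z.2⟫ :=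
    continuousAt_const.eventually_lt (hac.comp continuous_snd).continuousAt hay
  have n3 : ∀ᶠ z : E3 × E3 in 𝓝 (x, y), ‖z.2 - z.1‖ ^ 2 < (c₀ + 1) * (⟪a, z.1⟫ * ⟪a, z.2⟫) :=
    ContinuousAt.eventually_lt (by fun_prop) (by fun_prop) hstrict
  filter_upwards [n1, n2, n3, continuousAt_fst.preimage_mem_nhds (hV₁.mem_nhds hx),
    continuousAt_snd.preimage_mem_nhds (hV₂.mem_nhds hy)] with z g1 g2 g3 g4 g5 g6 g7
  have h1 : κ ≤ ‖z.2 - z.1‖ ^ 2 / ((⟪a, z.1⟫ + ε) * (⟪a, z.2⟫ + ε)) :=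
    hmin z ⟨g6, g1, g4, g7, g2, g5, g3.le⟩
  rw [le_div_iff₀ (by positivity)] at h1
  rw [hsq]
  linarith

end TwoPieceGlobal

section BaseJets

open Filter Topology Set

/-- The jets along the coordinate axes at `z` of a solution `u` of the graphical shrinker equation
and of its derivatives, if the gradient vanishes and the Hessian is diagonal at `z`. -/
structure BaseJets (u : ℝ × ℝ → ℝ) (z : ℝ × ℝ) (a r t C₀ C₁ C₂ C₃ D₀ D₁ D₂ D₃ D₄ : ℝ) : Prop where
  ux : HasJet2 (fun τ : ℝ => u (z + (τ, 0))) a 0 r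
  px : HasJet2 (fun τ : ℝ => dx u (z + (τ, 0))) 0 r C₀
  qx : HasJet2 (fun τ : ℝ => dy u (z + (τ, 0))) 0 0 C₁
  rx : HasJet2 (fun τ : ℝ => dx (dx u) (z + (τ, 0))) r C₀ D₀
  sx : HasJet2 (fun τ : ℝ => dy (dx u) (z + (τ, 0))) 0 C₁ D₁
  tx : HasJet2 (fun τ : ℝ => dy (dy u) (z + (τ, 0))) t C₂ D₂
  uy : HasJet2 (fun τ : ℝ => u (z + (0, τ))) a 0 t
  py : HasJet2 (fun τ : ℝ => dx u (z + (0, τ))) 0 0 C₂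
  qy : HasJet2 (fun τ : ℝ => dy u (z + (0, τ))) 0 t C₃
  ry : HasJet2 (fun τ : ℝ => dx (dx u) (z + (0, τ))) r C₁ D₂
  sy : HasJet2 (fun τ : ℝ => dy (dx u) (z + (0, τ))) 0 C₂ D₃
  ty : HasJet2 (fun τ : ℝ => dy (dy u) (z + (0, τ))) t C₃ D₄
  trace : r + t = -(1 / 2) * a
  trace_x : C₀ + C₂ = 1 / 2 * z.1 * r
  trace_y : C₁ + C₃ = 1 / 2 * z.2 * t
  trace_xx : D₀ + D₂ + 2 * r ^ 2 * t - 1 / 2 * (r + z.1 * C₀ + z.2 * C₁) + r ^ 2 * a = 0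
  trace_yy : D₂ + D₄ + 2 * t ^ 2 * r - 1 / 2 * (t + z.1 * C₂ + z.2 * C₃) + t ^ 2 * a = 0

theorem hasJet2_affine_add (c d : ℝ) : HasJet2 (fun τ : ℝ => c + τ * d) c d 0 := by
  simpa using (HasJet2.const c).add ((HasJet2.affine 0).mul (HasJet2.const d))

/-- The two-jet of the graphical shrinker operator at a critical point. -/
theorem hasJet2_pde {x y u p q r s t : ℝ → ℝ} {x₀ y₀ x₁ y₁ a u₂ p₁ q₁ p₂ q₂ r₀ r₁ r₂ s₁ s₂ t₀ t₁ t₂ : ℝ}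
    (hx : HasJet2 x x₀ x₁ 0) (hy : HasJet2 y y₀ y₁ 0) (hu : HasJet2 u a 0 u₂)
    (hp : HasJet2 p 0 p₁ p₂) (hq : HasJet2 q 0 q₁ q₂) (hr : HasJet2 r r₀ r₁ r₂)
    (hs : HasJet2 s 0 s₁ s₂) (ht : HasJet2 t t₀ t₁ t₂) :
    HasJet2 (fun τ => (1 + q τ ^ 2) * r τ - 2 * p τ * q τ * s τ + (1 + p τ ^ 2) * t τ
        - -(1 / 2) * (1 + p τ ^ 2 + q τ ^ 2) * (u τ - x τ * p τ - y τ * q τ))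
      (r₀ + t₀ + 1 / 2 * a) (r₁ + t₁ - 1 / 2 * (x₀ * p₁ + y₀ * q₁))
      (r₂ + 2 * q₁ ^ 2 * r₀ + t₂ + 2 * p₁ ^ 2 * t₀
        + 1 / 2 * (u₂ - 2 * x₁ * p₁ - 2 * y₁ * q₁ - x₀ * p₂ - y₀ * q₂)
        + (p₁ ^ 2 + q₁ ^ 2) * a) := by
  have one := HasJet2.const (1 : ℝ)
  have h1 := (one.add (hq.mul hq)).mul hr
  have h2 := (((HasJet2.const 2).mul hp).mul hq).mul hs
  have h3 := (one.add (hp.mul hp)).mul ht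
  have h4 := ((hu.sub (hx.mul hp)).sub (hy.mul hq))
  have h5 := ((HasJet2.const (-(1 / 2) : ℝ)).mul ((one.add (hp.mul hp)).add (hq.mul hq))).mul h4
  have h6 := ((h1.sub h2).add h3).sub h5
  convert h6 using 1
  · ext τ; ring
  all_goals ring

theorem IsGraphChart.baseJets {S : Surface3} (hS : IsShrinker S)
    {b : OrthonormalBasis (Fin 3) ℝ E3} {p : E3} {O : Set (ℝ × ℝ)} {u : ℝ × ℝ → ℝ}
    (h : IsGraphChart S b p O u) (hb : b 2 = S.ν p) (hs : dy (dx u) (pr b p) = 0) :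
    ∃ C₀ C₁ C₂ C₃ D₀ D₁ D₂ D₃ D₄ : ℝ, BaseJets u (pr b p) ⟪p, S.ν p⟫ (dx (dx u) (pr b p))
      (dy (dy u) (pr b p)) C₀ C₁ C₂ C₃ D₀ D₁ D₂ D₃ D₄ := by
  obtain ⟨hp0, hq0⟩ := h.Du_base hb
  have ha : u (pr b p) = ⟪p, S.ν p⟫ := by rw [h.u_base, hb, real_inner_comm]
  set z := pr b p with hz
  have hzO : z ∈ O := h.base_mem
  have hO : ∀ᶠ y in 𝓝 z, y ∈ O := h.isOpen.mem_nhds hzO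
  have S4 : ∀ y ∈ O, ContDiffAt ℝ 4 u y := h.smooth
  have Sp : ∀ y ∈ O, ContDiffAt ℝ 3 (dx u) y := fun y hy => (S4 y hy).dx (by norm_num)
  have Sq : ∀ y ∈ O, ContDiffAt ℝ 3 (dy u) y := fun y hy => (S4 y hy).dy (by norm_num)
  have Sr : ∀ y ∈ O, ContDiffAt ℝ 2 (dx (dx u)) y := fun y hy => (Sp y hy).dx (by norm_num)
  have Ss : ∀ y ∈ O, ContDiffAt ℝ 2 (dy (dx u)) y := fun y hy => (Sp y hy).dy (by norm_num)
  have St : ∀ y ∈ O, ContDiffAt ℝ 2 (dy (dy u)) y := fun y hy => (Sq y hy).dy (by norm_num)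
  have congx : ∀ {f g : ℝ × ℝ → ℝ}, (∀ y ∈ O, f y = g y) → ∀ y ∈ O, dx f y = dx g y :=
    fun {f g} hfg y hy => by
      have : f =ᶠ[𝓝 y] g := by filter_upwards [h.isOpen.mem_nhds hy] using hfg
      simp only [dx, this.fderiv_eq]
  have congy : ∀ {f g : ℝ × ℝ → ℝ}, (∀ y ∈ O, f y = g y) → ∀ y ∈ O, dy f y = dy g y :=
    fun {f g} hfg y hy => by
      have : f =ᶠ[𝓝 y] g := by filter_upwards [h.isOpen.mem_nhds hy] using hfg
      simp only [dy, this.fderiv_eq]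
  have c1 : ∀ y ∈ O, dx (dy u) y = dy (dx u) y := fun y hy =>
    dx_dy_comm ((S4 y hy).of_le (by norm_num))
  have c2 : ∀ y ∈ O, dy (dx (dx u)) y = dx (dy (dx u)) y := fun y hy =>
    (dx_dy_comm ((Sp y hy).of_le (by norm_num))).symm
  have c3 : ∀ y ∈ O, dy (dy (dx u)) y = dx (dy (dy u)) y := fun y hy =>
    (congy (fun y hy => (c1 y hy).symm) y hy).trans
      (dx_dy_comm ((Sq y hy).of_le (by norm_num))).symm
  have c4 : ∀ y ∈ O, dy (dy (dx (dx u))) y = dx (dx (dy (dy u))) y := fun y hy =>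
    ((congy c2 y hy).trans (dx_dy_comm (Ss y hy)).symm).trans (congx c3 y hy)
  have S4' := (S4 z hzO).of_le (by norm_num : (2 : WithTop ℕ∞) ≤ 4)
  have Sp' := (Sp z hzO).of_le (by norm_num : (2 : WithTop ℕ∞) ≤ 3)
  have Sq' := (Sq z hzO).of_le (by norm_num : (2 : WithTop ℕ∞) ≤ 3)
  have ux := hasJet2_x S4'
  have uy := hasJet2_y S4'
  have px := hasJet2_x Sp'
  have py := hasJet2_y Sp'
  have qx := hasJet2_x Sq'
  have qy := hasJet2_y Sq'
  have rx := hasJet2_x (Sr z hzO)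
  have ry := hasJet2_y (Sr z hzO)
  have sx := hasJet2_x (Ss z hzO)
  have sy := hasJet2_y (Ss z hzO)
  have tx := hasJet2_x (St z hzO)
  have ty := hasJet2_y (St z hzO)
  rw [ha, hp0] at ux
  rw [ha, hq0] at uy
  rw [hp0] at px
  rw [hp0, hs, c3 z hzO] at py
  rw [hq0, c1 z hzO, hs, congx c1 z hzO] at qx
  rw [hq0] at qy
  rw [c2 z hzO, c4 z hzO] at ry
  rw [hs] at sx
  rw [hs, c3 z hzO] at sy
  have zero := HasJet2.const (0 : ℝ)
  have jx := hasJet2_pde (hasJet2_affine_add z.1 1) (hasJet2_affine_add z.2 0) ux px qx rx sx tx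
  have jy := hasJet2_pde (hasJet2_affine_add z.1 0) (hasJet2_affine_add z.2 1) uy py qy ry sy ty
  obtain ⟨x0, x1, x2⟩ := jx.unique (zero.congr (by
    filter_upwards [h.eventually_x_mem hzO] with τ hτ
    have := h.pde hS hτ
    simp only [Prod.fst_add, Prod.snd_add] at this
    rw [this]; ring))
  obtain ⟨y0, y1, y2⟩ := jy.unique (zero.congr (by
    filter_upwards [h.eventually_y_mem hzO] with τ hτ
    have := h.pde hS hτ
    simp only [Prod.fst_add, Prod.snd_add] at this
    rw [this]; ring))
  exact ⟨_, _, _, _, _, _, _, _, _, ⟨ux, px, qx, rx, sx, tx, uy, py, qy, ry, sy, ty,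
    by linarith, by linarith, by linarith, by linarith, by linarith⟩⟩

/-- The support function in graph coordinates. -/
theorem IsGraphChart.inner_normal {S : Surface3} {b : OrthonormalBasis (Fin 3) ℝ E3} {p : E3}
    {O : Set (ℝ × ℝ)} {u : ℝ × ℝ → ℝ} (h : IsGraphChart S b p O u) {z : ℝ × ℝ} (hz : z ∈ O) :
    ⟪gr b u z, S.ν (gr b u z)⟫ = (u z - z.1 * dx u z - z.2 * dy u z) *
      (√(1 + dx u z ^ 2 + dy u z ^ 2))⁻¹ := by
  have n01 := inner_basis_ne b (show (0 : Fin 3) ≠ 1 by decide)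
  have n02 := inner_basis_ne b (show (0 : Fin 3) ≠ 2 by decide)
  have n10 := inner_basis_ne b (show (1 : Fin 3) ≠ 0 by decide)
  have n12 := inner_basis_ne b (show (1 : Fin 3) ≠ 2 by decide)
  have n20 := inner_basis_ne b (show (2 : Fin 3) ≠ 0 by decide)
  have n21 := inner_basis_ne b (show (2 : Fin 3) ≠ 1 by decide)
  rw [h.normal z hz]
  simp only [gr, inner_smul_right, inner_sub_right, inner_add_left, inner_smul_left, conj_trivial,
    n01, n02, n10, n12, n20, n21, inner_basis_same]
  ring

theorem hasJet2_support {x y u p q : ℝ → ℝ} {x₀ y₀ x₁ y₁ a u₂ p₁ q₁ p₂ q₂ : ℝ}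
    (hx : HasJet2 x x₀ x₁ 0) (hy : HasJet2 y y₀ y₁ 0) (hu : HasJet2 u a 0 u₂)
    (hp : HasJet2 p 0 p₁ p₂) (hq : HasJet2 q 0 q₁ q₂) :
    HasJet2 (fun τ => (u τ - x τ * p τ - y τ * q τ) * (√(1 + p τ ^ 2 + q τ ^ 2))⁻¹)
      a (-(x₀ * p₁ + y₀ * q₁))
      (u₂ - 2 * x₁ * p₁ - 2 * y₁ * q₁ - x₀ * p₂ - y₀ * q₂ - a * (p₁ ^ 2 + q₁ ^ 2)) := by
  have one := HasJet2.const (1 : ℝ)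
  have h1 := (one.add (hp.mul hp)).add (hq.mul hq)
  have h2 : HasJet2 (fun τ => 1 + p τ * p τ + q τ * q τ) 1 0 (2 * p₁ ^ 2 + 2 * q₁ ^ 2) := by
    convert h1 using 1 <;> ring
  have h3 := ((hu.sub (hx.mul hp)).sub (hy.mul hq)).mul (h2.sqrt.inv one_ne_zero)
  convert h3 using 1
  · ext τ; simp only [pow_two]
  all_goals ring

/-- The jets of the support function along the coordinate axes. -/
theorem IsGraphChart.hasJet2_support {S : Surface3} {b : OrthonormalBasis (Fin 3) ℝ E3} {p : E3}
    {O : Set (ℝ × ℝ)} {u : ℝ × ℝ → ℝ} (h : IsGraphChart S b p O u)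
    {a r t C₀ C₁ C₂ C₃ D₀ D₁ D₂ D₃ D₄ : ℝ}
    (j : BaseJets u (pr b p) a r t C₀ C₁ C₂ C₃ D₀ D₁ D₂ D₃ D₄) :
    HasJet2 (fun τ : ℝ => ⟪gr b u (pr b p + (τ, 0)), S.ν (gr b u (pr b p + (τ, 0)))⟫)
      a (-((pr b p).1 * r)) (-r - (pr b p).1 * C₀ - (pr b p).2 * C₁ - a * r ^ 2) ∧
    HasJet2 (fun τ : ℝ => ⟪gr b u (pr b p + (0, τ)), S.ν (gr b u (pr b p + (0, τ)))⟫)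
      a (-((pr b p).2 * t)) (-t - (pr b p).1 * C₂ - (pr b p).2 * C₃ - a * t ^ 2) := by
  have jx := _root_.hasJet2_support (hasJet2_affine_add (pr b p).1 1)
    (hasJet2_affine_add (pr b p).2 0) j.ux j.px j.qx
  have jy := _root_.hasJet2_support (hasJet2_affine_add (pr b p).1 0)
    (hasJet2_affine_add (pr b p).2 1) j.uy j.py j.qy
  constructor
  · have := jx.congr (δ := fun τ : ℝ =>
      ⟪gr b u (pr b p + (τ, 0)), S.ν (gr b u (pr b p + (τ, 0)))⟫) (by
      filter_upwards [h.eventually_x_mem h.base_mem] with τ hτ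
      rw [h.inner_normal hτ]
      simp)
    convert this using 1 <;> ring
  · have := jy.congr (δ := fun τ : ℝ =>
      ⟪gr b u (pr b p + (0, τ)), S.ν (gr b u (pr b p + (0, τ)))⟫) (by
      filter_upwards [h.eventually_y_mem h.base_mem] with τ hτ
      rw [h.inner_normal hτ]
      simp)
    convert this using 1 <;> ring

end BaseJets

section Hopf

open Filter Topology Set

/-- The support function of a surface. -/
def Surface3.supp (S : Surface3) (x : E3) : ℝ := ⟪x, S.ν x⟫

theorem Surface3.continuousOn_supp (S : Surface3) : ContinuousOn S.supp S.carrier := fun _ hx =>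
  (continuousAt_id.inner (S.contDiffAt_normal hx).continuousAt).continuousWithinAt

theorem Surface3.exists_nhds_tangential (S : Surface3) {w : E3} (hw : w ∈ S.carrier) :
    ∃ N ∈ 𝓝 w, ∀ x ∈ S.carrier ∩ N, ∀ z ∈ S.carrier ∩ N,
      |⟪x - z, S.ν x⟫| ≤ 1 / 2 * ‖x - z‖ := by
  obtain ⟨U, hU, hwU, f, hf, hfU, hg, hν⟩ := S.exists_nhds_normal hw
  have hd : HasStrictFDerivAt f (fderiv ℝ f w) w := (hf w hwU).hasStrictFDerivAt (by norm_num)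
  have hgpos : 0 < ‖gradient f w‖ := norm_pos_iff.2 (hg w hwU).1
  have h1 := hd.isLittleO.def (show 0 < ‖gradient f w‖ / 4 by positivity)
  have h2 : ∀ᶠ x in 𝓝 w, ‖S.ν x - S.ν w‖ < 1 / 4 := by
    have := (hν w hwU).continuousAt
    simpa [dist_eq_norm] using Metric.continuousAt_iff'.1 this (1 / 4) (by norm_num)
  rw [nhds_prod_eq, Metric.nhds_basis_ball.prod_self.eventually_iff] at h1
  obtain ⟨ρ, hρ, h1⟩ := h1
  refine ⟨Metric.ball w ρ ∩ (U ∩ {x | ‖S.ν x - S.ν w‖ < 1 / 4}),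
    inter_mem (Metric.ball_mem_nhds w hρ) (inter_mem (hU.mem_nhds hwU) h2), ?_⟩
  rintro x ⟨hxM, hxN, hxU, hxν⟩ z ⟨hzM, hzN, hzU, -⟩
  have h3 := h1 (x := (x, z)) ⟨hxN, hzN⟩
  dsimp only at h3
  rw [(hfU x hxU).1 hxM, (hfU z hzU).1 hzM, sub_self, zero_sub, norm_neg] at h3
  have h4 : fderiv ℝ f w (x - z) = ‖gradient f w‖ * ⟪x - z, S.ν w⟫ := by
    rw [(hg w hwU).2, inner_smul_right, mul_inv_cancel_left₀ hgpos.ne', real_inner_comm,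
      gradient, InnerProductSpace.toDual_symm_apply]
  rw [h4, Real.norm_eq_abs, abs_mul, abs_of_pos hgpos] at h3
  have h5 : |⟪x - z, S.ν w⟫| ≤ 1 / 4 * ‖x - z‖ := by
    refine le_of_mul_le_mul_left ?_ hgpos
    linarith
  have h6 : |⟪x - z, S.ν x - S.ν w⟫| ≤ ‖x - z‖ * (1 / 4) :=
    (abs_real_inner_le_norm _ _).trans (mul_le_mul_of_nonneg_left hxν.le (norm_nonneg _))
  have h7 : ⟪x - z, S.ν x⟫ = ⟪x - z, S.ν w⟫ + ⟪x - z, S.ν x - S.ν w⟫ := by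
    rw [inner_sub_right]; ring
  rw [h7]
  linarith [abs_add_le ⟪x - z, S.ν w⟫ ⟪x - z, S.ν x - S.ν w⟫]

theorem HasJet2.sq_dist {γ : ℝ → E3} {x e v : E3} (h : HasJet2 γ x e v) (z : E3) :
    HasJet2 (fun τ => ⟪γ τ - z, γ τ - z⟫) ⟪x - z, x - z⟫ (2 * ⟪x - z, e⟫)
      (2 * ⟪x - z, v⟫ + 2 * ⟪e, e⟫) := by
  have h1 := h.sub (HasJet2.const z)
  have h2 := h1.inner h1
  simp only [sub_zero] at h2
  rw [real_inner_comm (x - z) e, real_inner_comm (x - z) v] at h2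
  convert h2 using 1 <;> ring

/-- At a point of a surface closest to `z`, the difference vector is normal. -/
theorem abs_inner_eq_of_closest {S : Surface3} (hS : IsShrinker S) {w z : E3}
    (hw : w ∈ S.carrier)
    (hmin : ∀ᶠ x in 𝓝 w, x ∈ S.carrier → ⟪w - z, w - z⟫ ≤ ⟪x - z, x - z⟫) :
    ⟪w - z, S.ν w⟫ ^ 2 = ‖w - z‖ ^ 2 := by
  obtain ⟨b, γ, δ, r, t, hb, hγ, hδ, jγ, jδ, -⟩ := exists_frame hS hw
  have key : ∀ {γ : ℝ → E3} {e v : E3}, (∀ᶠ τ in 𝓝 0, γ τ ∈ S.carrier) → HasJet2 γ w e v →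
      ⟪w - z, e⟫ = 0 := fun hγ jγ => by
    have := ((jγ.sq_dist z).hasDerivAt_of_isLocalMin (by
      filter_upwards [hγ, jγ.tendsto.eventually hmin] with τ g1 g2 using g2 g1)).1
    linarith
  have h1 := inner_eq_sum_basis b (w - z) (w - z)
  rw [key hγ jγ, key hδ jδ, hb, real_inner_self_eq_norm_sq] at h1
  linarith

theorem exp_barrier_lt {S : Surface3} (hS : IsShrinker S) {x z : E3} (hx : x ∈ S.carrier)
    {ε α : ℝ} (hε : 0 < ε) (hpos : 0 < S.supp x)
    (hlt : S.supp x < ε * Real.exp (-α * ⟪x - z, x - z⟫))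
    (htan : ⟪x - z, S.ν x⟫ ^ 2 ≤ 1 / 4 * ⟪x - z, x - z⟫)
    (hmin : ∀ᶠ y in 𝓝 x, y ∈ S.carrier → S.supp x - ε * Real.exp (-α * ⟪x - z, x - z⟫) ≤
      S.supp y - ε * Real.exp (-α * ⟪y - z, y - z⟫)) :
    3 * α ^ 2 * ⟪x - z, x - z⟫ < 1 / 2 + α * (4 - ⟪x, x - z⟫) := by
  obtain ⟨b, O, u, hb, h, hs⟩ := exists_diagonal_chart S hx
  obtain ⟨C₀, C₁, C₂, C₃, D₀, D₁, D₂, D₃, D₄, j⟩ := h.baseJets hS hb hs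
  obtain ⟨jx, jy⟩ := h.hasJet2_support j
  obtain ⟨p0, q0⟩ := h.Du_base hb
  set r := dx (dx u) (pr b x)
  set t := dy (dy u) (pr b x)
  have gx := h.hasJet2_gr_line h.base_mem (1, 0)
  have gy := h.hasJet2_gr_line h.base_mem (0, 1)
  have e1 : fderiv ℝ u (pr b x) (1, 0) = 0 := p0
  have e2 : fderiv ℝ u (pr b x) (0, 1) = 0 := q0
  rw [h.gr_base, e1] at gx
  rw [h.gr_base, e2] at gy
  simp only [one_smul, zero_smul, add_zero, zero_add, Prod.smul_mk, smul_eq_mul, mul_one,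
    mul_zero] at gx gy
  change HasJet2 _ _ _ (r • b 2) at gx
  change HasJet2 _ _ _ (t • b 2) at gy
  have lx := jx.sub ((HasJet2.const ε).mul ((HasJet2.const (-α)).mul (gx.sq_dist z)).exp)
  have ly := jy.sub ((HasJet2.const ε).mul ((HasJet2.const (-α)).mul (gy.sq_dist z)).exp)
  obtain ⟨x1, x2⟩ := lx.hasDerivAt_of_isLocalMin (by
    filter_upwards [h.eventually_x_mem h.base_mem, gx.tendsto.eventually hmin] with τ g1 g2
    exact g2 (h.mem _ g1))
  obtain ⟨y1, y2⟩ := ly.hasDerivAt_of_isLocalMin (by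
    filter_upwards [h.eventually_y_mem h.base_mem, gy.tendsto.eventually hmin] with τ g1 g2
    exact g2 (h.mem _ g1))
  have hdecomp := inner_eq_sum_basis b (x - z) (x - z)
  have hdecomp' := inner_eq_sum_basis b x (x - z)
  have hX : ⟪x, b 0⟫ = (pr b x).1 := real_inner_comm _ _
  have hY : ⟪x, b 1⟫ = (pr b x).2 := real_inner_comm _ _
  have ha : ⟪x, b 2⟫ = S.supp x := by rw [hb]; rfl
  rw [hX, hY, ha] at hdecomp'
  rw [← hb] at htan
  have htr := j.trace
  have htx := j.trace_x
  have hty := j.trace_y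
  change r + t = -(1 / 2) * S.supp x at htr
  simp only [inner_smul_right, inner_basis_same, zero_mul, add_zero, mul_zero] at x1 x2 y1 y2
  change 0 ≤ _ - S.supp x * r ^ 2 - _ at x2
  change 0 ≤ _ - S.supp x * t ^ 2 - _ at y2
  set a := S.supp x
  set E := Real.exp (-α * ⟪x - z, x - z⟫) with hE
  have hE0 : 0 < E := Real.exp_pos _
  set P := ⟪x - z, b 0⟫
  set Q := ⟪x - z, b 1⟫
  set N := ⟪x - z, b 2⟫
  set X := (pr b x).1
  set Y := (pr b x).2
  set d := ⟪x - z, x - z⟫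
  have sum : 0 ≤ 1 / 2 * a - a * (r ^ 2 + t ^ 2) -
      ε * E * (4 * α ^ 2 * (d - N ^ 2) - α * (4 - ⟪x, x - z⟫)) := by
    rw [hdecomp, hdecomp']
    linear_combination x2 + y2 + (-1 + ε * E * 2 * α * N) * htr - X * htx - Y * hty + X / 2 * x1 + Y / 2 * y1
  have h3 : 0 ≤ a * (r ^ 2 + t ^ 2) := by positivity
  have h4 : 0 < ε * E * (1 / 2 - (4 * α ^ 2 * (d - N ^ 2) - α * (4 - ⟪x, x - z⟫))) := by
    linear_combination sum + h3 + 1 / 2 * hlt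
  have h5 := (mul_pos_iff_of_pos_left (by positivity)).1 h4
  nlinarith [mul_le_mul_of_nonneg_left htan (sq_nonneg α)]

end Hopf

section Hopf

open Filter Topology Set

theorem mul_deriv_nonpos_of_eventually {k g : ℝ → ℝ} {k' g' : ℝ} (hk : HasDerivAt k k' 0)
    (hg : HasDerivAt g g' 0) (h : ∀ᶠ τ in 𝓝 0, k τ ≤ k 0 → g 0 ≤ g τ) : k' * g' ≤ 0 := by
  by_contra! hpos
  have key : ∀ {f : ℝ → ℝ} {f' : ℝ}, HasDerivAt f f' 0 → 0 < k' * f' →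
      ∀ᶠ s in 𝓝[>] (0 : ℝ), f (-k' * s) < f 0 := fun {f f'} hf hf' => by
    have h1 : HasDerivAt (fun s => f (-k' * s)) (f' * (-k')) 0 := by
      have h2 : HasDerivAt (fun s => -k' * s) (-k') (0 : ℝ) := by
        simpa using (hasDerivAt_id (0 : ℝ)).const_mul (-k')
      exact HasDerivAt.comp (0 : ℝ) (by simpa using hf) h2
    have h3 := (hasDerivAt_iff_tendsto_slope.1 h1).mono_left
      (nhdsWithin_mono 0 (fun x (hx : (0 : ℝ) < x) => hx.ne'))
    filter_upwards [h3.eventually_lt_const (show f' * (-k') < 0 by linarith),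
      self_mem_nhdsWithin] with s hs (hs0 : 0 < s)
    rw [slope_def_field] at hs
    simp only [mul_zero, sub_zero] at hs
    rw [div_neg_iff] at hs
    rcases hs with ⟨-, hs⟩ | ⟨hs, -⟩ <;> linarith
  have hk' : 0 < k' * k' := by
    have : k' ≠ 0 := by rintro rfl; simp at hpos
    exact mul_self_pos.2 this
  have ht : Tendsto (fun s => -k' * s) (𝓝[>] (0 : ℝ)) (𝓝 0) := by
    have : Tendsto (fun s => -k' * s) (𝓝 (0 : ℝ)) (𝓝 (-k' * 0)) :=
      (continuous_const.mul continuous_id).tendsto 0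
    rw [mul_zero] at this
    exact this.mono_left nhdsWithin_le_nhds
  obtain ⟨s, h1, h2, h3⟩ := ((key hk hk').and ((key hg hpos).and (ht.eventually h))).exists
  exact absurd (h3 h1.le) (not_le.2 h2)

theorem exists_barrier {S : Surface3} (hS : IsShrinker S) (hM : IsCompact S.carrier)
    {z : E3} (hz : z ∈ S.carrier) {ρ : ℝ} (hρ : 0 < ρ)
    (htan : ∀ x ∈ S.carrier, ‖x - z‖ ≤ ρ → ⟪x - z, S.ν x⟫ ^ 2 ≤ 1 / 4 * ⟪x - z, x - z⟫)
    (hin : ∀ x ∈ S.carrier, ‖x - z‖ < ρ → 0 < S.supp x)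
    (hbd : ∀ x ∈ S.carrier, ‖x - z‖ ≤ ρ → 0 ≤ S.supp x) :
    ∃ ε α : ℝ, 0 < ε ∧ 0 < α ∧ ∀ x ∈ S.carrier, ‖x - z‖ ≤ ρ →
      ε * Real.exp (-α * ⟪x - z, x - z⟫) - ε * Real.exp (-α * ρ ^ 2) ≤ S.supp x := by
  obtain ⟨B, hB⟩ : ∃ B, ∀ x ∈ S.carrier, |⟪x, x - z⟫| ≤ B := by
    obtain ⟨B, hB⟩ := hM.exists_bound_of_continuousOn (f := fun x : E3 => ⟪x, x - z⟫)
      (Continuous.continuousOn (by fun_prop))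
    exact ⟨B, fun x hx => by simpa using hB x hx⟩
  have hB0 : 0 ≤ B := (abs_nonneg _).trans (hB z hz)
  have hcK : ∀ R : ℝ, IsCompact (S.carrier ∩ Metric.closedBall z R) := fun R =>
    hM.inter_right Metric.isClosed_closedBall
  have hmemK : ∀ {x : E3} {R : ℝ}, x ∈ Metric.closedBall z R ↔ ‖x - z‖ ≤ R := by
    intro x R; rw [mem_closedBall_iff_norm]
  obtain ⟨x₀, hx₀, hx₀m⟩ := (hcK (ρ / 2)).exists_isMinOn
    ⟨z, hz, Metric.mem_closedBall_self (by positivity)⟩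
    (S.continuousOn_supp.mono inter_subset_left)
  have hx₀' : ‖x₀ - z‖ ≤ ρ / 2 := hmemK.1 hx₀.2
  set ε := S.supp x₀ with hεdef
  have hε : 0 < ε := hin x₀ hx₀.1 (by linarith)
  set α := 1 + (5 + B) * (4 / (3 * ρ ^ 2)) with hαdef
  have hα1 : 1 ≤ α := by
    have : 0 ≤ (5 + B) * (4 / (3 * ρ ^ 2)) := by positivity
    linarith
  refine ⟨ε, α, hε, by linarith, ?_⟩
  obtain ⟨y, hy, hymin⟩ := (hcK ρ).exists_isMinOn
    ⟨z, hz, Metric.mem_closedBall_self hρ.le⟩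
    (f := fun x => S.supp x - ε * Real.exp (-α * ⟪x - z, x - z⟫))
    ((S.continuousOn_supp.mono inter_subset_left).sub
      (Continuous.continuousOn (by fun_prop)))
  rw [isMinOn_iff] at hymin
  suffices hy0 : -(ε * Real.exp (-α * ρ ^ 2)) ≤
      S.supp y - ε * Real.exp (-α * ⟪y - z, y - z⟫) by
    intro x hx hxρ
    have := hymin x ⟨hx, hmemK.2 hxρ⟩
    linarith
  by_contra! hneg
  have hyρ : ‖y - z‖ ≤ ρ := hmemK.1 hy.2
  have hnsq : ⟪y - z, y - z⟫ = ‖y - z‖ ^ 2 := real_inner_self_eq_norm_sq _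
  have hlt : ‖y - z‖ < ρ := by
    refine hyρ.lt_of_ne fun heq => ?_
    rw [hnsq, heq] at hneg
    linarith [hbd y hy.1 hyρ]
  have hgt : ρ / 2 < ‖y - z‖ := by
    by_contra! hle
    have h1 : ε ≤ S.supp y := isMinOn_iff.1 hx₀m y ⟨hy.1, hmemK.2 hle⟩
    have h2 : Real.exp (-α * ⟪y - z, y - z⟫) ≤ 1 := by
      rw [Real.exp_le_one_iff, hnsq]
      nlinarith [sq_nonneg ‖y - z‖]
    have h3 : 0 < ε * Real.exp (-α * ρ ^ 2) := by positivity
    nlinarith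
  have h1 := exp_barrier_lt hS hy.1 hε (hin y hy.1 hlt)
    (by linarith [show 0 < ε * Real.exp (-α * ρ ^ 2) by positivity]) (htan y hy.1 hyρ) (by
      have : ∀ᶠ x in 𝓝 y, ‖x - z‖ < ρ :=
        ContinuousAt.eventually_lt (by fun_prop) continuousAt_const hlt
      filter_upwards [this] with x hx hxM
      exact hymin x ⟨hxM, hmemK.2 hx.le⟩)
  have h2 := neg_le_of_abs_le (hB y hy.1)
  rw [hnsq] at h1
  have h3 : ρ ^ 2 / 4 ≤ ‖y - z‖ ^ 2 := by nlinarith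
  have h4 : α * (3 * ρ ^ 2 / 4) = 3 * ρ ^ 2 / 4 + (5 + B) := by
    rw [hαdef]; field_simp
  have h5 : α * (5 + B) ≤ 3 * α ^ 2 * ‖y - z‖ ^ 2 := by
    have h6 : 3 * α ^ 2 * (ρ ^ 2 / 4) ≤ 3 * α ^ 2 * ‖y - z‖ ^ 2 := by gcongr
    have h7 : 3 * α ^ 2 * (ρ ^ 2 / 4) = α * (α * (3 * ρ ^ 2 / 4)) := by ring
    rw [h7, h4] at h6
    nlinarith [sq_nonneg ρ]
  nlinarith

/-- At a zero of the support function touched from the positive side by a ball centred on the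
surface, the second fundamental form does not vanish. -/
theorem hessian_ne_zero_of_barrier {S : Surface3} (hS : IsShrinker S) {w z : E3}
    (hwz : w ≠ z) (hw0 : S.supp w = 0)
    (htan : ⟪w - z, S.ν w⟫ ^ 2 ≤ 1 / 4 * ⟪w - z, w - z⟫)
    {ε α : ℝ} (hε : 0 < ε) (hα : 0 < α)
    (hbar : ∀ x ∈ S.carrier, ⟪x - z, x - z⟫ ≤ ⟪w - z, w - z⟫ →
      ε * Real.exp (-α * ⟪x - z, x - z⟫) - ε * Real.exp (-α * ⟪w - z, w - z⟫) ≤ S.supp x)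
    {b : OrthonormalBasis (Fin 3) ℝ E3} {O : Set (ℝ × ℝ)} {u : ℝ × ℝ → ℝ}
    (hb : b 2 = S.ν w) (h : IsGraphChart S b w O u) (hs : dy (dx u) (pr b w) = 0) :
    dx (dx u) (pr b w) ≠ 0 := by
  intro hr
  obtain ⟨C₀, C₁, C₂, C₃, D₀, D₁, D₂, D₃, D₄, j⟩ := h.baseJets hS hb hs
  obtain ⟨jx, jy⟩ := h.hasJet2_support j
  obtain ⟨p0, q0⟩ := h.Du_base hb
  have ht := j.trace
  change _ + _ = -(1 / 2) * S.supp w at ht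
  rw [hr, hw0] at ht
  have ht0 : dy (dy u) (pr b w) = 0 := by linarith
  have gx := h.hasJet2_gr_line h.base_mem (1, 0)
  have gy := h.hasJet2_gr_line h.base_mem (0, 1)
  have e1 : fderiv ℝ u (pr b w) (1, 0) = 0 := p0
  have e2 : fderiv ℝ u (pr b w) (0, 1) = 0 := q0
  rw [h.gr_base, e1] at gx
  rw [h.gr_base, e2] at gy
  simp only [one_smul, zero_smul, add_zero, zero_add, Prod.smul_mk, smul_eq_mul, mul_one,
    mul_zero] at gx gy
  have key : ∀ {γ : ℝ → E3} {e v : E3} {s2 : ℝ}, HasJet2 γ w e v →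
      (∀ᶠ τ in 𝓝 0, γ τ ∈ S.carrier) →
      HasJet2 (fun τ => ⟪γ τ, S.ν (γ τ)⟫) (S.supp w) 0 s2 → ⟪w - z, e⟫ = 0 := by
    intro γ e v s2 jγ hγ js
    have j1 := jγ.sq_dist z
    have j2 := js.sub ((HasJet2.const ε).mul ((HasJet2.const (-α)).mul j1).exp)
    have h0 : γ 0 = w := jγ.1
    have h1 := mul_deriv_nonpos_of_eventually j1.hasDerivAt j2.hasDerivAt (by
      filter_upwards [hγ] with τ g1 g2
      rw [h0] at g2 ⊢
      have := hbar _ g1 g2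
      change S.supp w - _ ≤ S.supp _ - _
      rw [hw0]
      linarith)
    have h3 : 0 < 4 * ε * α * Real.exp (-α * ⟪w - z, w - z⟫) := by positivity
    have h4 : 4 * ε * α * Real.exp (-α * ⟪w - z, w - z⟫) * ⟪w - z, e⟫ ^ 2 ≤ 0 := by
      linear_combination h1
    by_contra hne
    have : 0 < ⟪w - z, e⟫ ^ 2 := by positivity
    nlinarith [mul_pos h3 this]
  rw [hr, mul_zero, neg_zero] at jx
  rw [ht0, mul_zero, neg_zero] at jy
  have kx := key gx ((h.eventually_x_mem h.base_mem).mono fun τ g => h.mem _ g) jx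
  have ky := key gy ((h.eventually_y_mem h.base_mem).mono fun τ g => h.mem _ g) jy
  have hsum := inner_eq_sum_basis b (w - z) (w - z)
  rw [kx, ky, hb] at hsum
  have hpos : 0 < ⟪w - z, w - z⟫ := real_inner_self_pos.2 (sub_ne_zero.2 hwz)
  nlinarith

/-- If the support function takes both positive and nonpositive values, it has a zero at which the
second fundamental form does not vanish. -/
theorem exists_zero_nondegenerate {S : Surface3} (hS : IsShrinker S) (hM : IsCompact S.carrier)
    (hconn : IsPreconnected S.carrier) (hpos : ∃ x ∈ S.carrier, 0 < S.supp x)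
    (hneg : ∃ x ∈ S.carrier, S.supp x ≤ 0) :
    ∃ w ∈ S.carrier, S.supp w = 0 ∧ ∀ (b : OrthonormalBasis (Fin 3) ℝ E3) (O : Set (ℝ × ℝ))
      (u : ℝ × ℝ → ℝ), b 2 = S.ν w → IsGraphChart S b w O u → dy (dx u) (pr b w) = 0 →
      dx (dx u) (pr b w) ≠ 0 := by
  obtain ⟨w₀, hw₀, hw₀0, hcl⟩ : ∃ w₀ ∈ S.carrier, S.supp w₀ ≤ 0 ∧
      w₀ ∈ closure (S.carrier ∩ {x | 0 < S.supp x}) := by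
    by_contra! hno
    obtain ⟨x, hx, hx0⟩ := hpos
    obtain ⟨y, hy, hy0⟩ := hneg
    obtain ⟨U, hU, hUeq⟩ : ∃ U, IsOpen U ∧ S.carrier ∩ {x | 0 < S.supp x} = S.carrier ∩ U := by
      obtain ⟨U, hU, hUe⟩ := continuousOn_iff'.1 S.continuousOn_supp (Ioi 0) isOpen_Ioi
      refine ⟨U, hU, ?_⟩
      rw [inter_comm _ U, ← hUe, inter_comm]
      rfl
    obtain ⟨v, hv, hvU, hvV⟩ := hconn U (closure (S.carrier ∩ {x | 0 < S.supp x}))ᶜ hU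
      isClosed_closure.isOpen_compl (fun v hv => by
        by_cases h : 0 < S.supp v
        · exact Or.inl (hUeq ▸ (show v ∈ S.carrier ∩ {x | 0 < S.supp x} from ⟨hv, h⟩)).2
        · exact Or.inr (hno v hv (not_lt.1 h)))
      ⟨x, hx, (hUeq ▸ (show x ∈ S.carrier ∩ {x | 0 < S.supp x} from ⟨hx, hx0⟩)).2⟩
      ⟨y, hy, hno y hy hy0⟩
    exact hvV (subset_closure (hUeq ▸ (show v ∈ S.carrier ∩ U from ⟨hv, hvU⟩)))
  obtain ⟨N, hN, htan⟩ := S.exists_nhds_tangential hw₀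
  obtain ⟨δ, hδ, hδN⟩ := Metric.mem_nhds_iff.1 hN
  obtain ⟨z, ⟨hz, hz0⟩, hzw⟩ := Metric.mem_closure_iff.1 hcl (δ / 3) (by positivity)
  replace hz0 : 0 < S.supp z := hz0
  have hQc : IsCompact (S.carrier ∩ {x | S.supp x ≤ 0}) := by
    refine IsCompact.of_isClosed_subset hM ?_ inter_subset_left
    exact S.continuousOn_supp.preimage_isClosed_of_isClosed hM.isClosed isClosed_Iic
  obtain ⟨w, ⟨hw, hw0⟩, hwmin⟩ := hQc.exists_isMinOn ⟨w₀, hw₀, hw₀0⟩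
    (f := fun x => ‖x - z‖) (Continuous.continuousOn (by fun_prop))
  replace hw0 : S.supp w ≤ 0 := hw0
  replace hwmin : ∀ x ∈ S.carrier, S.supp x ≤ 0 → ‖w - z‖ ≤ ‖x - z‖ := fun x hx hx0 =>
    isMinOn_iff.1 hwmin x ⟨hx, hx0⟩
  have hwz : w ≠ z := by rintro rfl; linarith
  set ρ := ‖w - z‖ with hρdef
  have hρ : 0 < ρ := norm_pos_iff.2 (sub_ne_zero.2 hwz)
  have hρδ : ρ < δ / 3 := by
    refine (hwmin w₀ hw₀ hw₀0).trans_lt ?_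
    rwa [← dist_eq_norm]
  have hball : ∀ x : E3, ‖x - z‖ ≤ ρ → x ∈ N := fun x hx => hδN (by
    rw [Metric.mem_ball]
    rw [dist_comm] at hzw
    have := dist_triangle x z w₀
    rw [dist_eq_norm x z] at this
    linarith)
  have htan' : ∀ x ∈ S.carrier, ‖x - z‖ ≤ ρ →
      ⟪x - z, S.ν x⟫ ^ 2 ≤ 1 / 4 * ⟪x - z, x - z⟫ := fun x hx hxρ => by
    have := htan x ⟨hx, hball x hxρ⟩ z ⟨hz, hball z (by simpa using hρ.le)⟩
    rw [real_inner_self_eq_norm_sq, ← sq_abs]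
    nlinarith [abs_nonneg ⟪x - z, S.ν x⟫, norm_nonneg (x - z)]
  have hin : ∀ x ∈ S.carrier, ‖x - z‖ < ρ → 0 < S.supp x := fun x hx hxρ => by
    by_contra! h
    exact absurd (hwmin x hx h) (not_le.2 hxρ)
  have hbd : ∀ x ∈ S.carrier, ‖x - z‖ ≤ ρ → 0 ≤ S.supp x := fun x hx hxρ => by
    by_contra! h
    have heq : ‖x - z‖ = ρ := le_antisymm hxρ (hwmin x hx h.le)
    have h1 := abs_inner_eq_of_closest (z := z) hS hx (by
      have hc : ContinuousAt S.supp x :=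
        continuousAt_id.inner (S.contDiffAt_normal hx).continuousAt
      filter_upwards [hc.eventually_lt_const h] with y hy hyM
      rw [real_inner_self_eq_norm_sq, real_inner_self_eq_norm_sq, heq]
      exact pow_le_pow_left₀ hρ.le (hwmin y hyM hy.le) 2)
    have h2 := htan' x hx hxρ
    rw [h1, real_inner_self_eq_norm_sq, heq] at h2
    nlinarith
  obtain ⟨ε, α, hε, hα, hbar⟩ := exists_barrier hS hM hz hρ htan' hin hbd
  have hw00 : S.supp w = 0 := le_antisymm hw0 (hbd w hw le_rfl)
  refine ⟨w, hw, hw00, fun b O u hb h hs => hessian_ne_zero_of_barrier hS hwz hw00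
    (htan' w hw le_rfl) hε hα (fun x hx hxw => ?_) hb h hs⟩
  have h1 : ‖x - z‖ ≤ ρ := by
    rw [real_inner_self_eq_norm_sq, real_inner_self_eq_norm_sq] at hxw
    exact le_of_sq_le_sq hxw hρ.le
  have := hbar x hx h1
  rwa [hρdef, ← real_inner_self_eq_norm_sq (w - z)] at this

end Hopf

section StarShaped

open Filter Topology Set

theorem HasJet2.eventually_pos {f : ℝ → ℝ} {w : ℝ} (h : HasJet2 f 0 0 w) (hw : 0 < w) :
    ∀ᶠ τ in 𝓝[≠] 0, 0 < f τ := by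
  have h1 := h.sub ((HasJet2.const (w / 4)).mul ((HasJet2.affine (0 : ℝ)).mul (HasJet2.affine 0)))
  set g : ℝ → ℝ := fun τ => f τ - w / 4 * ((0 + τ) * (0 + τ)) with hg
  obtain ⟨h0, g', h2, h3, h4⟩ := h1
  have h5 : deriv g =ᶠ[𝓝 0] g' := h2.mono fun τ hτ => hτ.deriv
  have h6 : IsLocalMin g 0 := isLocalMin_of_deriv_deriv_pos
    (by rw [h5.deriv_eq, h4.deriv]; linarith)
    (by rw [h5.self_of_nhds, h3]; ring) h2.self_of_nhds.continuousAt
  filter_upwards [nhdsWithin_le_nhds h6, self_mem_nhdsWithin] with τ hτ (hτ0 : τ ≠ 0)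
  have : 0 < τ ^ 2 := by positivity
  rw [h0] at hτ
  simp only [hg] at hτ
  nlinarith

theorem exists_planar_coordinate {M : Set E3} (e : M ≃ₜ (Metric.sphere (0 : E3) 1 : Set E3))
    {q : E3} (hq : q ∈ M) : ∃ θ : E3 → ℂ, ContinuousOn θ (M \ {q}) ∧ InjOn θ (M \ {q}) ∧
      ∀ U, IsOpen U → IsOpen (θ '' ((M \ {q}) ∩ U)) := by
  classical
  have : Fact (Module.finrank ℝ E3 = 2 + 1) := ⟨by simp⟩
  let E : OpenPartialHomeomorph M ℂ := (e.toOpenPartialHomeomorph.trans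
    (stereographic' 2 (e ⟨q, hq⟩))).trans
      Complex.orthonormalBasisOneI.repr.symm.toHomeomorph.toOpenPartialHomeomorph
  have hsrc : E.source = {(⟨q, hq⟩ : M)}ᶜ := by
    ext x
    simp [E]
  let θ : E3 → ℂ := fun x => if hx : x ∈ M then E ⟨x, hx⟩ else 0
  have hθ : ∀ x : M, θ x = E x := fun x => by simp [θ]
  have hmem : ∀ {x : E3} (hx : x ∈ M), x ≠ q → (⟨x, hx⟩ : M) ∈ E.source := by
    intro x hx hxq
    rw [hsrc]
    simpa using hxq
  refine ⟨θ, ?_, ?_, ?_⟩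
  · rintro x ⟨hx, hxq⟩
    have h1 : ContinuousAt E ⟨x, hx⟩ := E.continuousAt (hmem hx hxq)
    have h2 : Tendsto θ (𝓝[M] x) (𝓝 (θ x)) := by
      rw [← map_nhds_subtype_val ⟨x, hx⟩, tendsto_map'_iff]
      have : θ ∘ (Subtype.val : M → E3) = E := funext hθ
      rw [this, hθ ⟨x, hx⟩]
      exact h1
    exact h2.mono_left (nhdsWithin_mono x sdiff_subset)
  · rintro x ⟨hx, hxq⟩ y ⟨hy, hyq⟩ hxy
    have := E.injOn (hmem hx hxq) (hmem hy hyq) (by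
      rw [← hθ ⟨x, hx⟩, ← hθ ⟨y, hy⟩]; exact hxy)
    exact congrArg Subtype.val this
  · intro U hU
    have h1 : θ '' ((M \ {q}) ∩ U) = E '' (E.source ∩ Subtype.val ⁻¹' U) := by
      ext c
      constructor
      · rintro ⟨x, ⟨⟨hx, hxq⟩, hxU⟩, rfl⟩
        exact ⟨⟨x, hx⟩, ⟨hmem hx hxq, hxU⟩, (hθ ⟨x, hx⟩).symm⟩
      · rintro ⟨x, ⟨hx, hxU⟩, rfl⟩
        refine ⟨x, ⟨⟨x.2, fun hxq => ?_⟩, hxU⟩, hθ x⟩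
        rw [hsrc] at hx
        exact hx (Subtype.ext hxq)
    rw [h1]
    exact E.isOpen_image_source_inter (hU.preimage continuous_subtype_val)

/-- A surface of genus zero satisfying the two-piece property has no tangent plane through the
origin touching it to second order in a saddle. -/
theorem saddle_false {S : Surface3} (hS : IsShrinker S) (hM : IsCompact S.carrier)
    (e : S.carrier ≃ₜ (Metric.sphere (0 : E3) 1 : Set E3)) {w : E3}
    (hw0 : S.supp w = 0) {b : OrthonormalBasis (Fin 3) ℝ E3} {O : Set (ℝ × ℝ)} {u : ℝ × ℝ → ℝ}
    (hb : b 2 = S.ν w) (h : IsGraphChart S b w O u) (hs : dy (dx u) (pr b w) = 0)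
    (hr : dx (dx u) (pr b w) ≠ 0) : False := by
  set z := pr b w with hz
  set r := dx (dx u) z with hrdef
  obtain ⟨hp0, hq0⟩ := h.Du_base hb
  have hu0 : u z = 0 := by rw [h.u_base, hb, real_inner_comm]; exact hw0
  have htr : dy (dy u) z = -r := by
    obtain ⟨C₀, C₁, C₂, C₃, D₀, D₁, D₂, D₃, D₄, j⟩ := h.baseJets hS hb hs
    have := j.trace
    change r + dy (dy u) z = -(1 / 2) * S.supp w at this
    rw [hw0] at this
    linarith
  have hjx : HasJet2 (fun τ : ℝ => u (z + (τ, 0))) 0 0 r := by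
    have := hasJet2_x (h.smooth_base.of_le (show (2 : WithTop ℕ∞) ≤ 4 by norm_num))
    rwa [hp0, ← hz, hu0] at this
  have hjy : HasJet2 (fun τ : ℝ => u (z + (0, τ))) 0 0 (-r) := by
    have := hasJet2_y (h.smooth_base.of_le (show (2 : WithTop ℕ∞) ≤ 4 by norm_num))
    rwa [hq0, ← hz, hu0, htr] at this
  obtain ⟨s, hs1, hsr⟩ : ∃ s : ℝ, s ^ 2 = 1 ∧ 0 < s * r := by
    rcases lt_or_gt_of_ne hr with hr | hr
    · exact ⟨-1, by norm_num, by linarith⟩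
    · exact ⟨1, by norm_num, by linarith⟩
  have ex : ∀ᶠ τ in 𝓝[≠] (0 : ℝ), 0 < s * u (z + (τ, 0)) := by
    have := (HasJet2.const s).mul hjx
    simp only [mul_zero, add_zero] at this
    exact HasJet2.eventually_pos this (by linarith)
  have ey : ∀ᶠ τ in 𝓝[≠] (0 : ℝ), 0 < -s * u (z + (0, τ)) := by
    have := (HasJet2.const (-s)).mul hjy
    simp only [mul_zero, add_zero] at this
    exact HasJet2.eventually_pos this (by linarith)
  obtain ⟨V, hV, hwV, hsurj⟩ := h.surj
  have hcgr : ∀ y ∈ O, ContinuousAt (gr b u) y := fun y hy =>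
    (hasFDerivAt_gr b ((h.smooth y hy).differentiableAt (by norm_num))).continuousAt
  have hnear : ∀ᶠ y in 𝓝 z, y ∈ O ∧ gr b u y ∈ V :=
    (show ∀ᶠ y in 𝓝 z, y ∈ O from h.isOpen.mem_nhds h.base_mem).and
      ((hcgr z h.base_mem).eventually (hV.mem_nhds (by rw [h.gr_base]; exact hwV)))
  obtain ⟨κ₁, hκ₁, hball⟩ := Metric.eventually_nhds_iff_ball.1 hnear
  obtain ⟨κ₂, hκ₂, hex⟩ := Metric.eventually_nhds_iff_ball.1
    (eventually_nhdsWithin_iff.1 (ex.and ey))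
  obtain ⟨κ, hκ, hκ1, hκ2⟩ : ∃ κ : ℝ, 0 < κ ∧ κ ≤ κ₁ ∧ κ ≤ κ₂ :=
    ⟨min κ₁ κ₂, lt_min hκ₁ hκ₂, min_le_left _ _, min_le_right _ _⟩
  have hO : ∀ v : ℝ × ℝ, ‖v‖ < κ → z + v ∈ O ∧ gr b u (z + v) ∈ V := fun v hv =>
    hball _ (by rw [Metric.mem_ball, dist_eq_norm, add_sub_cancel_left]; linarith)
  have hxy : ∀ τ : ℝ, |τ| < κ → τ ≠ 0 → 0 < s * u (z + (τ, 0)) ∧ 0 < -s * u (z + (0, τ)) :=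
    fun τ h1 h2 => hex τ (by rw [Metric.mem_ball, Real.dist_eq, sub_zero]; linarith) h2
  have hcu : ∀ v : ℝ × ℝ, ‖v‖ < κ → ContinuousAt u (z + v) := fun v hv =>
    (h.smooth _ (hO v hv).1).continuousAt
  obtain ⟨v₁, hv₁, hv₁', hv₁0⟩ : ∃ v : ℝ × ℝ, κ / 4 ≤ ‖v‖ ∧ ‖v‖ < κ ∧ u (z + v) = 0 := by
    have hn : ∀ σ ∈ Icc (0 : ℝ) 1, κ / 4 ≤ ‖((κ / 2 * σ, κ / 2 * (1 - σ)) : ℝ × ℝ)‖ ∧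
        ‖((κ / 2 * σ, κ / 2 * (1 - σ)) : ℝ × ℝ)‖ < κ := by
      rintro σ ⟨h0, h1⟩
      rw [Prod.norm_mk, Real.norm_eq_abs, Real.norm_eq_abs, abs_of_nonneg (by positivity),
        abs_of_nonneg (mul_nonneg (by positivity) (by linarith))]
      constructor
      · rw [le_max_iff]
        rcases le_total σ (1 / 2) with h | h
        · right; nlinarith
        · left; nlinarith
      · rw [max_lt_iff]
        constructor <;> nlinarith
    have hc : ContinuousOn (fun σ : ℝ => s * u (z + (κ / 2 * σ, κ / 2 * (1 - σ)))) (Icc 0 1) :=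
      fun σ hσ => by
        have h1 : ContinuousAt (fun σ : ℝ => z + ((κ / 2 * σ, κ / 2 * (1 - σ)) : ℝ × ℝ)) σ := by
          fun_prop
        have h2 := ContinuousAt.comp (f := fun σ : ℝ => z + ((κ / 2 * σ, κ / 2 * (1 - σ)) : ℝ × ℝ))
          (hcu _ (hn σ hσ).2) h1
        exact (continuousAt_const.mul h2).continuousWithinAt
    have hκ' : |κ / 2| < κ := by rw [abs_of_pos (by positivity)]; linarith
    have hpq := hxy (κ / 2) hκ' (by positivity)
    obtain ⟨σ, hσ, hσ0⟩ := intermediate_value_Icc zero_le_one hc (show (0 : ℝ) ∈ _ by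
      constructor
      · simp only [mul_zero, sub_zero, mul_one]; linarith
      · simp only [mul_one, sub_self, mul_zero]; linarith)
    refine ⟨_, (hn σ hσ).1, (hn σ hσ).2, ?_⟩
    rcases mul_eq_zero.1 hσ0 with h0 | h0
    · rw [h0] at hs1; norm_num at hs1
    · exact h0
  set q := gr b u (z + v₁) with hq
  have hqM : q ∈ S.carrier := h.mem _ (hO v₁ hv₁').1
  obtain ⟨θ, hθc, hθi, hθo⟩ := exists_planar_coordinate e hqM
  have hb2 : ‖b 2‖ = 1 := b.norm_eq_one 2
  have hfq : ⟪b 2, q⟫ = 0 := by rw [hq, inner_gr, hv₁0]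
  have hhalf : ∀ σ : ℝ, S.carrier ∩ {x | 0 < ⟪σ • b 2, x⟫} ⊆ S.carrier \ {q} := by
    rintro σ x ⟨hx, hx0⟩
    refine ⟨hx, fun hxq => ?_⟩
    rw [hxq, Set.mem_ofPred_eq, real_inner_smul_left, hfq, mul_zero] at hx0
    exact lt_irrefl _ hx0
  have hconn : ∀ σ : ℝ, σ ^ 2 = 1 →
      IsPreconnected (θ '' (S.carrier ∩ {x | 0 < ⟪σ • b 2, x⟫})) := fun σ hσ => by
    refine (isPreconnected_halfspace hS hM ?_).image θ (hθc.mono (hhalf σ))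
    rw [norm_smul, hb2, mul_one, Real.norm_eq_abs]
    rwa [← sq_abs, pow_eq_one_iff_of_nonneg (abs_nonneg σ) two_ne_zero] at hσ
  have hsmall : ∀ v ∈ Metric.ball (0 : ℝ × ℝ) 1, ‖(κ / 4) • v‖ < κ / 4 := fun v hv => by
    rw [mem_ball_zero_iff] at hv
    rw [norm_smul, Real.norm_eq_abs, abs_of_pos (by positivity)]
    nlinarith
  have hsmall' : ∀ v ∈ Metric.ball (0 : ℝ × ℝ) 1, ‖(κ / 4) • v‖ < κ := fun v hv =>
    (hsmall v hv).trans (by linarith)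
  have hinj : InjOn (fun v : ℝ × ℝ => gr b u (z + (κ / 4) • v)) (Metric.ball 0 1) := by
    intro v hv v' hv' hvv
    have := congrArg (pr b) hvv
    simp only [pr_gr, add_right_inj] at this
    exact smul_right_injective _ (by positivity : κ / 4 ≠ 0) this
  have hmaps : MapsTo (fun v : ℝ × ℝ => gr b u (z + (κ / 4) • v)) (Metric.ball 0 1)
      (S.carrier \ {q}) := by
    intro v hv
    refine ⟨h.mem _ (hO _ (hsmall' v hv)).1, fun hvq => ?_⟩
    have := congrArg (pr b) hvq
    simp only [hq, pr_gr, add_right_inj] at this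
    have h1 := hsmall v hv
    rw [this] at h1
    linarith
  have hwz : gr b u (z + (κ / 4) • (0 : ℝ × ℝ)) = w := by rw [smul_zero, add_zero, h.gr_base]
  have hwM : w ∈ S.carrier \ {q} := by
    have := hmaps (Metric.mem_ball_self (x := (0 : ℝ × ℝ)) one_pos)
    dsimp only at this
    rwa [hwz] at this
  have hw_not : ∀ σ : ℝ, θ w ∉ θ '' (S.carrier ∩ {x | 0 < ⟪σ • b 2, x⟫}) := by
    rintro σ ⟨x, hx, hxw⟩
    have : x = w := hθi (hhalf σ hx) hwM hxw
    subst this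
    have h1 := hx.2
    rw [Set.mem_ofPred_eq, real_inner_smul_left, hb, real_inner_comm] at h1
    change 0 < σ * S.supp x at h1
    rw [hw0, mul_zero] at h1
    exact lt_irrefl _ h1
  refine planar_saddle_false (Φ := fun v => θ (gr b u (z + (κ / 4) • v)))
    (V₁ := θ '' (S.carrier ∩ {x | 0 < ⟪s • b 2, x⟫}))
    (V₂ := θ '' (S.carrier ∩ {x | 0 < ⟪(-s) • b 2, x⟫})) ?_ ?_ ?_ (hconn s hs1) ?_
    (hconn (-s) (by rw [neg_sq, hs1])) ?_ ?_ ?_ ?_ ?_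
  · refine hθc.comp (fun v hv => ?_) hmaps
    have h1 : ContinuousAt (fun v : ℝ × ℝ => z + (κ / 4) • v) v := by fun_prop
    exact (ContinuousAt.comp (f := fun v : ℝ × ℝ => z + (κ / 4) • v)
      (hcgr _ (hO _ (hsmall' v hv)).1) h1).continuousWithinAt
  · exact hθi.comp hinj hmaps
  · intro U hU hUo
    have h1 : (fun v => θ (gr b u (z + (κ / 4) • v))) '' U = θ '' ((S.carrier \ {q}) ∩
        (V ∩ (fun x => (κ / 4)⁻¹ • (pr b x - z)) ⁻¹' U)) := by
      ext c
      constructor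
      · rintro ⟨v, hv, rfl⟩
        refine ⟨_, ⟨hmaps (hU hv), (hO _ (hsmall' v (hU hv))).2, ?_⟩, rfl⟩
        rw [mem_preimage, pr_gr, add_sub_cancel_left, inv_smul_smul₀ (by positivity)]
        exact hv
      · rintro ⟨x, ⟨hx, hxV, hxU⟩, rfl⟩
        refine ⟨_, hxU, ?_⟩
        dsimp only
        rw [smul_inv_smul₀ (by positivity), add_sub_cancel, (hsurj x hx.1 hxV).2]
    rw [h1]
    refine hθo _ (hV.inter (hUo.preimage ?_))
    have := continuous_pr b
    fun_prop
  · have h1 : S.carrier ∩ {x | 0 < ⟪(-s) • b 2, x⟫} =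
        (S.carrier \ {q}) ∩ {x | 0 < ⟪(-s) • b 2, x⟫} := by
      refine Subset.antisymm (fun x hx => ⟨hhalf _ hx, hx.2⟩) fun x hx => ⟨hx.1.1, hx.2⟩
    rw [h1]
    exact hθo _ (isOpen_lt continuous_const (by fun_prop))
  · rw [Set.disjoint_left]
    rintro c ⟨x, hx, rfl⟩ ⟨y, hy, hxy'⟩
    have : y = x := hθi (hhalf _ hy) (hhalf _ hx) hxy'
    subst this
    have h1 := hx.2
    have h2 := hy.2
    rw [Set.mem_ofPred_eq, real_inner_smul_left] at h1 h2
    linarith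
  · rw [hwz]
    exact hw_not s
  · rw [hwz]
    exact hw_not (-s)
  · intro x hx hx0
    have h1 : |κ / 4 * x| < κ := by
      rw [abs_mul, abs_of_pos (show 0 < κ / 4 by positivity)]; nlinarith [abs_nonneg x]
    refine ⟨_, ⟨h.mem _ (hO ((κ / 4) • (x, 0)) ?_).1, ?_⟩, rfl⟩
    · rw [Prod.smul_mk, Prod.norm_mk, smul_zero, norm_zero, max_lt_iff]
      exact ⟨h1, hκ⟩
    · rw [Set.mem_ofPred_eq, real_inner_smul_left, inner_gr]
      simpa using (hxy (κ / 4 * x) h1 (by positivity)).1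
  · intro x hx hx0
    have h1 : |κ / 4 * x| < κ := by
      rw [abs_mul, abs_of_pos (show 0 < κ / 4 by positivity)]; nlinarith [abs_nonneg x]
    refine ⟨_, ⟨h.mem _ (hO ((κ / 4) • (0, x)) ?_).1, ?_⟩, rfl⟩
    · rw [Prod.smul_mk, Prod.norm_mk, smul_eq_mul, smul_eq_mul, mul_zero, norm_zero, max_lt_iff]
      exact ⟨hκ, h1⟩
    · rw [Set.mem_ofPred_eq, real_inner_smul_left, inner_gr]
      simpa using (hxy (κ / 4 * x) h1 (by positivity)).2

end StarShaped

section StarShaped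

open Filter Topology Set

/-- The surface with the opposite unit normal. -/
def Surface3.flip (S : Surface3) : Surface3 where
  carrier := S.carrier
  ν := fun x => -S.ν x
  localDef := fun p hp => by
    obtain ⟨U, hU, hpU, f, hf, hfU, hg⟩ := S.localDef p hp
    have key : ∀ x, gradient (fun y => -f y) x = -gradient f x := fun x => by
      rw [gradient, gradient, fderiv_fun_neg, map_neg]
    refine ⟨U, hU, hpU, fun x => -f x, hf.neg, fun x hx => ?_, fun x hx => ?_⟩
    · rw [hfU x hx, neg_eq_zero]
    · rw [key, norm_neg, smul_neg, (hg x hx).2]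
      exact ⟨neg_ne_zero.2 (hg x hx).1, rfl⟩

theorem Surface3.supp_flip (S : Surface3) (x : E3) : S.flip.supp x = -S.supp x :=
  inner_neg_right _ _

theorem IsShrinker.flip {S : Surface3} (hS : IsShrinker S) : IsShrinker S.flip := fun p hp => by
  have h1 : meanCurv S.flip p = -meanCurv S p := by
    simp only [meanCurv, Surface3.flip, fderiv_fun_neg, neg_apply, inner_neg_left,
      Finset.sum_neg_distrib]
  have h2 : (⟪p, S.flip.ν p⟫ : ℝ) = -⟪p, S.ν p⟫ := inner_neg_right _ _
  rw [h1, h2, hS p hp]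
  ring

theorem sq_supp_eq_of_farthest {S : Surface3} (hS : IsShrinker S) {p : E3} (hp : p ∈ S.carrier)
    (hmax : ∀ x ∈ S.carrier, ‖x‖ ≤ ‖p‖) : S.supp p ^ 2 = ‖p‖ ^ 2 := by
  obtain ⟨b, γ, δ, r, t, hb, hγ, hδ, jγ, jδ, -⟩ := exists_frame hS hp
  have key : ∀ {γ : ℝ → E3} {e v : E3}, (∀ᶠ τ in 𝓝 0, γ τ ∈ S.carrier) → HasJet2 γ p e v →
      ⟪p, e⟫ = 0 := fun hγ jγ => by
    have := (((HasJet2.const (-1 : ℝ)).mul (jγ.sq_dist 0)).hasDerivAt_of_isLocalMin (by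
      filter_upwards [hγ] with τ g1
      simp only [sub_zero, real_inner_self_eq_norm_sq]
      linarith [pow_le_pow_left₀ (norm_nonneg _) (hmax _ g1) 2])).1
    simp only [sub_zero] at this
    linarith
  have h1 := inner_eq_sum_basis b p p
  rw [key hγ jγ, key hδ jδ, hb, real_inner_self_eq_norm_sq] at h1
  rw [Surface3.supp]
  linarith

/-- A compact genus-zero shrinker can be oriented so that its support function is positive. -/
theorem exists_supp_pos {S : Surface3} (hS : IsShrinker S) (hM : IsCompact S.carrier)
    (e : S.carrier ≃ₜ (Metric.sphere (0 : E3) 1 : Set E3)) (hconn : IsPreconnected S.carrier)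
    (hnt : S.carrier.Nontrivial) :
    ∃ S' : Surface3, S'.carrier = S.carrier ∧ IsShrinker S' ∧ ∀ x ∈ S'.carrier, 0 < S'.supp x := by
  have key : ∀ {T : Surface3}, IsShrinker T → T.carrier = S.carrier →
      (∃ x ∈ T.carrier, 0 < T.supp x) → ∀ x ∈ T.carrier, 0 < T.supp x := by
    intro T hT hTS hpos
    by_contra! hneg
    obtain ⟨w, hw, hw0, hnd⟩ := exists_zero_nondegenerate hT (hTS ▸ hM) (hTS ▸ hconn) hpos hneg
    obtain ⟨b, O, u, hb, h, hs⟩ := exists_diagonal_chart T hw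
    exact saddle_false hT (hTS ▸ hM) ((Homeomorph.setCongr hTS).trans e) hw0 hb h hs
      (hnd b O u hb h hs)
  obtain ⟨p, hp, hpmax⟩ := hM.exists_isMaxOn hnt.nonempty (f := fun x => ‖x‖)
    continuous_norm.continuousOn
  have hpmax' : ∀ x ∈ S.carrier, ‖x‖ ≤ ‖p‖ := fun x hx => isMaxOn_iff.1 hpmax x hx
  have hp0 : 0 < ‖p‖ := by
    obtain ⟨x, hx, hx0⟩ := hnt.exists_ne 0
    exact (norm_pos_iff.2 hx0).trans_le (hpmax' x hx)
  have hne : S.supp p ≠ 0 := fun h0 => by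
    have := sq_supp_eq_of_farthest hS hp hpmax'
    rw [h0] at this
    nlinarith
  rcases lt_or_gt_of_ne hne with h | h
  · exact ⟨S.flip, rfl, hS.flip, key hS.flip rfl ⟨p, hp, by rw [S.supp_flip]; linarith⟩⟩
  · exact ⟨S, rfl, hS, key hS rfl ⟨p, hp, h⟩⟩

end StarShaped

section GaussCurvature

open Filter Topology Set

theorem det_inner_map (f : E3 →L[ℝ] E3) (v w : Fin 3 → E3) :
    (Matrix.of fun i j => (⟪f (v i), w j⟫ : ℝ)).det =
      f.det * (Matrix.of fun i j => (⟪v i, w j⟫ : ℝ)).det := by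
  set b := EuclideanSpace.basisFun (Fin 3) ℝ
  have key : ∀ x : Fin 3 → E3, (Matrix.of fun i j => (⟪x i, w j⟫ : ℝ)).det =
      b.toBasis.det x * b.toBasis.det w := fun x => by
    rw [Module.Basis.det_apply, Module.Basis.det_apply, ← Matrix.det_transpose (b.toBasis.toMatrix x),
      ← Matrix.det_mul]
    congr 1
    ext i j
    simp only [Matrix.of_apply, Matrix.mul_apply, Matrix.transpose_apply,
      Module.Basis.toMatrix_apply, OrthonormalBasis.coe_toBasis_repr_apply]
    rw [← b.sum_inner_mul_inner]
    refine Finset.sum_congr rfl fun k _ => ?_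
    rw [b.repr_apply_apply, b.repr_apply_apply, real_inner_comm]
  rw [key v, ← mul_assoc]
  have h1 := Module.Basis.det_comp b.toBasis (f : E3 →ₗ[ℝ] E3) v
  have h2 : b.toBasis.det (fun i => f (v i)) = f.det * b.toBasis.det v := h1
  rw [← h2]
  exact key fun i => f (v i)

/-- The Gauss curvature, as the determinant of the derivative of the unit normal, extended by the
identity on the normal line. -/
def Surface3.gaussCurv (S : Surface3) (x : E3) : ℝ :=
  (fderiv ℝ S.ν x + (innerSL ℝ (S.ν x)).smulRight (S.ν x)).det

theorem Surface3.continuousOn_gaussCurv (S : Surface3) : ContinuousOn S.gaussCurv S.carrier := by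
  intro x hx
  have h1 : ContinuousAt S.ν x := (S.contDiffAt_normal hx).continuousAt
  have h2 : ContinuousAt (fderiv ℝ S.ν) x :=
    ((S.contDiffAt_normal hx).fderiv_right (m := 3) (by norm_num)).continuousAt
  have h3 : ContinuousAt (fun y => (innerSL ℝ (S.ν y)).smulRight (S.ν y)) x :=
    (((innerSL ℝ (E := E3)).contDiff.contDiffAt.comp x (S.contDiffAt_normal hx)).smulRight
      (S.contDiffAt_normal hx)).continuousAt
  exact (ContinuousLinearMap.continuous_det.continuousAt.comp (h2.add h3)).continuousWithinAt

theorem IsGraphChart.gaussCurv_eq {S : Surface3} {b : OrthonormalBasis (Fin 3) ℝ E3} {p : E3}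
    {O : Set (ℝ × ℝ)} {u : ℝ × ℝ → ℝ} (h : IsGraphChart S b p O u) {z : ℝ × ℝ} (hz : z ∈ O) :
    S.gaussCurv (gr b u z) * (1 + dx u z ^ 2 + dy u z ^ 2) ^ 2 =
      dx (dx u) z * dy (dy u) z - dy (dx u) z ^ 2 := by
  have n01 := inner_basis_ne b (show (0 : Fin 3) ≠ 1 by decide)
  have n02 := inner_basis_ne b (show (0 : Fin 3) ≠ 2 by decide)
  have n10 := inner_basis_ne b (show (1 : Fin 3) ≠ 0 by decide)
  have n12 := inner_basis_ne b (show (1 : Fin 3) ≠ 2 by decide)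
  have n20 := inner_basis_ne b (show (2 : Fin 3) ≠ 0 by decide)
  have n21 := inner_basis_ne b (show (2 : Fin 3) ≠ 1 by decide)
  have hu := h.smooth z hz
  have hcomm : dx (dy u) z = dy (dx u) z := dx_dy_comm (hu.of_le (by norm_num))
  set W := √(1 + dx u z ^ 2 + dy u z ^ 2) with hW
  have hWpos : 0 < W := Real.sqrt_pos.2 (by positivity)
  have hW2 : W ^ 2 = 1 + dx u z ^ 2 + dy u z ^ 2 := Real.sq_sqrt (by positivity)
  set m := gr b u z with hm
  set L := fderiv ℝ S.ν m with hL
  set p' := dx u z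
  set q' := dy u z
  let T : ℝ × ℝ → E3 := fun e => e.1 • b 0 + e.2 • b 1 + fderiv ℝ u z e • b 2
  have hT1 : T (1, 0) = b 0 + p' • b 2 := by simp [T, p', dx]
  have hT2 : T (0, 1) = b 1 + q' • b 2 := by simp [T, q', dy]
  have h11 := h.inner_fderiv_normal hz (1, 0) (1, 0)
  have h12 := h.inner_fderiv_normal hz (1, 0) (0, 1)
  have h21 := h.inner_fderiv_normal hz (0, 1) (1, 0)
  have h22 := h.inner_fderiv_normal hz (0, 1) (0, 1)
  change W * ⟪L (T (1, 0)), T (1, 0)⟫ = _ at h11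
  change W * ⟪L (T (1, 0)), T (0, 1)⟫ = _ at h12
  change W * ⟪L (T (0, 1)), T (1, 0)⟫ = _ at h21
  change W * ⟪L (T (0, 1)), T (0, 1)⟫ = _ at h22
  rw [hT1] at h11 h12 h21
  rw [hT2] at h12 h21 h22
  simp only [fderiv_eq_dx_dy, one_mul, zero_mul, add_zero, zero_add, hcomm] at h11 h12 h21 h22
  have hν := h.normal z hz
  rw [← hm, ← hW] at hν
  have hN1 : ⟪S.ν m, b 0 + p' • b 2⟫ = 0 := by
    rw [hν]
    simp only [inner_sub_left, inner_add_right, inner_smul_right, inner_smul_left,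
      n02, n10, n12, n20, inner_basis_same]
    simp only [conj_trivial]
    ring
  have hN2 : ⟪S.ν m, b 1 + q' • b 2⟫ = 0 := by
    rw [hν]
    simp only [inner_sub_left, inner_add_right, inner_smul_right, inner_smul_left,
      n01, n02, n12, n21, inner_basis_same]
    simp only [conj_trivial]
    ring
  have hNN : ⟪S.ν m, S.ν m⟫ = 1 := by
    rw [real_inner_self_eq_norm_sq, S.norm_normal (h.mem z hz), one_pow]
  have hLN : ∀ v, ⟪L v, S.ν m⟫ = 0 := S.inner_fderiv_normal (h.mem z hz)
  have hdet := det_inner_map (L + (innerSL ℝ (S.ν m)).smulRight (S.ν m))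
    ![b 0 + p' • b 2, b 1 + q' • b 2, S.ν m] ![b 0 + p' • b 2, b 1 + q' • b 2, S.ν m]
  rw [Matrix.det_fin_three, Matrix.det_fin_three] at hdet
  have e00 : ⟪b 0 + p' • b 2, b 0 + p' • b 2⟫ = 1 + p' ^ 2 := by
    simp only [inner_add_left, inner_add_right, inner_smul_right, inner_smul_left,
      n02, n20, inner_basis_same]
    simp; ring
  have e01 : ⟪b 0 + p' • b 2, b 1 + q' • b 2⟫ = p' * q' := by
    simp only [inner_add_left, inner_add_right, inner_smul_right, inner_smul_left,
      n01, n02, n21, inner_basis_same]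
    simp; ring
  have e11 : ⟪b 1 + q' • b 2, b 1 + q' • b 2⟫ = 1 + q' ^ 2 := by
    simp only [inner_add_left, inner_add_right, inner_smul_right, inner_smul_left,
      n12, n21, inner_basis_same]
    simp; ring
  have e10 : ⟪b 1 + q' • b 2, b 0 + p' • b 2⟫ = p' * q' := by rw [real_inner_comm, e01]
  have f0 : ⟪b 0 + p' • b 2, S.ν m⟫ = 0 := by rw [real_inner_comm, hN1]
  have f1 : ⟪b 1 + q' • b 2, S.ν m⟫ = 0 := by rw [real_inner_comm, hN2]
  simp only [Matrix.of_apply, Matrix.cons_val, add_apply, ContinuousLinearMap.smulRight_apply,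
    innerSL_apply_apply, inner_add_left (L _), real_inner_smul_left (S.ν m), hN1, hN2, hNN, hLN,
    e00, e01, e10, e11, f0, f1, zero_mul, mul_zero, add_zero, sub_zero, zero_add, mul_one] at hdet
  change _ = S.gaussCurv m * _ at hdet
  rw [← hW2]
  have h3 : S.gaussCurv m * W ^ 2 * W ^ 2 = (W * ⟪L (b 0 + p' • b 2), b 0 + p' • b 2⟫) *
      (W * ⟪L (b 1 + q' • b 2), b 1 + q' • b 2⟫) -
      (W * ⟪L (b 0 + p' • b 2), b 1 + q' • b 2⟫) *
      (W * ⟪L (b 1 + q' • b 2), b 0 + p' • b 2⟫) := by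
    have h4 : S.gaussCurv m * W ^ 2 =
        S.gaussCurv m * ((1 + p' ^ 2) * (1 + q' ^ 2) - p' * q' * (p' * q')) := by
      rw [hW2]; ring
    rw [h4, ← hdet]
    ring
  rw [h11, h12, h21, h22] at h3
  change _ = dx (dx u) z * dy (dy u) z - _
  change _ = -(dx (dx u) z) * -(dy (dy u) z) - -(dy (dx u) z) * -(dy (dx u) z) at h3
  linear_combination h3

end GaussCurvature

section PerturbedMinimum

open Filter Topology Set

theorem IsGraphChart.norm_sq_gr (b : OrthonormalBasis (Fin 3) ℝ E3) (u : ℝ × ℝ → ℝ) (z : ℝ × ℝ) :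
    ‖gr b u z‖ ^ 2 = z.1 ^ 2 + z.2 ^ 2 + u z ^ 2 := by
  have h := congrArg Prod.fst (pr_gr b u z)
  have h' := congrArg Prod.snd (pr_gr b u z)
  simp only [pr] at h h'
  rw [← real_inner_self_eq_norm_sq, inner_eq_sum_basis b, real_inner_comm, h,
    real_inner_comm (b 1), h', real_inner_comm (b 2), inner_gr]
  ring

theorem hasJet2_norm_sq {x y u : ℝ → ℝ} {x₀ y₀ x₁ y₁ a u₂ : ℝ}
    (hx : HasJet2 x x₀ x₁ 0) (hy : HasJet2 y y₀ y₁ 0) (hu : HasJet2 u a 0 u₂) :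
    HasJet2 (fun τ => x τ ^ 2 + y τ ^ 2 + u τ ^ 2) (x₀ ^ 2 + y₀ ^ 2 + a ^ 2)
      (2 * x₀ * x₁ + 2 * y₀ * y₁) (2 * x₁ ^ 2 + 2 * y₁ ^ 2 + 2 * a * u₂) := by
  convert ((hx.mul hx).add (hy.mul hy)).add (hu.mul hu) using 1
  · ext τ; ring
  all_goals ring

/-- The two-jet, at a critical point of a graph, of the function whose sign compares the quotient
of the Gauss curvature by the squared support function with its perturbation. -/
theorem hasJet2_comparison {p q r s t h n : ℝ → ℝ}
    {p₁ p₂ q₁ q₂ r₀ r₁ r₂ s₁ s₂ t₀ t₁ t₂ a h₁ h₂ n₀ n₁ n₂ : ℝ} (ε β m : ℝ)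
    (hp : HasJet2 p 0 p₁ p₂) (hq : HasJet2 q 0 q₁ q₂) (hr : HasJet2 r r₀ r₁ r₂)
    (hs : HasJet2 s 0 s₁ s₂) (ht : HasJet2 t t₀ t₁ t₂) (hh : HasJet2 h a h₁ h₂)
    (hn : HasJet2 n n₀ n₁ n₂) :
    HasJet2 (fun τ => r τ * t τ - s τ ^ 2 -
        (1 + p τ ^ 2 + q τ ^ 2) ^ 2 * (ε * Real.exp (β * n τ) * h τ + m * h τ ^ 2))
      (r₀ * t₀ - ε * Real.exp (β * n₀) * a - m * a ^ 2)
      (r₁ * t₀ + r₀ * t₁ - ε * Real.exp (β * n₀) * (β * n₁ * a + h₁) - 2 * m * a * h₁)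
      (r₂ * t₀ + 2 * r₁ * t₁ + r₀ * t₂ - 2 * s₁ ^ 2 - ε * Real.exp (β * n₀) *
          ((β ^ 2 * n₁ ^ 2 + β * n₂) * a + 2 * β * n₁ * h₁ + h₂ + 4 * (p₁ ^ 2 + q₁ ^ 2) * a) -
        m * (2 * h₁ ^ 2 + 2 * a * h₂ + 4 * (p₁ ^ 2 + q₁ ^ 2) * a ^ 2)) := by
  have w := ((HasJet2.const (1 : ℝ)).add (hp.mul hp)).add (hq.mul hq)
  have e := ((HasJet2.const β).mul hn).exp
  have k := (w.mul w).mul ((((HasJet2.const ε).mul e).mul hh).add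
    ((HasJet2.const m).mul (hh.mul hh)))
  convert ((hr.mul ht).sub (hs.mul hs)).sub k using 1
  · ext τ; ring
  all_goals ring

/-- The algebraic identity behind the maximum principle for the quotient of the Gauss curvature
by the squared support function. -/
theorem quotient_identity {a r t X Y C₀ C₁ C₂ C₃ D₀ D₂ D₄ k β m : ℝ}
    (tr : r + t = -(1 / 2) * a) (tr_x : C₀ + C₂ = 1 / 2 * X * r) (tr_y : C₁ + C₃ = 1 / 2 * Y * t)
    (tr_xx : D₀ + D₂ + 2 * r ^ 2 * t - 1 / 2 * (r + X * C₀ + Y * C₁) + r ^ 2 * a = 0)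
    (tr_yy : D₂ + D₄ + 2 * t ^ 2 * r - 1 / 2 * (t + X * C₂ + Y * C₃) + t ^ 2 * a = 0)
    (F0 : r * t - k * a - m * a ^ 2 = 0)
    (Fx : C₀ * t + r * C₂ - k * (β * (2 * X) * a + -(X * r)) - 2 * m * a * -(X * r) = 0)
    (Fy : C₁ * t + r * C₃ - k * (β * (2 * Y) * a + -(Y * t)) - 2 * m * a * -(Y * t) = 0) :
    a ^ 2 * ((D₀ * t + 2 * C₀ * C₂ + r * D₂ - 2 * C₁ ^ 2 - k *
          ((β ^ 2 * (2 * X) ^ 2 + β * (2 + 2 * a * r)) * a + 2 * β * (2 * X) * -(X * r) +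
            (-r - X * C₀ - Y * C₁ - a * r ^ 2) + 4 * (r ^ 2 + 0 ^ 2) * a) -
        m * (2 * (-(X * r)) ^ 2 + 2 * a * (-r - X * C₀ - Y * C₁ - a * r ^ 2) +
          4 * (r ^ 2 + 0 ^ 2) * a ^ 2)) +
      (D₂ * t + 2 * C₁ * C₃ + r * D₄ - 2 * C₂ ^ 2 - k *
          ((β ^ 2 * (2 * Y) ^ 2 + β * (2 + 2 * a * t)) * a + 2 * β * (2 * Y) * -(Y * t) +
            (-t - X * C₂ - Y * C₃ - a * t ^ 2) + 4 * (0 ^ 2 + t ^ 2) * a) -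
        m * (2 * (-(Y * t)) ^ 2 + 2 * a * (-t - X * C₂ - Y * C₃ - a * t ^ 2) +
          4 * (0 ^ 2 + t ^ 2) * a ^ 2))) =
    -(2 * (C₂ * a + X * r * t) ^ 2 + 2 * (C₂ * a) ^ 2 +
      2 * (C₁ * a + r * t * Y) ^ 2 + 2 * (C₁ * a) ^ 2) -
      k * a ^ 3 * (4 * β ^ 2 * (X ^ 2 + Y ^ 2) + β * (4 - (X ^ 2 + Y ^ 2 + a ^ 2)) +
        r ^ 2 + t ^ 2 - 1 / 2) := by
  obtain rfl : t = -(1 / 2) * a - r := by linarith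
  obtain rfl : C₀ = 1 / 2 * X * r - C₂ := by linarith
  obtain rfl : C₃ = 1 / 2 * Y * (-(1 / 2) * a - r) - C₁ := by linarith
  linear_combination (a ^ 2 * (-(1 / 2) * a - r)) * tr_xx + (a ^ 2 * r) * tr_yy +
    (a ^ 2 * X / 2 - 2 * a * X * r) * Fx +
    (a ^ 2 * Y / 2 - 2 * a * Y * (-(1 / 2) * a - r)) * Fy +
    (2 * (X * r) ^ 2 + 2 * a * (-r - X * (1 / 2 * X * r - C₂) - Y * C₁ - a * r ^ 2) +
      4 * r ^ 2 * a ^ 2 + 2 * (Y * (-(1 / 2) * a - r)) ^ 2 +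
      2 * a * (-(-(1 / 2) * a - r) - X * C₂ - Y * (1 / 2 * Y * (-(1 / 2) * a - r) - C₁) -
        a * (-(1 / 2) * a - r) ^ 2) + 4 * (-(1 / 2) * a - r) ^ 2 * a ^ 2 +
      a * X ^ 2 * r - 4 * X ^ 2 * r ^ 2 + a * Y ^ 2 * (-(1 / 2) * a - r) -
      4 * Y ^ 2 * (-(1 / 2) * a - r) ^ 2) * F0

set_option maxHeartbeats 1000000 in
/-- At a minimum of a perturbation of the quotient of the Gauss curvature by the squared support
function. -/
theorem exists_of_perturbed_min {S : Surface3} (hS : IsShrinker S) {p : E3} (hp : p ∈ S.carrier)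
    (hpos : ∀ x ∈ S.carrier, 0 < S.supp x) {ε β : ℝ}
    (hmin : ∀ x ∈ S.carrier,
      S.gaussCurv p / S.supp p ^ 2 - ε * Real.exp (β * ‖p‖ ^ 2) / S.supp p ≤
        S.gaussCurv x / S.supp x ^ 2 - ε * Real.exp (β * ‖x‖ ^ 2) / S.supp x) :
    ∃ r t τ : ℝ, r + t = -(1 / 2) * S.supp p ∧ S.gaussCurv p = r * t ∧
      ‖p‖ ^ 2 = τ + S.supp p ^ 2 ∧ 0 ≤ τ ∧
      (r * t) ^ 2 * τ + ε * Real.exp (β * ‖p‖ ^ 2) * S.supp p ^ 3 *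
        (4 * β ^ 2 * τ + β * (4 - ‖p‖ ^ 2) + r ^ 2 + t ^ 2 - 1 / 2) ≤ 0 := by
  obtain ⟨b, O, u, hb, h, hs⟩ := exists_diagonal_chart S hp
  obtain ⟨C₀, C₁, C₂, C₃, D₀, D₁, D₂, D₃, D₄, j⟩ := h.baseJets hS hb hs
  obtain ⟨hx, hy⟩ := h.hasJet2_support j
  have hK := h.gaussCurv_eq h.base_mem
  obtain ⟨hp0, hq0⟩ := h.Du_base hb
  have hn := IsGraphChart.norm_sq_gr b u (pr b p)
  rw [h.gr_base] at hK hn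
  rw [hp0, hq0, hs] at hK
  rw [h.u_base, hb, real_inner_comm] at hn
  set z := pr b p
  set r := dx (dx u) z
  set t := dy (dy u) z
  change HasJet2 (fun τ => S.supp (gr b u (z + (τ, 0)))) (S.supp p) _ _ at hx
  change HasJet2 (fun τ => S.supp (gr b u (z + (0, τ)))) (S.supp p) _ _ at hy
  change BaseJets u z (S.supp p) r t C₀ C₁ C₂ C₃ D₀ D₁ D₂ D₃ D₄ at j
  change _ = _ + S.supp p ^ 2 at hn
  have ha := hpos p hp
  rw [show ⟪p, S.ν p⟫ = S.supp p from rfl] at hx hy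
  set a := S.supp p
  set E := Real.exp (β * ‖p‖ ^ 2) with hE
  set m := S.gaussCurv p / a ^ 2 - ε * E / a with hm
  have hKp : S.gaussCurv p = r * t := by linarith
  have F0 : r * t - ε * E * a - m * a ^ 2 = 0 := by
    rw [hm, hKp]
    field_simp
    ring
  have cmp : ∀ y ∈ O, 0 ≤ dx (dx u) y * dy (dy u) y - dy (dx u) y ^ 2 -
      (1 + dx u y ^ 2 + dy u y ^ 2) ^ 2 * (ε * Real.exp (β * (y.1 ^ 2 + y.2 ^ 2 + u y ^ 2)) *
        S.supp (gr b u y) + m * S.supp (gr b u y) ^ 2) := by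
    intro y hy
    have h1 := hmin _ (h.mem y hy)
    have h2 := hpos _ (h.mem y hy)
    rw [← h.gaussCurv_eq hy, ← IsGraphChart.norm_sq_gr b u y]
    set w := S.supp (gr b u y)
    have h3 : m * w ^ 2 ≤ S.gaussCurv (gr b u y) - ε * Real.exp (β * ‖gr b u y‖ ^ 2) * w := by
      have h4 := mul_le_mul_of_nonneg_right h1 (sq_nonneg w)
      refine h4.trans_eq ?_
      field_simp
    linear_combination mul_le_mul_of_nonneg_left h3 (sq_nonneg (1 + dx u y ^ 2 + dy u y ^ 2))
  have jx := hasJet2_comparison ε β m j.px j.qx j.rx j.sx j.tx hx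
    (hasJet2_norm_sq (hasJet2_affine_add z.1 1) (hasJet2_affine_add z.2 0) j.ux)
  have jy := hasJet2_comparison ε β m j.py j.qy j.ry j.sy j.ty hy
    (hasJet2_norm_sq (hasJet2_affine_add z.1 0) (hasJet2_affine_add z.2 1) j.uy)
  rw [← hn, ← hE, F0] at jx jy
  obtain ⟨Fx, Fxx⟩ := jx.hasDerivAt_of_isLocalMin (by
    filter_upwards [h.eventually_x_mem h.base_mem] with τ hτ
    simpa using cmp _ hτ)
  obtain ⟨Fy, Fyy⟩ := jy.hasDerivAt_of_isLocalMin (by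
    filter_upwards [h.eventually_y_mem h.base_mem] with τ hτ
    simpa using cmp _ hτ)
  have id := quotient_identity (k := ε * E) (β := β) j.trace j.trace_x j.trace_y j.trace_xx
    j.trace_yy F0 (by linarith) (by linarith)
  refine ⟨r, t, z.1 ^ 2 + z.2 ^ 2, j.trace, hKp, hn, by positivity, ?_⟩
  rw [hn]
  have pos := mul_nonneg (sq_nonneg a) (add_nonneg Fxx Fyy)
  linear_combination pos + id + sq_nonneg (2 * (C₂ * a) + z.1 * r * t) +
    sq_nonneg (2 * (C₁ * a) + r * t * z.2)

end PerturbedMinimum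

section UmbilicalShrinker

open Filter Topology Set

theorem le_of_forall_small {c g C ε₀ : ℝ} (hε₀ : 0 < ε₀) (hC : 0 < C)
    (h : ∀ ε, 0 < ε → ε ≤ ε₀ → c - ε * C ≤ g) : c ≤ g := by
  by_contra! hlt
  have h1 : 0 < min ε₀ ((c - g) / (2 * C)) := lt_min hε₀ (by have := sub_pos.2 hlt; positivity)
  have h2 := h _ h1 (min_le_left _ _)
  have h3 : min ε₀ ((c - g) / (2 * C)) * C ≤ (c - g) / 2 :=
    (mul_le_mul_of_nonneg_right (min_le_right _ _) hC.le).trans_eq (by field_simp)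
  linarith

theorem exists_pos_upper_bound {K : Set E3} (hK : IsCompact K) {f : E3 → ℝ} (hf : ContinuousOn f K) :
    ∃ C, 0 < C ∧ ∀ x ∈ K, f x ≤ C := by
  obtain ⟨C, hC⟩ := hK.bddAbove_image hf
  exact ⟨max C 1, by positivity, fun x hx => (hC (mem_image_of_mem f hx)).trans (le_max_left _ _)⟩

/-- A lower bound at all minima of small perturbations is a lower bound. -/
theorem le_quotient_of_perturbed {S : Surface3} (hcpt : IsCompact S.carrier)
    (hpos : ∀ x ∈ S.carrier, 0 < S.supp x) {ε₀ c : ℝ} (β : ℝ) (hε₀ : 0 < ε₀)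
    (h : ∀ ε, 0 < ε → ε ≤ ε₀ → ∀ p ∈ S.carrier, (∀ x ∈ S.carrier,
      S.gaussCurv p / S.supp p ^ 2 - ε * Real.exp (β * ‖p‖ ^ 2) / S.supp p ≤
        S.gaussCurv x / S.supp x ^ 2 - ε * Real.exp (β * ‖x‖ ^ 2) / S.supp x) →
      c ≤ S.gaussCurv p / S.supp p ^ 2) :
    ∀ x ∈ S.carrier, c ≤ S.gaussCurv x / S.supp x ^ 2 := by
  intro x hx
  have hs := S.continuousOn_supp
  have hE : ContinuousOn (fun x : E3 => Real.exp (β * ‖x‖ ^ 2)) S.carrier := by fun_prop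
  obtain ⟨C, hC, hCle⟩ := exists_pos_upper_bound hcpt (hE.div hs fun y hy => (hpos y hy).ne')
  refine le_of_forall_small hε₀ hC fun ε hε hεle => ?_
  obtain ⟨p, hp, hmin⟩ := hcpt.exists_isMinOn ⟨x, hx⟩
    ((S.continuousOn_gaussCurv.div (hs.pow 2) fun y hy => (pow_pos (hpos y hy) 2).ne').sub
      ((continuousOn_const (c := ε) |>.mul hE).div hs fun y hy => (hpos y hy).ne'))
  have hmin' := isMinOn_iff.1 hmin
  have h1 := h ε hε hεle p hp hmin'
  have h2 := hmin' x hx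
  have h3 := mul_le_mul_of_nonneg_left (hCle p hp) hε.le
  have h4 : 0 ≤ ε * Real.exp (β * ‖x‖ ^ 2) / S.supp x := by
    have := hpos x hx
    positivity
  simp only [mul_div_assoc] at h2 h4
  simp only [Pi.div_apply] at h3
  simp only [Pi.sub_apply, Pi.div_apply, Pi.mul_apply, Pi.pow_apply] at h2
  linarith

theorem gaussCurv_le {S : Surface3} (hS : IsShrinker S) {p : E3} (hp : p ∈ S.carrier) :
    S.gaussCurv p ≤ 1 / 16 * S.supp p ^ 2 := by
  obtain ⟨b, O, u, hb, h, hs⟩ := exists_diagonal_chart S hp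
  obtain ⟨C₀, C₁, C₂, C₃, D₀, D₁, D₂, D₃, D₄, j⟩ := h.baseJets hS hb hs
  have hK := h.gaussCurv_eq h.base_mem
  obtain ⟨hp0, hq0⟩ := h.Du_base hb
  rw [h.gr_base, hp0, hq0, hs] at hK
  have tr := j.trace
  change _ = _ * S.supp p at tr
  have ha : S.supp p = -2 * (dx (dx u) (pr b p) + dy (dy u) (pr b p)) := by linarith
  rw [ha]
  nlinarith [sq_nonneg (dx (dx u) (pr b p) - dy (dy u) (pr b p))]

theorem sq_norm_eq_sq_supp {S : Surface3} (hS : IsShrinker S) (hcpt : IsCompact S.carrier)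
    (hpos : ∀ x ∈ S.carrier, 0 < S.supp x) : ∀ x ∈ S.carrier, ‖x‖ ^ 2 = S.supp x ^ 2 := by
  have hs := S.continuousOn_supp
  obtain ⟨A, hA, hAle⟩ := exists_pos_upper_bound hcpt (hs.pow 2)
  have step1 := le_quotient_of_perturbed (c := 1 / (4 * A)) hcpt hpos (1 / 4) one_pos
    fun ε hε _ p hp hmin => by
      obtain ⟨r, t, τ, tr, hK, hn, hτ, hle⟩ := exists_of_perturbed_min hS hp hpos hmin
      have ha := hpos p hp
      have hAp := hAle p hp
      have e : 4 * (1 / 4) ^ 2 * τ + 1 / 4 * (4 - ‖p‖ ^ 2) + r ^ 2 + t ^ 2 - 1 / 2 =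
          1 / 2 - 2 * (r * t) := by
        have : S.supp p = -2 * (r + t) := by linarith
        rw [hn, this]; ring
      rw [e] at hle
      have hrt : 1 / 4 ≤ r * t := by
        by_contra! hlt
        have : 0 < ε * Real.exp (1 / 4 * ‖p‖ ^ 2) * S.supp p ^ 3 * (1 / 2 - 2 * (r * t)) :=
          mul_pos (by positivity) (by linarith)
        nlinarith [mul_nonneg (sq_nonneg (r * t)) hτ]
      rw [hK, div_le_div_iff₀ (by positivity) (by positivity)]
      simp only [Pi.pow_apply] at hAp
      nlinarith
  have hKpos : ∀ x ∈ S.carrier, 0 < S.gaussCurv x := fun x hx => by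
    have h1 := (by positivity : 0 < 1 / (4 * A)).trans_le (step1 x hx)
    exact (div_pos_iff_of_pos_right (pow_pos (hpos x hx) 2)).1 h1
  obtain ⟨B, hB, hBle⟩ := exists_pos_upper_bound hcpt (f := fun x =>
    Real.exp (1 / 8 * ‖x‖ ^ 2) * S.supp x ^ 3 / 16 / S.gaussCurv x ^ 2)
    (ContinuousOn.div (by fun_prop) (S.continuousOn_gaussCurv.pow 2)
      fun x hx => (pow_pos (hKpos x hx) 2).ne')
  have step2 := le_quotient_of_perturbed (c := 1 / 16) hcpt hpos (1 / 8) (inv_pos.2 hB)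
    fun ε hε hεle p hp hmin => by
      obtain ⟨r, t, τ, tr, hK, hn, hτ, hle⟩ := exists_of_perturbed_min hS hp hpos hmin
      have ha := hpos p hp
      have hBp := hBle p hp
      have hKp := hKpos p hp
      have ea : S.supp p = -2 * (r + t) := by linarith
      have e : 4 * (1 / 8) ^ 2 * τ + 1 / 8 * (4 - ‖p‖ ^ 2) + r ^ 2 + t ^ 2 - 1 / 2 =
          -(τ / 16) + 1 / 2 * (r - t) ^ 2 := by
        rw [hn, ea]; ring
      rw [e, ← hK] at hle
      rw [div_le_iff₀ (by positivity)] at hBp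
      have h1 : ε * (Real.exp (1 / 8 * ‖p‖ ^ 2) * S.supp p ^ 3 / 16) ≤ S.gaussCurv p ^ 2 := by
        refine (mul_le_mul hεle hBp (by positivity) (by positivity)).trans_eq ?_
        field_simp
      have h2 : 0 < ε * Real.exp (1 / 8 * ‖p‖ ^ 2) * S.supp p ^ 3 := by positivity
      have h3 : r = t := by
        by_contra hne
        have := mul_pos h2 (sq_pos_of_ne_zero (sub_ne_zero.2 hne))
        nlinarith [mul_le_mul_of_nonneg_right h1 hτ]
      rw [le_div_iff₀ (by positivity), hK, ea, h3]
      linarith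
  have hG : ∀ x ∈ S.carrier, S.gaussCurv x / S.supp x ^ 2 = 1 / 16 := fun x hx =>
    le_antisymm ((div_le_iff₀ (pow_pos (hpos x hx) 2)).2 (gaussCurv_le hS hx)) (step2 x hx)
  intro p hp
  obtain ⟨r, t, τ, tr, hK, hn, hτ, hle⟩ := exists_of_perturbed_min (ε := 0) (β := 0) hS hp hpos
    fun x hx => by rw [hG x hx, hG p hp]; simp
  rw [← hK] at hle
  have hτ0 : τ = 0 := by
    have := pow_pos (hKpos p hp) 2
    nlinarith
  rw [hn, hτ0, zero_add]

theorem norm_eq_two {S : Surface3} (hS : IsShrinker S)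
    (h : ∀ x ∈ S.carrier, ‖x‖ ^ 2 = S.supp x ^ 2) {p : E3} (hp : p ∈ S.carrier) : ‖p‖ = 2 := by
  obtain ⟨b, O, u, hb, hu, hs⟩ := exists_diagonal_chart S hp
  obtain ⟨C₀, C₁, C₂, C₃, D₀, D₁, D₂, D₃, D₄, j⟩ := hu.baseJets hS hb hs
  obtain ⟨hx, hy⟩ := hu.hasJet2_support j
  have hn := IsGraphChart.norm_sq_gr b u (pr b p)
  rw [hu.gr_base, hu.u_base, hb, real_inner_comm] at hn
  have hn' := h p hp
  have tr := j.trace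
  have nx := hasJet2_norm_sq (hasJet2_affine_add (pr b p).1 1) (hasJet2_affine_add (pr b p).2 0)
    j.ux
  have ny := hasJet2_norm_sq (hasJet2_affine_add (pr b p).1 0) (hasJet2_affine_add (pr b p).2 1)
    j.uy
  change _ = _ * S.supp p at tr
  change _ = _ + S.supp p ^ 2 at hn
  rw [show ⟪p, S.ν p⟫ = S.supp p from rfl] at hx hy nx ny
  have hX : (pr b p).1 = 0 := by
    apply pow_eq_zero_iff two_ne_zero |>.1
    nlinarith [sq_nonneg (pr b p).1, sq_nonneg (pr b p).2]
  have hY : (pr b p).2 = 0 := by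
    apply pow_eq_zero_iff two_ne_zero |>.1
    nlinarith [sq_nonneg (pr b p).1, sq_nonneg (pr b p).2]
  obtain ⟨-, -, x2⟩ := nx.unique ((hx.mul hx).congr (by
    filter_upwards [hu.eventually_x_mem hu.base_mem] with τ hτ
    have := h _ (hu.mem _ hτ)
    rw [IsGraphChart.norm_sq_gr, pow_two (S.supp _)] at this
    simpa [Surface3.supp] using this))
  obtain ⟨-, -, y2⟩ := ny.unique ((hy.mul hy).congr (by
    filter_upwards [hu.eventually_y_mem hu.base_mem] with τ hτ
    have := h _ (hu.mem _ hτ)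
    rw [IsGraphChart.norm_sq_gr, pow_two (S.supp _)] at this
    simpa [Surface3.supp] using this))
  rw [hX, hY] at x2 y2
  have x3 : S.supp p * dx (dx u) (pr b p) + 1 = 0 := by
    apply pow_eq_zero_iff two_ne_zero |>.1
    linarith
  have y3 : S.supp p * dy (dy u) (pr b p) + 1 = 0 := by
    apply pow_eq_zero_iff two_ne_zero |>.1
    linarith
  have h4 : ‖p‖ ^ 2 = 2 ^ 2 := by
    rw [hn']
    linear_combination -2 * x3 - 2 * y3 + 2 * S.supp p * tr
  exact (pow_left_inj₀ (norm_nonneg p) (by norm_num) two_ne_zero).1 h4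

theorem carrier_eq_sphere {S : Surface3} (hS : IsShrinker S) (hcpt : IsCompact S.carrier)
    (hnt : S.carrier.Nontrivial) (h : ∀ x ∈ S.carrier, ‖x‖ ^ 2 = S.supp x ^ 2) :
    S.carrier = Metric.sphere (0 : E3) 2 := by
  have hsub : ∀ x ∈ S.carrier, ‖x‖ = 2 := fun x hx => norm_eq_two hS h hx
  refine Subset.antisymm (fun x hx => mem_sphere_zero_iff_norm.2 (hsub x hx)) fun q hq => ?_
  rw [mem_sphere_zero_iff_norm] at hq
  obtain ⟨p, hp, hmax⟩ := hcpt.exists_isMinOn (f := fun x => -⟪x, q⟫) hnt.nonempty (by fun_prop)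
  have hmax' := isMinOn_iff.1 hmax
  obtain ⟨b, γ, δ, r, t, hb, hγ, hδ, jγ, jδ, -⟩ := exists_frame hS hp
  obtain ⟨h0, -⟩ := (jγ.inner (HasJet2.const q)).neg.hasDerivAt_of_isLocalMin (by
    filter_upwards [hγ] with s hs using hmax' _ hs)
  obtain ⟨h1, -⟩ := (jδ.inner (HasJet2.const q)).neg.hasDerivAt_of_isLocalMin (by
    filter_upwards [hδ] with s hs using hmax' _ hs)
  rw [inner_zero_right, zero_add, neg_eq_zero, real_inner_comm] at h0 h1
  have hpp := inner_eq_sum_basis b p p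
  have hpq := inner_eq_sum_basis b p q
  have hqq := inner_eq_sum_basis b q q
  have hp' : S.supp p ^ 2 = 4 := by rw [← h p hp, hsub p hp]; norm_num
  rw [h0, h1, hb] at hpq hqq
  rw [real_inner_self_eq_norm_sq, hq] at hqq
  change _ = _ + _ + S.supp p * _ at hpq
  have h2 : (⟪p, q⟫ - 4) * (⟪p, q⟫ + 4) = 0 := by
    rw [hpq]
    linear_combination ⟪q, S.ν p⟫ ^ 2 * hp' - 4 * hqq
  rcases mul_eq_zero.1 h2 with h3 | h3
  · have h4 : ‖p - q‖ ^ 2 = 0 := by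
      rw [norm_sub_sq_real, hsub p hp, hq]
      linarith
    rwa [← sub_eq_zero.1 (norm_eq_zero.1 (pow_eq_zero_iff two_ne_zero |>.1 h4))]
  · exfalso
    have h4 : ∀ x ∈ S.carrier, x = -q := fun x hx => by
      have h5 : ‖x + q‖ ^ 2 ≤ 0 := by
        rw [norm_add_sq_real, hsub x hx, hq]
        linarith [hmax' x hx]
      exact eq_neg_of_add_eq_zero_left
        (norm_eq_zero.1 (pow_eq_zero_iff two_ne_zero |>.1 (h5.antisymm (sq_nonneg _))))
    obtain ⟨x, hx, y, hy, hxy⟩ := hnt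
    exact hxy ((h4 x hx).trans (h4 y hy).symm)

end UmbilicalShrinker

/-- **Theorem 1 (main theorem).** A compact, embedded self-similar shrinker in `ℝ³`
of genus 0 (i.e. homeomorphic to the 2-sphere) is the round sphere of radius 2
centered at the origin. -/
theorem compact_genus_zero_shrinker_is_round_sphere
    (S : Surface3) (hS : IsShrinker S) (hcpt : IsCompact S.carrier)
    (hgenus0 : Nonempty (S.carrier ≃ₜ (Metric.sphere (0 : E3) 1 : Set E3))) :
    S.carrier = Metric.sphere (0 : E3) 2 := by
  obtain ⟨e⟩ := hgenus0
  have hrank : 1 < Module.rank ℝ E3 := by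
    rw [← Module.finrank_eq_rank, finrank_euclideanSpace_fin]
    norm_num
  have hsph : IsConnected (Metric.sphere (0 : E3) 1) := isConnected_sphere hrank 0 zero_le_one
  have : PreconnectedSpace (Metric.sphere (0 : E3) 1) :=
    isPreconnected_iff_preconnectedSpace.1 hsph.isPreconnected
  have hconn : IsPreconnected S.carrier := by
    rw [isPreconnected_iff_preconnectedSpace]
    exact ⟨by simpa using isPreconnected_univ.image e.symm e.symm.continuous.continuousOn⟩
  have hnt : S.carrier.Nontrivial := by
    rw [← Set.nontrivial_coe_sort]
    obtain ⟨v, hv⟩ := hsph.nonempty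
    have : Nontrivial (Metric.sphere (0 : E3) 1) := by
      refine ⟨⟨v, hv⟩, ⟨-v, by simpa using hv⟩, fun heq => ?_⟩
      have h2 : (2 : ℝ) • v = 0 := by
        rw [two_smul]
        exact add_eq_zero_iff_eq_neg.2 (Subtype.ext_iff.1 heq)
      have h0 : v = 0 := (smul_eq_zero.1 h2).resolve_left two_ne_zero
      simp [h0] at hv
    exact e.symm.injective.nontrivial
  obtain ⟨S', hc, hS', hpos⟩ := exists_supp_pos hS hcpt e hconn hnt
  rw [← hc] at hcpt hnt ⊢
  exact carrier_eq_sphere hS' hcpt hnt (sq_norm_eq_sq_supp hS' hcpt hpos)
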